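/- The ℤ[δ,δ⁻¹]-algebra homomorphism φ : Br(F4) → Br(E6) determined by φ(r_1) = R_1R_6, φ(r_2) = R_3R_5, φ(r_3) = R_4, φ(r_4) = R_2, φ(e_1) = E_1E_6, φ(e_2) = E_3E_5, φ(e_3) = E_4, φ(e_4) = E_2 is injective, and its image equals SBr(E6), the ℤ[δ,δ⁻¹]-subalgebra of Br(E6) generated by the σ-invariant elements of the submonoid of the multiplicative monoid of Br(E6) generated by δ·1, δ⁻¹·1 and the elements R_1,…,R_6, E_1,…,E_6. In particular φ induces a ℤ[δ,δ⁻¹]-algebra isomorphism Br(F4) ≅ SBr(E6). -/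

import Mathlib

open LaurentPolynomial

/-- The base ring `ℤ[δ, δ⁻¹]` of Laurent polynomials over `ℤ`. -/
abbrev Rring : Type := LaurentPolynomial ℤ

/-- The distinguished invertible element `δ`. -/
noncomputable def δ : Rring := LaurentPolynomial.T 1

/-- Generators of the Brauer algebra of type F₄: `r i` and `e i` for the four nodes
(the node `i : Fin 4` corresponds to the node `i+1` in the usual 1-based labelling). -/
inductive GenF4 : Type
  | r : Fin 4 → GenF4
  | e : Fin 4 → GenF4

namespace BrF4rel

/-- `R i` in the free algebra. -/
noncomputable abbrev R (i : Fin 4) : FreeAlgebra Rring GenF4 := FreeAlgebra.ι Rring (GenF4.r i)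
/-- `E i` in the free algebra. -/
noncomputable abbrev E (i : Fin 4) : FreeAlgebra Rring GenF4 := FreeAlgebra.ι Rring (GenF4.e i)

/-- Non-adjacent (0-based) pairs of nodes of the F₄ diagram: `{1,3}, {1,4}, {2,4}` 1-based. -/
def nadj (i j : Fin 4) : Prop :=
  (i, j) ∈ ([(0, 2), (2, 0), (0, 3), (3, 0), (1, 3), (3, 1)] : List (Fin 4 × Fin 4))

/-- Simply bonded (0-based) pairs of nodes of the F₄ diagram: `{1,2}, {3,4}` 1-based. -/
def sadj (i j : Fin 4) : Prop :=
  (i, j) ∈ ([(0, 1), (1, 0), (2, 3), (3, 2)] : List (Fin 4 × Fin 4))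

/-- The defining relations of the Brauer algebra of type F₄ (0-based node labels:
node `i` here is node `i+1` in the paper). -/
inductive rel : FreeAlgebra Rring GenF4 → FreeAlgebra Rring GenF4 → Prop
  | rr (i : Fin 4) : rel (R i * R i) 1
  | re (i : Fin 4) : rel (R i * E i) (E i)
  | er (i : Fin 4) : rel (E i * R i) (E i)
  | ee_short (i : Fin 4) (h : i = 2 ∨ i = 3) : rel (E i * E i) (δ • E i)
  | ee_long (i : Fin 4) (h : i = 0 ∨ i = 1) : rel (E i * E i) ((δ ^ 2) • E i)
  | rr_comm {i j : Fin 4} (h : nadj i j) : rel (R i * R j) (R j * R i)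
  | er_comm {i j : Fin 4} (h : nadj i j) : rel (E i * R j) (R j * E i)
  | ee_comm {i j : Fin 4} (h : nadj i j) : rel (E i * E j) (E j * E i)
  | braid {i j : Fin 4} (h : sadj i j) : rel (R i * R j * R i) (R j * R i * R j)
  | rre {i j : Fin 4} (h : sadj i j) : rel (R j * R i * E j) (E i * E j)
  | rer {i j : Fin 4} (h : sadj i j) : rel (R i * E j * R i) (R j * E i * R j)
  | db1 : rel (R 1 * R 2 * R 1 * R 2) (R 2 * R 1 * R 2 * R 1)
  | db2 : rel (R 1 * R 2 * E 1) (R 2 * E 1)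
  | db3 : rel (R 1 * E 2 * R 1 * E 2) (E 2 * E 1 * E 2)
  | db4 : rel (R 1 * R 2 * R 1 * E 2) (E 2 * (R 1 * R 2 * R 1))
  | db5 : rel (E 1 * R 2 * E 1) (δ • E 1)
  | db6 : rel (E 1 * E 2 * E 1) (δ • E 1)
  | db7 : rel (E 1 * R 2 * R 1) (E 1 * R 2)
  | db8 : rel (E 1 * E 2 * R 1) (E 1 * E 2)

end BrF4rel

/-- The Brauer algebra of type F₄ over `ℤ[δ, δ⁻¹]`. -/
noncomputable abbrev BrF4 : Type := RingQuot BrF4rel.rel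

/-- The generator `r i` (0-based) of `BrF4`. -/
noncomputable def rgen (i : Fin 4) : BrF4 :=
  RingQuot.mkAlgHom Rring BrF4rel.rel (BrF4rel.R i)

/-- The generator `e i` (0-based) of `BrF4`. -/
noncomputable def egen (i : Fin 4) : BrF4 :=
  RingQuot.mkAlgHom Rring BrF4rel.rel (BrF4rel.E i)

/-- Generators of the Brauer algebra of type E₆: `R i` and `E i` for the six nodes
(the node `i : Fin 6` corresponds to the node `i+1` in the usual 1-based labelling). -/
inductive GenE6 : Type
  | r : Fin 6 → GenE6
  | e : Fin 6 → GenE6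

namespace BrE6rel

noncomputable abbrev R (i : Fin 6) : FreeAlgebra Rring GenE6 := FreeAlgebra.ι Rring (GenE6.r i)
noncomputable abbrev E (i : Fin 6) : FreeAlgebra Rring GenE6 := FreeAlgebra.ι Rring (GenE6.e i)

/-- Adjacent (0-based) pairs of nodes of the E₆ diagram,
whose edges are (1-based) `{1,3}, {3,4}, {4,5}, {5,6}, {2,4}`. -/
def adj (i j : Fin 6) : Prop :=
  (i, j) ∈ ([(0, 2), (2, 0), (2, 3), (3, 2), (3, 4), (4, 3), (4, 5), (5, 4), (1, 3), (3, 1)] :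
    List (Fin 6 × Fin 6))

/-- Non-adjacent pairs: distinct non-adjacent nodes. -/
def nadj (i j : Fin 6) : Prop := i ≠ j ∧ ¬ adj i j

/-- The defining relations of the Brauer algebra of type E₆ (0-based node labels). -/
inductive rel : FreeAlgebra Rring GenE6 → FreeAlgebra Rring GenE6 → Prop
  | rr (i : Fin 6) : rel (R i * R i) 1
  | re (i : Fin 6) : rel (R i * E i) (E i)
  | er (i : Fin 6) : rel (E i * R i) (E i)
  | ee (i : Fin 6) : rel (E i * E i) (δ • E i)
  | rr_comm {i j : Fin 6} (h : nadj i j) : rel (R i * R j) (R j * R i)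
  | er_comm {i j : Fin 6} (h : nadj i j) : rel (E i * R j) (R j * E i)
  | ee_comm {i j : Fin 6} (h : nadj i j) : rel (E i * E j) (E j * E i)
  | braid {i j : Fin 6} (h : adj i j) : rel (R i * R j * R i) (R j * R i * R j)
  | rre {i j : Fin 6} (h : adj i j) : rel (R j * R i * E j) (E i * E j)
  | rer {i j : Fin 6} (h : adj i j) : rel (R i * E j * R i) (R j * E i * R j)

end BrE6rel

/-- The Brauer algebra of type E₆ over `ℤ[δ, δ⁻¹]`. -/
noncomputable abbrev BrE6 : Type := RingQuot BrE6rel.rel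

/-- The generator `R i` (0-based) of `BrE6`. -/
noncomputable def Rgen (i : Fin 6) : BrE6 :=
  RingQuot.mkAlgHom Rring BrE6rel.rel (BrE6rel.R i)

/-- The generator `E i` (0-based) of `BrE6`. -/
noncomputable def Egen (i : Fin 6) : BrE6 :=
  RingQuot.mkAlgHom Rring BrE6rel.rel (BrE6rel.E i)

/-- The diagram automorphism `(1 6)(3 5)` of the E₆ diagram, in 0-based labels `0↔5, 2↔4`. -/
def τ : Fin 6 → Fin 6 := ![5, 1, 4, 3, 2, 0]

/-- The monoid of monomials of `Br(E₆)`: the submonoid of the multiplicative monoid of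
`Br(E₆)` generated by `δ·1`, `δ⁻¹·1` and the generators `R i`, `E i`. -/
noncomputable def BrMonE6 : Submonoid BrE6 :=
  Submonoid.closure
    ({algebraMap Rring BrE6 δ, algebraMap Rring BrE6 (LaurentPolynomial.T (-1))}
      ∪ Set.range Rgen ∪ Set.range Egen)

/-- The subalgebra `SBr(E₆)` generated by the `σ`-invariant monomials of `Br(E₆)`. -/
noncomputable def SBrE6 (σ : BrE6 ≃ₐ[Rring] BrE6) : Subalgebra Rring BrE6 :=
  Algebra.adjoin Rring {a : BrE6 | a ∈ BrMonE6 ∧ σ a = a}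


/-! ### Completion of rewriting systems on monoids -/

/-- The value in a monoid of a word, given the values of its letters. -/
def wordProd {M : Type*} [Monoid M] (g : ℕ → M) (w : List ℕ) : M := (w.map g).prod

section wordProd

variable {M : Type*} [Monoid M] (g : ℕ → M)

@[simp] theorem wordProd_nil : wordProd g [] = 1 := rfl

@[simp] theorem wordProd_cons (a : ℕ) (w : List ℕ) : wordProd g (a :: w) = g a * wordProd g w := by
  simp [wordProd]

@[simp] theorem wordProd_append (v w : List ℕ) :
    wordProd g (v ++ w) = wordProd g v * wordProd g w := by
  simp [wordProd]

theorem wordProd_congr_middle {l r : List ℕ} (h : wordProd g l = wordProd g r) (p q : List ℕ) :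
    wordProd g (p ++ l ++ q) = wordProd g (p ++ r ++ q) := by
  simp [h]

end wordProd

/-- A trie of rewriting rules. The left-hand sides are read from right to left; a node holds a
letter, the right-hand side of the rule ending there (if any), the trie of continuations, and the
trie of alternatives to its letter. -/
inductive RuleTrie : Type
  | nil : RuleTrie
  | node : ℕ → Option (List ℕ) → RuleTrie → RuleTrie → RuleTrie

namespace RuleTrie

/-- Find a rule whose left-hand side ends the given stack of letters (topmost letter first);
returns its right-hand side and the rest of the stack. -/
noncomputable def find (t : RuleTrie) : List ℕ → Option (List ℕ × List ℕ) :=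
  RuleTrie.rec (fun _ => none)
    (fun a v _ _ fk fs s => List.rec none
      (fun b s' _ => Bool.rec (fs s) (Option.rec (fk s') (fun r => some (r, s')) v)
        (Nat.beq a b)) s) t

/-- The right-hand side stored at exactly the given reversed left-hand side. -/
def get : RuleTrie → List ℕ → Option (List ℕ)
  | nil, _ => none
  | node _ _ _ _, [] => none
  | node a v kid sib, b :: s =>
    match Nat.beq a b with
    | true => match s with
      | [] => v
      | c :: s' => get kid (c :: s')
    | false => get sib (b :: s)

theorem get_cons (a : ℕ) (v : Option (List ℕ)) (kid sib : RuleTrie) (b : ℕ) (s : List ℕ) :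
    (node a v kid sib).get (b :: s) =
      if a = b then (match s with | [] => v | c :: s' => kid.get (c :: s')) else sib.get (b :: s) := by
  by_cases h : a = b
  · subst h
    cases s <;> simp [get]
  · have : Nat.beq a b = false := by
      rw [← Bool.not_eq_true, Nat.beq_eq]; exact h
    cases s <;> simp [get, h, this]

/-- The trie with a single rule. -/
def single (r : List ℕ) : List ℕ → RuleTrie
  | [] => nil
  | b :: s => match s with
    | [] => node b (some r) nil nil
    | c :: s' => node b none (single r (c :: s')) nil

/-- Add a rule to a trie. -/
def insert (r : List ℕ) : RuleTrie → List ℕ → RuleTrie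
  | nil, s => single r s
  | node a v kid sib, [] => node a v kid sib
  | node a v kid sib, b :: s =>
    match Nat.beq a b with
    | true => match s with
      | [] => node a (some r) kid sib
      | c :: s' => node a v (insert r kid (c :: s')) sib
    | false => node a v kid (insert r sib (b :: s))

theorem insert_cons (r : List ℕ) (a : ℕ) (v : Option (List ℕ)) (kid sib : RuleTrie) (b : ℕ)
    (s : List ℕ) : (node a v kid sib).insert r (b :: s) =
      if a = b then
        (match s with
          | [] => node a (some r) kid sib
          | c :: s' => node a v (kid.insert r (c :: s')) sib)
      else node a v kid (sib.insert r (b :: s)) := by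
  by_cases h : a = b
  · subst h
    cases s <;> simp [insert]
  · have : Nat.beq a b = false := by
      rw [← Bool.not_eq_true, Nat.beq_eq]; exact h
    cases s <;> simp [insert, h, this]

/-- Rewrite the word `st`, moving its letters one at a time to the stack `out`. -/
noncomputable def reduce (t : RuleTrie) (n : ℕ) : List ℕ → List ℕ → List ℕ :=
  Nat.rec (fun out st => st.reverseAux out)
    (fun _ ih out st => List.rec out
      (fun b st' _ => id (Option.rec (ih (b :: out) st') (fun p => ih p.2 (p.1 ++ st'))
        (t.find (b :: out)))) st) n

/-- The normal form of a word, reversed. -/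
noncomputable def nf (t : RuleTrie) (w : List ℕ) : List ℕ := t.reduce 1000 [] w

end RuleTrie

/-- Evaluate a function at a small number given by an expression to be computed first. -/
def withDigit {α : Type} (n : ℕ) (f : ℕ → α) : α :=
  match n with
  | 0 => f 0 | 1 => f 1 | 2 => f 2 | 3 => f 3 | 4 => f 4 | 5 => f 5 | 6 => f 6 | 7 => f 7
  | 8 => f 8 | 9 => f 9 | 10 => f 10 | 11 => f 11 | 12 => f 12 | 13 => f 13 | 14 => f 14
  | _ => f n

/-- Digits in base 16, least significant first, with bounded fuel. -/
def hexDigits : ℕ → ℕ → List ℕ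
  | 0, _ => []
  | _ + 1, 0 => []
  | k + 1, n + 1 => withDigit ((n + 1) % 16) fun d => d :: hexDigits k ((n + 1) / 16)

/-- Weighted length of a word. -/
def wordWeight (wt : ℕ → ℕ) (w : List ℕ) : ℕ := w.foldl (fun n a => n + wt a) 0

/-- A numerical key whose order is the weighted length-lexicographic one. -/
def wordKey (wt : ℕ → ℕ) (w : List ℕ) : ℕ := w.foldl (fun n a => n * 16 ^ wt a + a * 16 ^ (wt a - 1)) 0

namespace RuleTrie

/-- Orient and add an equation between two words, given reversed. -/
def addEq (wt : ℕ → ℕ) (t : RuleTrie) (a b : List ℕ) : RuleTrie :=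
  match Nat.blt (wordKey wt a.reverse) (wordKey wt b.reverse) with
  | true => t.insert a.reverse b
  | false => match Nat.blt (wordKey wt b.reverse) (wordKey wt a.reverse) with
    | true => t.insert b.reverse a
    | false => t

/-- Add an equation that follows from the rules present: the code `c` tells either to reduce
a word in two ways, or to reduce both sides of a rule. -/
noncomputable def step (wt : ℕ → ℕ) (t : RuleTrie) (c : ℕ) : RuleTrie :=
  let u := hexDigits 100 (c / 64)
  match c % 2 with
  | 0 => t.addEq wt (t.nf u) (t.nf (u.take (c / 2 % 32) ++ (t.nf (u.drop (c / 2 % 32))).reverse))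
  | _ + 1 => match t.get u.reverse with
    | none => t
    | some r => t.addEq wt (t.nf u) (t.nf r)

/-- Fold over a list, computing every intermediate trie. -/
noncomputable def foldTrie {α : Type} (f : RuleTrie → α → RuleTrie) (l : List α) (t : RuleTrie) :
    RuleTrie :=
  List.rec (fun t => t) (fun c _ ih t => id (RuleTrie.rec (motive := fun _ => RuleTrie) (ih nil)
    (fun a v kid sib _ _ => ih (node a v kid sib)) (f t c))) l t

/-- The rules obtained from the equations `base` by the completion steps `cs`. -/
noncomputable def complete (wt : ℕ → ℕ) (base : List (List ℕ × List ℕ)) (cs : List ℕ) : RuleTrie :=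
  foldTrie (step wt) cs (foldTrie (fun t p => t.addEq wt (t.nf p.1) (t.nf p.2)) base nil)

theorem foldTrie_cons {α : Type} (f : RuleTrie → α → RuleTrie) (c : α) (l : List α) (t : RuleTrie) :
    foldTrie f (c :: l) t = foldTrie f l (f t c) := by
  change RuleTrie.rec (motive := fun _ => RuleTrie) (foldTrie f l nil)
    (fun a v kid sib _ _ => foldTrie f l (node a v kid sib)) (f t c) = _
  cases f t c <;> rfl

/-- Every rule of the trie satisfies `P`, where `p` has been read off its left-hand side. -/
def All (P : List ℕ → List ℕ → Prop) : RuleTrie → List ℕ → Prop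
  | nil, _ => True
  | node a v kid sib, p =>
    (∀ r, v = some r → P (a :: p) r) ∧ All P kid (a :: p) ∧ All P sib p

/-- Boolean version of `RuleTrie.All`. -/
def all (P : List ℕ → List ℕ → Bool) : RuleTrie → List ℕ → Bool
  | nil, _ => true
  | node a v kid sib, p =>
    (match v with | none => true | some r => P (a :: p) r) && (all P kid (a :: p) && all P sib p)

theorem all_sound {P : List ℕ → List ℕ → Bool} :
    ∀ (t : RuleTrie) (p : List ℕ), t.all P p = true → t.All (fun l r => P l r = true) p
  | nil, _, _ => trivial
  | node a v kid sib, p, h => by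
    simp only [all, Bool.and_eq_true] at h
    refine ⟨?_, all_sound kid _ h.2.1, all_sound sib _ h.2.2⟩
    rintro r rfl
    exact h.1

variable {P : List ℕ → List ℕ → Prop}

theorem find_node_cons (a : ℕ) (v : Option (List ℕ)) (kid sib : RuleTrie) (b : ℕ) (s : List ℕ) :
    (node a v kid sib).find (b :: s) =
      if a = b then (match v with | some r => some (r, s) | none => kid.find s)
      else sib.find (b :: s) := by
  change Bool.rec (motive := fun _ => Option (List ℕ × List ℕ)) (sib.find (b :: s))
    (Option.rec (kid.find s) (fun r => some (r, s)) v) (Nat.beq a b) = _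
  by_cases h : a = b
  · subst h
    have : Nat.beq a a = true := by simp
    rw [this]
    cases v <;> simp
  · have : Nat.beq a b = false := by
      rw [← Bool.not_eq_true, Nat.beq_eq]; exact h
    rw [this]
    simp [h]

theorem find_sound : ∀ (t : RuleTrie) (p s : List ℕ), t.All P p → ∀ r rest,
    t.find s = some (r, rest) → ∃ q, s = q ++ rest ∧ P (q.reverse ++ p) r
  | nil, _, _, _, _, _, h => by cases h
  | node _ _ _ _, _, [], _, _, _, h => by cases h
  | node a v kid sib, p, b :: s, ht, r, rest, h => by
    rw [find_node_cons] at h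
    split_ifs at h with hab
    · subst hab
      cases v with
      | some r' =>
        simp only [Option.some.injEq, Prod.mk.injEq] at h
        obtain ⟨rfl, rfl⟩ := h
        exact ⟨[a], rfl, ht.1 _ rfl⟩
      | none =>
        obtain ⟨q, rfl, hq⟩ := find_sound kid (a :: p) s ht.2.1 r rest h
        exact ⟨a :: q, rfl, by simpa using hq⟩
    · exact find_sound sib p (b :: s) ht.2.2 r rest h

theorem get_sound : ∀ (t : RuleTrie) (p s : List ℕ), t.All P p → ∀ r,
    t.get s = some r → P (s.reverse ++ p) r
  | nil, _, _, _, _, h => by simp [get] at h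
  | node _ _ _ _, _, [], _, _, h => by simp [get] at h
  | node a v kid sib, p, b :: s, ht, r, h => by
    rw [get_cons] at h
    split_ifs at h with hab
    · subst hab
      cases s with
      | nil => exact ht.1 _ h
      | cons c s =>
        have := get_sound kid (a :: p) (c :: s) ht.2.1 r h
        simpa using this
    · exact get_sound sib p (b :: s) ht.2.2 r h

theorem single_all (r : List ℕ) : ∀ (s p : List ℕ), P (s.reverse ++ p) r → (single r s).All P p
  | [], _, _ => trivial
  | [b], p, h => ⟨by rintro r' ⟨rfl⟩; simpa using h, trivial, trivial⟩
  | b :: c :: s, p, h =>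
    ⟨by rintro r' ⟨⟩, single_all r (c :: s) (b :: p) (by simpa using h), trivial⟩

theorem insert_all (r : List ℕ) : ∀ (t : RuleTrie) (s p : List ℕ), t.All P p →
    P (s.reverse ++ p) r → (t.insert r s).All P p
  | nil, s, p, _, h => single_all r s p h
  | node _ _ _ _, [], _, ht, _ => ht
  | node a v kid sib, b :: s, p, ht, h => by
    rw [insert_cons]
    split_ifs with hab
    · subst hab
      cases s with
      | nil => exact ⟨by rintro r' ⟨rfl⟩; simpa using h, ht.2⟩
      | cons c s => exact ⟨ht.1, insert_all r kid (c :: s) (a :: p) ht.2.1 (by simpa using h), ht.2.2⟩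
    · exact ⟨ht.1, ht.2.1, insert_all r sib (b :: s) p ht.2.2 h⟩

variable {M : Type*} [Monoid M] {g : ℕ → M}

/-- All rules of the trie hold in `M`. -/
def Holds (g : ℕ → M) (t : RuleTrie) : Prop := t.All (fun l r => wordProd g l = wordProd g r) []

theorem reduce_succ_cons (t : RuleTrie) (n : ℕ) (out st : List ℕ) (b : ℕ) :
    t.reduce (n + 1) out (b :: st) = match t.find (b :: out) with
      | some (r, rest) => t.reduce n rest (r ++ st)
      | none => t.reduce n (b :: out) st := by
  change Option.rec (motive := fun _ => List ℕ) (t.reduce n (b :: out) st)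
    (fun p => t.reduce n p.2 (p.1 ++ st)) (t.find (b :: out)) = _
  cases t.find (b :: out) <;> rfl

theorem wordProd_reduce {t : RuleTrie} (ht : t.Holds g) : ∀ (n : ℕ) (out st : List ℕ),
    wordProd g (t.reduce n out st).reverse = wordProd g (out.reverse ++ st)
  | 0, out, st => by
    change wordProd g (List.reverseAux st out).reverse = _
    simp [List.reverseAux_eq]
  | n + 1, out, [] => by
    change wordProd g out.reverse = _
    simp
  | n + 1, out, b :: st => by
    rw [reduce_succ_cons]
    cases h : t.find (b :: out) with
    | none =>
      rw [wordProd_reduce ht n]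
      simp
    | some x =>
      obtain ⟨r, rest⟩ := x
      obtain ⟨q, hq, hr⟩ := find_sound t [] _ ht r rest h
      simp only [List.append_nil] at hr
      rw [wordProd_reduce ht n]
      have : out.reverse ++ b :: st = rest.reverse ++ (q.reverse ++ st) := by
        have := congrArg List.reverse hq
        simp only [List.reverse_cons, List.reverse_append] at this
        rw [← List.append_assoc, ← this]; simp
      rw [this]
      simp only [wordProd_append, hr]

theorem wordProd_nf {t : RuleTrie} (ht : t.Holds g) (w : List ℕ) :
    wordProd g (t.nf w).reverse = wordProd g w := wordProd_reduce ht _ _ _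

theorem addEq_holds {t : RuleTrie} (ht : t.Holds g) (wt : ℕ → ℕ) {a b : List ℕ}
    (h : wordProd g a.reverse = wordProd g b.reverse) : (t.addEq wt a b).Holds g := by
  unfold addEq
  split
  · exact insert_all _ _ _ _ ht (by simpa using h.symm)
  · split
    · exact insert_all _ _ _ _ ht (by simpa using h)
    · exact ht

theorem step_holds {t : RuleTrie} (ht : t.Holds g) (wt : ℕ → ℕ) (c : ℕ) : (t.step wt c).Holds g := by
  unfold step
  extract_lets u
  split
  · apply addEq_holds ht
    rw [wordProd_nf ht, wordProd_nf ht, wordProd_append, wordProd_nf ht, ← wordProd_append,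
      List.take_append_drop]
  · split
    · exact ht
    · next r hr =>
      apply addEq_holds ht
      rw [wordProd_nf ht, wordProd_nf ht]
      simpa using get_sound t [] _ ht _ hr

theorem complete_holds (wt : ℕ → ℕ) {base : List (List ℕ × List ℕ)}
    (h : ∀ p ∈ base, wordProd g p.1 = wordProd g p.2) (cs : List ℕ) :
    (complete wt base cs).Holds g := by
  have key : ∀ {α : Type} (f : RuleTrie → α → RuleTrie) (l : List α),
      (∀ c ∈ l, ∀ t : RuleTrie, t.Holds g → (f t c).Holds g) →
        ∀ t : RuleTrie, t.Holds g → (foldTrie f l t).Holds g := by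
    intro α f l
    induction l with
    | nil => exact fun _ t ht => ht
    | cons c l ih =>
      intro hl t ht
      rw [foldTrie_cons]
      exact ih (fun c hc => hl c (by simp [hc])) _ (hl c (by simp) t ht)
  refine key _ _ (fun c _ t ht => step_holds ht wt c) _ (key _ _ (fun p hp t ht => ?_) _ trivial)
  apply addEq_holds ht
  rw [wordProd_nf ht, wordProd_nf ht, h p hp]

/-- A word, given reversed, to which no rule applies. -/
def Irr (t : RuleTrie) : List ℕ → Prop
  | [] => True
  | b :: w => t.find (b :: w) = none ∧ Irr t w

/-- A rule decreases the key of every word it is applied to. -/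
def decreasing (wt : ℕ → ℕ) (l r : List ℕ) : Bool :=
  Nat.ble (wordWeight wt r) (wordWeight wt l) && Nat.blt (wordKey wt r) (wordKey wt l)

theorem wordWeight_eq (wt : ℕ → ℕ) (w : List ℕ) (n : ℕ) :
    w.foldl (fun n a => n + wt a) n = n + wordWeight wt w := by
  unfold wordWeight
  induction w generalizing n with
  | nil => rfl
  | cons a w ih => rw [List.foldl_cons, List.foldl_cons, ih, ih (0 + wt a)]; ring

theorem wordKey_eq (wt : ℕ → ℕ) (w : List ℕ) (n : ℕ) :
    w.foldl (fun n a => n * 16 ^ wt a + a * 16 ^ (wt a - 1)) n =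
      n * 16 ^ wordWeight wt w + wordKey wt w := by
  unfold wordKey
  induction w generalizing n with
  | nil => simp [wordWeight]
  | cons a w ih =>
    have : wordWeight wt (a :: w) = wt a + wordWeight wt w := by
      rw [wordWeight, List.foldl_cons, wordWeight_eq]; ring
    rw [List.foldl_cons, List.foldl_cons, ih, ih (0 * _ + _), this, pow_add]; ring

theorem wordKey_append (wt : ℕ → ℕ) (v w : List ℕ) :
    wordKey wt (v ++ w) = wordKey wt v * 16 ^ wordWeight wt w + wordKey wt w := by
  rw [wordKey, List.foldl_append, wordKey_eq]; rfl

theorem wordKey_lt_of_decreasing {wt : ℕ → ℕ} {l r : List ℕ} (h : decreasing wt l r = true)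
    (p q : List ℕ) : wordKey wt (p ++ r ++ q) < wordKey wt (p ++ l ++ q) := by
  simp only [decreasing, Bool.and_eq_true, Nat.ble_eq, Nat.blt_eq] at h
  simp only [wordKey_append]
  have h1 : 16 ^ wordWeight wt r ≤ 16 ^ wordWeight wt l := Nat.pow_le_pow_right (by norm_num) h.1
  have h2 : 0 < 16 ^ wordWeight wt q := by positivity
  have h3 := Nat.mul_le_mul_left (wordKey wt p) h1
  have h4 : wordKey wt p * 16 ^ wordWeight wt r + wordKey wt r <
    wordKey wt p * 16 ^ wordWeight wt l + wordKey wt l := by omega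
  have := Nat.mul_lt_mul_of_pos_right h4 h2
  omega

/-- Every word reduces to an irreducible one, and stays in any class of words preserved by
the rules. -/
theorem exists_irr {t : RuleTrie} (ht : t.Holds g) {wt : ℕ → ℕ}
    {ok : List ℕ → List ℕ → Bool} (hd : t.all (fun l r => decreasing wt l r && ok l r) [] = true)
    {G : List ℕ → Prop} (hG : ∀ p l q r, ok l r = true → G (p ++ l ++ q) → G (p ++ r ++ q))
    (w : List ℕ) (hw : G w) : ∃ w', G w' ∧ wordProd g w' = wordProd g w ∧ t.Irr w'.reverse := by
  have key : ∀ w : List ℕ, ¬ t.Irr w → ∃ p l q r, w.reverse = p ++ l ++ q ∧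
      wordProd g l = wordProd g r ∧ decreasing wt l r = true ∧ ok l r = true := by
    intro w
    induction w with
    | nil => exact fun h => (h trivial).elim
    | cons b w ih =>
      intro h
      by_cases hw : t.Irr w
      · have hf : t.find (b :: w) ≠ none := fun h' => h ⟨h', hw⟩
        obtain ⟨⟨r, rest⟩, hr⟩ := Option.ne_none_iff_exists'.1 hf
        obtain ⟨q, hq, h1⟩ := find_sound t [] _ ht r rest hr
        obtain ⟨q', hq', h2⟩ := find_sound t [] _ (all_sound t [] hd) r rest hr
        obtain rfl : q = q' := List.append_cancel_right (hq.symm.trans hq')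
        simp only [List.append_nil, Bool.and_eq_true] at h1 h2
        exact ⟨rest.reverse, q.reverse, [], r, by rw [hq]; simp, h1, h2.1, h2.2⟩
      · obtain ⟨p, l, q, r, h1, h2⟩ := ih hw
        exact ⟨p, l, q ++ [b], r, by simp [h1], h2⟩
  induction hn : wordKey wt w using Nat.strong_induction_on generalizing w with
  | _ n ih =>
    by_cases hi : t.Irr w.reverse
    · exact ⟨w, hw, rfl, hi⟩
    · obtain ⟨p, l, q, r, h1, h2, h3, h4⟩ := key _ hi
      rw [List.reverse_reverse] at h1
      subst h1 hn
      obtain ⟨w', hw', he, hi'⟩ := ih _ (wordKey_lt_of_decreasing h3 p q) _ (hG _ _ _ _ h4 hw) rfl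
      exact ⟨w', hw', he.trans (wordProd_congr_middle g h2 p q).symm, hi'⟩

/-- The irreducible words (reversed) with letters from `letters` that extend the reversed word `w`
by at most `n` letters; the words that would have to be extended further are doubled. -/
noncomputable def extensions (t : RuleTrie) (letters : List ℕ) (n : ℕ) : List ℕ → List (List ℕ) :=
  Nat.rec (fun w => [w, w])
    (fun _ ih w => w :: letters.flatMap fun b =>
      Option.rec (ih (b :: w)) (fun _ => []) (t.find (b :: w))) n

theorem extensions_succ (t : RuleTrie) (letters : List ℕ) (n : ℕ) (w : List ℕ) :
    t.extensions letters (n + 1) w = w :: letters.flatMap fun b =>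
      match t.find (b :: w) with
      | none => t.extensions letters n (b :: w)
      | some _ => [] := by
  change w :: _ = _
  congr 2
  funext b
  cases t.find (b :: w) <;> rfl

theorem mem_extensions {t : RuleTrie} {letters : List ℕ} : ∀ (n : ℕ) (w : List ℕ),
    (t.extensions letters n w).Nodup → ∀ q : List ℕ, (∀ b ∈ q, b ∈ letters) →
      t.Irr (q ++ w) → q ++ w ∈ t.extensions letters n w
  | 0, w, h, _, _, _ => by
    change [w, w].Nodup at h
    simp at h
  | n + 1, w, h, q, hq, hi => by
    rw [extensions_succ] at h ⊢
    induction q using List.reverseRecOn with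
    | nil => simp
    | append_singleton q b _ =>
      have hb : b ∈ letters := hq b (by simp)
      have hf : t.find (b :: w) = none := by
        have : ∀ q : List ℕ, t.Irr (q ++ b :: w) → t.find (b :: w) = none := by
          intro q
          induction q with
          | nil => exact fun h => h.1
          | cons c q ih => exact fun h => ih h.2
        exact this q (by simpa using hi)
      refine List.mem_cons_of_mem _ (List.mem_flatMap.2 ⟨b, hb, ?_⟩)
      rw [hf]
      have hnd : (t.extensions letters n (b :: w)).Nodup := by
        have h' := (List.nodup_flatMap.1 (List.nodup_cons.1 h).2).1 b hb
        simpa [hf] using h'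
      have := mem_extensions n (b :: w) hnd q (fun c hc => hq c (by simp [hc])) (by simpa using hi)
      simpa using this

end RuleTrie

/-! ### The relations of type E₆ and an action on admissible sets of roots -/

/-- Half of the edges of the E₆ diagram, as ordered pairs. -/
def e6Edges : List (ℕ × ℕ) := [(1, 3), (3, 4), (4, 5), (5, 6), (2, 4)]

/-- Half of the pairs of distinct nodes of the E₆ diagram that are not joined. -/
def e6NonEdges : List (ℕ × ℕ) :=
  [(1, 2), (1, 4), (1, 5), (1, 6), (2, 3), (2, 5), (2, 6), (3, 5), (3, 6), (4, 6)]

/-- The relations of type E₆ on words with letter `i` for `R i` and `6 + i` for `E i` (nodes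
numbered from 1), together with the reversed relations, up to swapping sides;
the entry `(l, r, k)` says that `l` equals `δ ^ k` times `r`. -/
def e6Rels : List (List ℕ × List ℕ × ℕ) :=
  ([1, 2, 3, 4, 5, 6].flatMap fun i =>
    [([i, i], [], 0), ([i, 6 + i], [6 + i], 0), ([6 + i, i], [6 + i], 0),
      ([6 + i, 6 + i], [6 + i], 1)]) ++
  (e6NonEdges.flatMap fun p =>
    [([p.1, p.2], [p.2, p.1], 0), ([6 + p.1, p.2], [p.2, 6 + p.1], 0),
      ([6 + p.2, p.1], [p.1, 6 + p.2], 0), ([6 + p.1, 6 + p.2], [6 + p.2, 6 + p.1], 0)]) ++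
  (e6Edges.flatMap fun p =>
    [([p.1, p.2, p.1], [p.2, p.1, p.2], 0),
      ([p.2, p.1, 6 + p.2], [6 + p.1, 6 + p.2], 0), ([p.1, p.2, 6 + p.1], [6 + p.2, 6 + p.1], 0),
      ([6 + p.2, p.1, p.2], [6 + p.2, 6 + p.1], 0), ([6 + p.1, p.2, p.1], [6 + p.1, 6 + p.2], 0),
      ([p.1, 6 + p.2, p.1], [p.2, 6 + p.1, p.2], 0)])

/-- A word equation holds up to swapping sides in `e6Rels`. -/
def e6Rel (l r : List ℕ) (k : ℕ) : Prop := (l, r, k) ∈ e6Rels ∨ k = 0 ∧ (r, l, k) ∈ e6Rels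

instance (l r : List ℕ) (k : ℕ) : Decidable (e6Rel l r k) := by unfold e6Rel; infer_instance

/-- The action of `R 1`, encoded as explained at `e6Table`. -/
def e6TableR1 : ℕ :=
  9378259274553792434968559874890572913849787494490064606817783475115692616413222982949041734085429894422534493847824564110742057479563371510647124121246880782008716023496345884000034302219413693587546789856941067711495156002610614983543759451236177453195319613692210605086208848464268625433133651197290464118348901079225780338750225818220723969524251797788693349775568141076802293734366563825269944015857061568926707582208368678720690036105059031692734373615923040447460504888155124015559351870022214839646811700106111191355741312256245529194557030549054148260150990748020958944295534765244862124394090714923998954903429725221162154978131052529222692494240488217180899464804810081035499200571469071959782790725500258579701014770003119000588429997809354292882663780863280389232238124056895661108734840561779470714057793778453584290173257021705546429111414341093146811084934550831781038200660556839649882124145210673779867707469302454995923159922804166352014820809122236940551515918135024010887193233135642010687037152309025772445799282845078721450689677037664324754960151473080289210784618072284347308604925279618496917383952730120128910981495117055748017923744042369964725554135190572826955700604425658372665000047357010618010038586019549146365827410658025073648487101012586629057499767727824719345766744781072705222975866885773695214349119636111343651222352642796264513839975032430828152606721176639251166205330685366540794599525927758937721352533923817511591962974140254008193770569769018032662763029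8578780460292309322872445238843872904192

/-- The action of `R 2`, encoded as explained at `e6Table`. -/
def e6TableR2 : ℕ :=
  93782592745537924349685598748905729138497874944900646068177834751156926164132229829490417340854298944225344938478245641107420574795633715106471241212468807820087160234963458840000343022194136935875467898569410677045000383991239308788622760998130693222939886239589178348592296135815087256982121800430167707104464451461457794618014571723244177268487571177555149929334604411899280067381744357118169114512985613666923496707435236929814200330004005144246437985760431931071513840106867570690853483869002805268833796203889825894090337449869121047984438940170841778637450691643859177404355571675247441943554649063165467230368763937599448107460534509871335878129254176837217570116491705486823064223997200179333539292505876874978176231558771080782638960760163305724859713897141320340872177388685166701818638690633006052757694021765597271747760001883127681864064289165605711256248435139483845309575060612377287819487842966994266294304236309308129069220370951997691888677710669113941207118700622920640827545366047542147327087994215805621366184556430806229842223575583538122881738913323798542988976934812064437943233459525807048073163938821324358087583725179668790925213909195223210480128470564214820395200793457272673428706814603501380595550662046608388792324008282829390250757781128678503010140694125684439079688079660398152054736465168044379448401214251276502734077950012741777294329157164088406714896313887281600142492353451861140210654712789514965852768280794377622662899422066521979281986554881504377226711660755416299104488677349645774025039807488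

/-- The action of `R 3`, encoded as explained at `e6Table`. -/
def e6TableR3 : ℕ :=
  93782592745537924349685598748905729138497874944900646068177834751156926164132229829490417340854298944225344938478245641107420574795633715106471241212468807820087160234963458840000343022194136935875467898569410677149909479522923592113596339853304016514686498394765529930549682385171649677947391719359142344151428962817811709269593382084488310538774711340097433333105703027633831131640928005848874030345406410520636769748569908690755463167055371212549055293475317714535391547024952625288041909842972854818202211881551572757510705870313563361622936854799072371731231751179978583924594083349250024550838322938584703487893648089894240948231518401766508674835172648743409339592525816629107502907675091134119312790752199653904751292548247249225831090450804799868852560378283337900727776486537771736916348685191227547399175141728707285303900776729702320240761973977872263481064187505195192958872221062957050997079961237022073542658484419777003229325685854374759667082166067892450687078006548912475624841286418533225201631923153245347018257914669363378900412652733311815321079780367837858804736822449378703964401448975987704055998020568993626864899821824800288245226158923630770785649580035687443827233712458812163395215436982170259610971542853716434431180304513696751126329604696790142607849582458402602202829399238265524497588656473329140332707941052835131267293781195548539745450877353951439603752341648497482652897964269165175074581434659278736311633518511271850566175673715560774984290896018776777287980156807630042179063934981529855867746262016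

/-- The action of `R 4`, encoded as explained at `e6Table`. -/
def e6TableR4 : ℕ :=
  93782592745537924349685598748905729138497874944900646068177834751156926164132229829490417340854298944225344938478245641107420574795633715106471241212468807820087160234963458840000343022194136935875467898569410677114951560026296607410228555398473701090479706196088840060923770204778413939845667728879693400960948437977435081514119087660279177152199556923264693215109803449448060346562168141492383464991831494185523445359062188299282923652394838270771825803710747079936571770520389290109532384344035121759579567374033578038208725596738517291364478735636666903057042197838043086357180851360486496506736476085822991573091957638114170375784668110309909721985191938833970651072014349455279112704792644333250108649145100757573303681662728695027038479878496519473723389149953022932100540492317450773474841104016197353030675210818670210620092535582394976104615029658806984698710631146174763496736013193775170307868690563436494222564697746220482325798713432362163600959552542358183357662561230925579842642745466441157019513220617899171374453233411818682235806409609787431931913618023855394019223685588229297509563208969820349919412106756577614716715261250550661089087981699144497942560336348063086914777896974216996256818550941987255692285929220519846846022283326321302671120603184138836371984657739826701707929111657490851825508036471115930351668096605821688421969854068764068576934122545626870983167708374709499312188079398636535498222872688678173979487932752944048914242558685622783784387389700629677839226931003749637542669538440531229732358849536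

/-- The action of `R 5`, encoded as explained at `e6Table`. -/
def e6TableR5 : ℕ :=
  93782592745537924349685598748905729138497874944900646068177834751156926164132229829490417340854298944225344938478245641107420574795633715106471241212468807820087160234963458840000343022194136935875467898569410676975389667771595707830953695997883899110531977612234487745051162217490513618425003198873383080343887493530156279837408085905627041476372272955223385622866448222734444423506314953706793629325307056084629932933294191558690743038297698399590809119460603931280954399236239092566850838166483688340204068359063939475126647695510988459001376082924480350247317850390657319384734455764191331438055423837839705587753641551185746195344116809874315510229928333041032239725897580358931154992386981472647702780143856216950912644845460328636821306515638221698663345838520722661110005975923497417758081110407082946928806176847538037653113423804403615142184348582062856985218098917530978057072462391261862211068856291996903963530068894809050267570145800356416275181993118414966823007480380338282975161769699806514080556081577691697305425579473777237921952683466742208398885028568520844399629394443782155689902612066680255027822916881955604797915647426198550068863462099522628167462597390308470471598197107111842956651527852193725971028241583130990297866202534096925555065942686449836475992108604840545905601417475801150958714952901634808098424275078629399952004276517735958262560548684566426763461713398551493761044072818250304381553402102649289838894326463254025358322431969539750044551411944033264132478764081180429415127704963336345871022294016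

/-- The action of `R 6`, encoded as explained at `e6Table`. -/
def e6TableR6 : ℕ :=
  93782592745537924349685598748905729138497874944900646068177834751156926164132229829490417340854298944225344938478245641107420574795633715106471241212468807820087160234963458840000343022194136935875467898569410677114577127012081020110639683728580627405563455224833418116370208803622257871483356529764256149184310325140795155544160412120820129913008987677058695637334076168462562147708898333451522358033498485620838594735828849190991194192989983098830204132235714079380352858226363754685665888453128937188138485838631786252697249518914040584159152983701285645601677665689737388627876565473222153246619580924497490580643538972406223388411646423672979805330424724458584711057273781466142461254476742332175451164635492367434314837384900510576374367467944484118874623708901707443684547481111717963933359295057933606417810629205666772879039360571157394537544283663530823791367338893777404771679922450968392249269174314955687720128868226518529411334348897824022016625557394466628606119584098224270933780850601575397407252667337939886014753927359863947416609937473668868563993818995952786666386459687743032159604059729990884927343131881427969867270685051985860698216671267277553622318437944070492549269742150730720633057161027084970903519038469466936777320748244184578224226327488102156129901000072426060716344086078578035807912198045005188356526494302187135265090173094978001422080277459597730787619371454061591919921875115384876021835715109153787909240753822697662578888383123574591493299222498555956018523827822969860711568322934725629963487151104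

/-- The action of `E 1`, encoded as explained at `e6Table`. -/
def e6TableE1 : ℕ :=
  183527929838021273203600115389573948848944291114397192029386640224109205638442839272864947316689267224118755876712562153474097178042232818915891435633638112144858680445732619661561028770247846178303676810871144938029931068936168319894253480106054349830332599639171234932017903690961241331568070821712901201886608145026321063332595867924924652149935742412291707965686116499475073271143473257987562122066379718440723169882489597197504140743077149722987230276186214840640653919789711946361102100134641123720253448321282527686404008778580639740360895361882376203187452910778812431028924538252371833077119402053298516630080848624414262881329969975521066909144226077522031912276169222296015019367157249886388013321991665831299220843884530343301728211942466120458189455066996262839025421640276246086885726739397242918746255756092911826516140412381242931893130078210407829435290536528023046836769981383034567151911413665906827213303609686139722693391619424691125216343249646189011925084933751326211552380153059408004773556871271593220236067000365358331368094226842602259610134843796303582777209240695259122025412370131886532286137280728998477789997770844955980435554229469167681506857220856896581706442740103539981308166181427370598086852180469837914809445761574251066276498361991892362083893050457557388601945214964271056391621271561674159521867197396322294200765626047163360838899373946817013407255724805225161294818113326364337349556672733790799029785321799823034371404215288395511933941952349859766950740030217469534978493340528301017547670529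

/-- The action of `E 2`, encoded as explained at `e6Table`. -/
def e6TableE2 : ℕ :=
  367055859676042546407200230779147897697888582228794384058773280448218411276885678545729894633378534448237511753425124306948194356084465637831782871267276224289717360891465239323122057540495692356607353621742279687978542452935470441707413671168135822603397495892416637950242606270483784515725468701342668737132463731349643462456003358057825677406909774521449919875562069274960510506145493202834691126320053196686048080067466483069882136571194926683945576444352734483403435808941222779080716813709704295693069706773066866161030438225131741703313411910781479902549871889271622963832981739651082633611468220714299288501081254932102269674342905567019452247789903835740150905283171723900679118392701358839984408879313708125562893189926036790515891730508534104526270966095771443976531941004351107719681160690608673387951400633725040483478810604260875156800194939472414989279716579007058140445576957349534158562827387276003553876188907674222450996363198447712758233726426673134313849799910203169353267792953328816580491017931894869237732041443069254762579665677833123311573557351436141493277522354544597933100262933543261054608597713630718408512375840793022556232721575286545072741713954093286879301100142916915694417317619353685533714459844714794785471193350190221578550402886211045885931836424631108195835239822100447204971198450625208368021369904471386224657883928622435986763124597334569832149630591841951552220394802786200435531872246850412728323538111968434227423392503521241382992053973784681180732863425221943309529320200600308311673312258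

/-- The action of `E 3`, encoded as explained at `e6Table`. -/
def e6TableE3 : ℕ :=
  550583789514063819610800346168721846546832873343191576088159920672327616915328517818594841950067801672356267630137686460422291534126698456747674306900914336434576041337197858984683086310743538534911030432613414228585014096074472555187107699475276421958468838926211323502664857171319731229143191028333620577171835807171051309442507072833111597060062978397866578678453347078282148591300993381907644135025720050160013907983211296239524503855374975577779542669848775345348070516811169384753474655776949050689681724555267762280479476562065070272333515385503920036114973781296851136136791413450993451761159496509520768955374011482295975918305750029856208662521183567067015514951554266005064162861432653652157239840394283819204322193911314624424963383337978718278589319293138129702977393772881098877917221790284472543890939692438190413765211087667207890497162722328158704553895823687779106667092788268042023018232667324473626631324854156263692807685555038430153629767148096321155614821022361235115594717216832476652585360325214557569270773042555708532833501581652181831313713423890792504345422952848679371534560868317278901078041319191945670030942573916542935693589027496767934145053202931285770991499959903241764615045638231921533527546723647933925712350230173684459404239363438132199246559650607376733969952393896954831843173092210936925237791757363010644703261755294485832856743038995089765788255738237933266252091039169979764001990882379106230512894247697871056823563012260893431946120365448803831172841024609855950840392340002577283532459011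

/-- The action of `E 4`, encoded as explained at `e6Table`. -/
def e6TableE4 : ℕ :=
  734111719352085092814400461558295795395777164457588768117546560896436822553771357091459789266757068896475023506850248613896388712168931275663565742534552448579434721782930478646244115080991384713214707243484547303899325835657626759586177132398430833591104762648048973222927745014339495185792412191369227584380253487616400789004686388654832258625032058340975375983297123665386311143811622969421189669868932208837334988532415710912879026898355234350435614812143823516800794444042796692047196381809902371895963639725397595138813079520972190239573864369976655675558158150319174405537702930666488925133615737619706203370326364937320797822884890349241076001787307629293136668364604156912284342600468757226840522971362540788951961034260211484544150503003690390300624432819926888412937075434793572402213721287478713450344374969975700803055416096027260402142860163666631023512128243282639994608711405294664118709334354454711961405664740749222514918598591473924795307972128269258786397684032045070506424340906131205182866848372915100079776070627393478254497317901243739014707437160215116035706610848228377795156566703526063726949008298939337252101835483396199791619873357806731353708328005807471419897421532125597020940716630291847452011439870965964623690019951079734927430605798436409040698165577195860745178029282748069645912817814306562111664109784964058583696832426882687583863185488207882126428249102915112262185686511067930917064964970806527734493041189189490147221652815825826762716126704701694911338477746819192087717359174330681821143013380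

/-- The action of `E 5`, encoded as explained at `e6Table`. -/
def e6TableE5 : ℕ :=
  917639649190106366018000576947869744244721455571985960146933201120546028192214196364324736583446336120593779383562810767370485890211164094579457178168190560724293402228663098307805143851239230891518384054355683170372822003502488407485100760836778555364501836155468434147989086309907502399571355314658625734548917021051774445047197609743191485316873895199100051878319870940299410815017979857488953337310519721490979982085755026968571879937725980362091232934199748807993458857706653620091029041640400175747865479029562816217340166056879470934630859577189650711080432116408217886404117148929502637820936228239218042287779735842651849289862271619237506327122175685567941616487177513186710544653736016910122865356826633473333666015762149943502567364842453165650169339692081479452629540291164786406837756091606204898770469696918058872489723445592536620255690311636950107220745240857732822055513251706081616250473387732328534519304718837685299992004918147808219452832540369754374423628689622245349216460119377225534682255074894241552265594652678992067915253485890984684012952740419649406433366238567401177250020850692948404226076857864797182051366949364650900082205618532176771169556200665438812967626426724628898909086777497650133100471818703873409418457434454214841785211692987413349845812599622147024660889769147956623388876719795538816591055364982305386244489027927175381908457684779159623717251104515205481273611201323109383064456660741974476622913663140535852939669747985901013111283623829188084715598533846476919589002658603891872012213253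

/-- The action of `E 6`, encoded as explained at `e6Table`. -/
def e6TableE6 : ℕ :=
  1101167579028127639221600692337443693093665746686383152176319841344655233830657035637189683900135603344712535260275372920844583068253396913495348613801828672869152082674395717969366172621487077069822060865226815549650379931333996464313834775717625521328636881678505816740846650756721419364716102154604039546145800662663800679013295330218061565521919400231196979916027483028685106918667910224265713601287615271245645784843287444383256069833956923158975639896914395748938238233441655479624843439265414975360284668165411310606638449173368913089005236784784121777891489467571648186368548757344852226321835569016422861826764374064279907415300636238503863187053685991538592341617872579052001328732383914353685503148095622118091302171274507341340348184722767657833491427131847526168303039232848677837245163133548023287858434053905504470949802955145892281375011461573099488093631476692887437534443239543403278189670818915480547716424981856205917196105094631007105818991978385131918910350242204571764227422629443092227547729813544179893756101390499194750512344538085815628610799777660134262210292196418870657597478463767995836395495532066096156231529816631548935525845726379372747373201316432264363657369469324023222428280144058009824219568641743190745124705482498937936704581242055193901313072585811167572218851441589638360362586350876662605732802015536505702723478120701798830633655673564888471353061819223642747615860630768511599075092348877543852544840986599644807903174990270522875752128486801424035763822498359896225022866995311051256765652998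

/-- The action of the letters on the 442 admissible sets of positive roots (the empty set, the
36 singletons, the 270 orthogonal pairs and the 135 orthogonal quadruples), encoded in base 1024:
the digit at place `x` is `y + 512 * k` if the letter sends the set with index `x` to `δ ^ k` times
the set with index `y`. There are 70 more places, which behave like the empty set. -/
def e6Table : ℕ → ℕ
  | 1 => e6TableR1
  | 2 => e6TableR2
  | 3 => e6TableR3
  | 4 => e6TableR4
  | 5 => e6TableR5
  | 6 => e6TableR6
  | 7 => e6TableE1
  | 8 => e6TableE2
  | 9 => e6TableE3
  | 10 => e6TableE4
  | 11 => e6TableE5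
  | 12 => e6TableE6
  | _ => 0

/-- The digit at place `x` of `e6Table a`. -/
def e6Entry (a x : ℕ) : ℕ := Nat.mod (Nat.shiftRight (e6Table a) (Nat.mul 10 x)) 1024

/-- The index of the image of an admissible set under a letter. -/
def idxAct (a x : ℕ) : ℕ := Nat.mod (e6Entry a x) 512

/-- The action of a letter on codes `x + 512 * k` for `δ ^ k` times the admissible set of
index `x`. -/
def codeAct (a s : ℕ) : ℕ := Nat.add (Nat.mul (Nat.div s 512) 512) (e6Entry a (Nat.mod s 512))

/-- The action of a word on codes. -/
def wordAct (w : List ℕ) (s : ℕ) : ℕ := w.foldr codeAct s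

/-- The index of the image of an admissible set under a word acting from the left. -/
def wordIdx (w : List ℕ) (x : ℕ) : ℕ := w.foldr idxAct x

theorem wordIdx_append (v w : List ℕ) (x : ℕ) : wordIdx (v ++ w) x = wordIdx v (wordIdx w x) := by
  simp [wordIdx]

theorem idxAct_lt (a x : ℕ) : idxAct a x < 512 := Nat.mod_lt _ (by norm_num)

theorem codeAct_mod (a s : ℕ) : codeAct a s % 512 = idxAct a (s % 512) := by
  change (s / 512 * 512 + e6Entry a (s % 512)) % 512 = e6Entry a (s % 512) % 512
  omega

theorem codeAct_div (a s : ℕ) : codeAct a s / 512 = s / 512 + e6Entry a (s % 512) / 512 := by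
  change (s / 512 * 512 + e6Entry a (s % 512)) / 512 = s / 512 + e6Entry a (s % 512) / 512
  omega

theorem wordAct_mod (w : List ℕ) (s : ℕ) : wordAct w s % 512 = wordIdx w (s % 512) := by
  induction w with
  | nil => rfl
  | cons a w ih => rw [wordAct, List.foldr_cons, codeAct_mod, ← wordAct, ih]; rfl

theorem e6Rels_act : e6Rels.all (fun p => (List.range 512).all fun x =>
    Nat.beq (wordAct p.1 x) (Nat.add (wordAct p.2.1 x) (Nat.mul 512 p.2.2))) = true := by
  decide +kernel

theorem e6Rels_reverse : ∀ p ∈ e6Rels, e6Rel p.1.reverse p.2.1.reverse p.2.2 := by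
  decide +kernel

theorem e6Rel.reverse {l r : List ℕ} {k : ℕ} (h : e6Rel l r k) :
    e6Rel l.reverse r.reverse k := by
  rcases h with h | ⟨rfl, h⟩
  · exact e6Rels_reverse _ h
  · rcases e6Rels_reverse _ h with h | ⟨-, h⟩
    · exact Or.inr ⟨rfl, h⟩
    · exact Or.inl h

theorem e6Rel.wordAct_eq {l r : List ℕ} {k : ℕ} (h : e6Rel l r k) {x : ℕ} (hx : x < 512) :
    wordAct l x = wordAct r x + 512 * k := by
  have key : ∀ p ∈ e6Rels, wordAct p.1 x = wordAct p.2.1 x + 512 * p.2.2 := by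
    intro p hp
    exact Nat.eq_of_beq_eq_true
      (List.all_eq_true.1 (List.all_eq_true.1 e6Rels_act p hp) x (List.mem_range.2 hx))
  rcases h with h | ⟨rfl, h⟩
  · exact key _ h
  · simpa using (key _ h).symm

theorem e6Rel.wordIdx_eq {l r : List ℕ} {k : ℕ} (h : e6Rel l r k) {x : ℕ} (hx : x < 512) :
    wordIdx l x = wordIdx r x := by
  have := congrArg (· % 512) (h.wordAct_eq hx)
  simpa [Nat.add_mul_mod_self_left, wordAct_mod, Nat.mod_eq_of_lt hx] using this

/-- The values of the letters in `BrE6`. -/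
noncomputable def e6Gen : ℕ → BrE6
  | 1 => Rgen 0 | 2 => Rgen 1 | 3 => Rgen 2 | 4 => Rgen 3 | 5 => Rgen 4 | 6 => Rgen 5
  | 7 => Egen 0 | 8 => Egen 1 | 9 => Egen 2 | 10 => Egen 3 | 11 => Egen 4 | 12 => Egen 5
  | _ => 1

theorem e6Gen_R (i : Fin 6) : e6Gen (i + 1) = Rgen i := by fin_cases i <;> rfl

theorem e6Gen_E (i : Fin 6) : e6Gen (6 + (i + 1)) = Egen i := by fin_cases i <;> rfl

theorem exists_fin_of_mem_e6Edges : ∀ p ∈ e6Edges, ∃ i j : Fin 6,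
    p = ((i : ℕ) + 1, (j : ℕ) + 1) ∧ (i, j) ∈ [(0, 2), (2, 3), (3, 4), (4, 5), (1, 3)] := by
  decide

theorem exists_fin_of_mem_e6NonEdges : ∀ p ∈ e6NonEdges, ∃ i j : Fin 6,
    p = ((i : ℕ) + 1, (j : ℕ) + 1) ∧ (i, j) ∈ [(0, 1), (0, 3), (0, 4), (0, 5), (1, 2), (1, 4),
      (1, 5), (2, 4), (2, 5), (3, 5)] := by
  decide

theorem E_mul_R_mul_R {M : Type*} [Monoid M] {r s e f : M} (hr : r * r = 1) (hs : s * s = 1)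
    (h1 : r * s * e = f * e) (h3 : r * f * r = s * e * s) :
    f * r * s = f * e := by
  have h4 : s * (r * f * r) * s = e := by
    rw [h3]; simp only [← mul_assoc, hs, one_mul]; rw [mul_assoc, hs, mul_one]
  calc f * r * s = r * s * (s * (r * f * r) * s) := by
        simp only [← mul_assoc]
        rw [mul_assoc r s s, hs, mul_one, hr, one_mul]
    _ = f * e := by rw [h4, h1]

theorem e6Gen_rel {l r : List ℕ} {k : ℕ} (h : e6Rel l r k) :
    wordProd e6Gen l = δ ^ k • wordProd e6Gen r := by
  have mk : ∀ {a b}, BrE6rel.rel a b → RingQuot.mkAlgHom Rring BrE6rel.rel a =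
      RingQuot.mkAlgHom Rring BrE6rel.rel b := fun h => RingQuot.mkAlgHom_rel Rring h
  have key : ∀ p ∈ e6Rels, wordProd e6Gen p.1 = δ ^ p.2.2 • wordProd e6Gen p.2.1 := by
    intro p hp
    simp only [e6Rels, List.mem_append, List.mem_flatMap, or_assoc] at hp
    rcases hp with ⟨i, hi, hp⟩ | ⟨q, hq, hp⟩ | ⟨q, hq, hp⟩
    · obtain ⟨i, rfl⟩ : ∃ j : Fin 6, i = (j : ℕ) + 1 := by
        clear hp; revert i; decide
      have h1 := mk (.rr i)
      have h2 := mk (.re i)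
      have h3 := mk (.er i)
      have h4 := mk (.ee i)
      simp only [map_mul, map_one, map_smul] at h1 h2 h3 h4
      simp only [List.mem_cons, List.not_mem_nil, or_false] at hp
      rcases hp with rfl | rfl | rfl | rfl <;>
        simpa [e6Gen_R, e6Gen_E, Rgen, Egen]
    · obtain ⟨i, j, rfl, hij⟩ := exists_fin_of_mem_e6NonEdges q hq
      obtain ⟨h, h'⟩ : BrE6rel.nadj i j ∧ BrE6rel.nadj j i := by
        clear hp hq; revert i j; unfold BrE6rel.nadj BrE6rel.adj; decide
      have h1 := mk (.rr_comm h)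
      have h2 := mk (.er_comm h)
      have h3 := mk (.er_comm h')
      have h4 := mk (.ee_comm h)
      simp only [map_mul] at h1 h2 h3 h4
      simp only [List.mem_cons, List.not_mem_nil, or_false] at hp
      rcases hp with rfl | rfl | rfl | rfl <;>
        simpa [e6Gen_R, e6Gen_E, Rgen, Egen]
    · obtain ⟨i, j, rfl, hij⟩ := exists_fin_of_mem_e6Edges q hq
      obtain ⟨h, h'⟩ : BrE6rel.adj i j ∧ BrE6rel.adj j i := by
        clear hp hq; revert i j; unfold BrE6rel.adj; decide
      have h1 := mk (.braid h)
      have h2 := mk (.rre h)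
      have h3 := mk (.rre h')
      have h4 := mk (.rer h)
      have h5 := mk (.rer h')
      have h6 := mk (.rr i)
      have h7 := mk (.rr j)
      simp only [map_mul, map_one] at h1 h2 h3 h4 h5 h6 h7
      have h8 := E_mul_R_mul_R h6 h7 h3 h4
      have h9 := E_mul_R_mul_R h7 h6 h2 h5
      simp only [List.mem_cons, List.not_mem_nil, or_false] at hp
      rcases hp with rfl | rfl | rfl | rfl | rfl | rfl <;>
        simpa [e6Gen_R, e6Gen_E, Rgen, Egen, ← mul_assoc]
  rcases h with h | ⟨rfl, h⟩
  · exact key _ h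
  · simpa using (key _ h).symm


/-- The action of a letter on index maps of admissible sets, for the left and the right action. -/
def actFin (a : ℕ) (x : Fin 512) : Fin 512 := ⟨idxAct a x, idxAct_lt a x⟩

/-- The combined left and right action of a letter on pairs of maps on admissible sets. -/
def actState (a : ℕ) (s : (Fin 512 → Fin 512) × (Fin 512 → Fin 512)) :
    (Fin 512 → Fin 512) × (Fin 512 → Fin 512) :=
  (actFin a ∘ s.1, s.2 ∘ actFin a)

/-- The combined action of a word on pairs of maps on admissible sets. -/
def wordState (w : List ℕ) (s : (Fin 512 → Fin 512) × (Fin 512 → Fin 512)) :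
    (Fin 512 → Fin 512) × (Fin 512 → Fin 512) :=
  w.foldr actState s

theorem wordState_fst (w : List ℕ) (s : (Fin 512 → Fin 512) × (Fin 512 → Fin 512)) (x : Fin 512) :
    (((wordState w s).1 x : Fin 512) : ℕ) = wordIdx w (s.1 x) := by
  induction w with
  | nil => rfl
  | cons a w ih =>
    change idxAct a ((wordState w s).1 x) = idxAct a (wordIdx w (s.1 x))
    rw [ih]

theorem wordState_snd (w : List ℕ) (s : (Fin 512 → Fin 512) × (Fin 512 → Fin 512)) :
    (wordState w s).2 = s.2 ∘ fun x : Fin 512 => ⟨wordIdx w.reverse x % 512, Nat.mod_lt _ (by norm_num)⟩ := by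
  induction w with
  | nil =>
    funext x
    simp [wordState, wordIdx, Nat.mod_eq_of_lt x.2]
  | cons a w ih =>
    change (wordState w s).2 ∘ actFin a = _
    rw [ih]
    funext x
    simp [wordIdx, actFin]

/-- The linear map by which a letter acts in a representation of `BrE6`. -/
noncomputable def actOp (a : ℕ) :
    Module.End Rring ((Fin 512 → Fin 512) × (Fin 512 → Fin 512) →₀ Rring) :=
  Finsupp.linearCombination Rring fun s =>
    Finsupp.single (actState a s) (δ ^ (e6Entry a (s.1 0) / 512))

theorem wordProd_actOp (w : List ℕ) (s : (Fin 512 → Fin 512) × (Fin 512 → Fin 512)) :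
    wordProd actOp w (Finsupp.single s 1) =
      Finsupp.single (wordState w s) (δ ^ (wordAct w (s.1 0) / 512)) := by
  induction w with
  | nil =>
    have : ((s.1 0 : Fin 512) : ℕ) / 512 = 0 := Nat.div_eq_of_lt (s.1 0).2
    simp [wordState, wordAct, this]
  | cons a w ih =>
    have h1 : wordAct (a :: w) (s.1 0) / 512 =
        wordAct w (s.1 0) / 512 + e6Entry a ((wordState w s).1 0) / 512 := by
      rw [wordAct, List.foldr_cons, codeAct_div, ← wordAct, wordAct_mod, wordState_fst,
        Nat.mod_eq_of_lt (s.1 0).2]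
    rw [wordProd_cons, Module.End.mul_apply, ih, actOp, Finsupp.linearCombination_single, h1,
      Finsupp.smul_single, pow_add, smul_eq_mul]
    rfl

theorem wordState_eq {l r : List ℕ} {k : ℕ} (h : e6Rel l r k)
    (s : (Fin 512 → Fin 512) × (Fin 512 → Fin 512)) : wordState l s = wordState r s := by
  refine Prod.ext ?_ ?_
  · funext x
    refine Fin.ext ?_
    rw [wordState_fst, wordState_fst, h.wordIdx_eq (s.1 x).2]
  · rw [wordState_snd, wordState_snd]
    congr 1
    funext x
    simp only [h.reverse.wordIdx_eq x.2]

theorem actOp_rel {l r : List ℕ} {k : ℕ} (h : e6Rel l r k) :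
    wordProd actOp l = δ ^ k • wordProd actOp r := by
  refine Finsupp.lhom_ext' fun s => LinearMap.ext_ring ?_
  change wordProd actOp l (Finsupp.single s 1) = δ ^ k • wordProd actOp r (Finsupp.single s 1)
  rw [wordProd_actOp, wordProd_actOp, wordState_eq h, h.wordAct_eq (s.1 0).2, Finsupp.smul_single,
    Nat.add_mul_div_left _ _ (by norm_num), pow_add, smul_eq_mul, mul_comm]

/-- A representation of `BrE6`. -/
noncomputable def e6Rep :
    BrE6 →ₐ[Rring] Module.End Rring ((Fin 512 → Fin 512) × (Fin 512 → Fin 512) →₀ Rring) :=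
  RingQuot.liftAlgHom Rring ⟨FreeAlgebra.lift Rring fun
    | .r i => actOp ((i : ℕ) + 1)
    | .e i => actOp (6 + ((i : ℕ) + 1)), by
    intro a b h
    cases h with
    | rr i =>
      simpa using actOp_rel (l := [i + 1, i + 1]) (r := []) (k := 0) (by revert i; decide)
    | re i =>
      simpa using actOp_rel (l := [i + 1, 6 + (i + 1)]) (r := [6 + (i + 1)]) (k := 0)
        (by revert i; decide)
    | er i =>
      simpa using actOp_rel (l := [6 + (i + 1), i + 1]) (r := [6 + (i + 1)]) (k := 0)
        (by revert i; decide)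
    | ee i =>
      simpa using actOp_rel (l := [6 + (i + 1), 6 + (i + 1)]) (r := [6 + (i + 1)]) (k := 1)
        (by revert i; decide)
    | @rr_comm i j h =>
      simpa using actOp_rel (l := [i + 1, j + 1]) (r := [j + 1, i + 1]) (k := 0)
        (by revert i j; unfold BrE6rel.nadj BrE6rel.adj; decide)
    | @er_comm i j h =>
      simpa using actOp_rel (l := [6 + (i + 1), j + 1]) (r := [j + 1, 6 + (i + 1)]) (k := 0)
        (by revert i j; unfold BrE6rel.nadj BrE6rel.adj; decide)
    | @ee_comm i j h =>
      simpa using actOp_rel (l := [6 + (i + 1), 6 + (j + 1)]) (r := [6 + (j + 1), 6 + (i + 1)])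
        (k := 0) (by revert i j; unfold BrE6rel.nadj BrE6rel.adj; decide)
    | @braid i j h =>
      simpa [mul_assoc] using actOp_rel (l := [i + 1, j + 1, i + 1]) (r := [j + 1, i + 1, j + 1])
        (k := 0) (by revert i j; unfold BrE6rel.adj; decide)
    | @rre i j h =>
      simpa [mul_assoc] using actOp_rel (l := [j + 1, i + 1, 6 + (j + 1)])
        (r := [6 + (i + 1), 6 + (j + 1)]) (k := 0) (by revert i j; unfold BrE6rel.adj; decide)
    | @rer i j h =>
      simpa [mul_assoc] using actOp_rel (l := [i + 1, 6 + (j + 1), i + 1])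
        (r := [j + 1, 6 + (i + 1), j + 1]) (k := 0) (by revert i j; unfold BrE6rel.adj; decide)⟩

theorem e6Rep_R (i : Fin 6) : e6Rep (Rgen i) = actOp (i + 1) := by
  simp [e6Rep, Rgen]

theorem e6Rep_E (i : Fin 6) : e6Rep (Egen i) = actOp (6 + (i + 1)) := by
  simp [e6Rep, Egen]

theorem e6Rep_e6Gen {a : ℕ} (h : a ∈ List.range' 1 12) : e6Rep (e6Gen a) = actOp a := by
  obtain ⟨i, rfl | rfl⟩ : ∃ i : Fin 6, a = i + 1 ∨ a = 6 + (i + 1) := by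
    revert a; decide
  · rw [e6Gen_R, e6Rep_R]
  · rw [e6Gen_E, e6Rep_E]

theorem e6Rep_wordProd {w : List ℕ} (hw : ∀ a ∈ w, a ∈ List.range' 1 12) :
    e6Rep (wordProd e6Gen w) = wordProd actOp w := by
  induction w with
  | nil => simp
  | cons a w ih =>
    simp only [wordProd_cons, map_mul, e6Rep_e6Gen (hw a (by simp)),
      ih fun b hb => hw b (by simp [hb])]

/-! ### Distinctness of natural numbers by binary digits -/

/-- Evaluate a function at a number given by an expression to be computed first. -/
noncomputable def withNat {α : Type} (n : ℕ) (f : ℕ → α) : α := Nat.rec (f 0) (fun k _ => f k.succ) n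

theorem withNat_eq {α : Type} (n : ℕ) (f : ℕ → α) : withNat n f = f n := by cases n <;> rfl

/-- Check that the members of a list are distinct, by looking at the lowest binary digit to
distribute the list into two lists that are then checked recursively. -/
noncomputable def distinctBits (n : ℕ) : List ℕ → Bool :=
  Nat.rec (fun _ => false)
    (fun _ ih l => List.rec true (fun _ l' _ => List.rec true (fun _ _ _ =>
      List.rec (fun A B => ih A && ih B)
        (fun x _ ihl A B => Nat.rec
          (id (withNat (Nat.div x 2) fun y => ihl (y :: A) B))
          (fun _ _ => id (withNat (Nat.div x 2) fun y => ihl A (y :: B))) (Nat.mod x 2)) l [] []) l')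
      l) n

theorem nodup_of_distinctBits (n : ℕ) {l : List ℕ} (h : distinctBits n l = true) : l.Nodup := by
  induction n generalizing l with
  | zero => cases h
  | succ n ih =>
    have key : ∀ l A B : List ℕ, List.rec (motive := fun _ => List ℕ → List ℕ → Bool)
        (fun A B => distinctBits n A && distinctBits n B)
        (fun x _ ihl A B => Nat.rec
          (id (withNat (Nat.div x 2) fun y => ihl (y :: A) B))
          (fun _ _ => id (withNat (Nat.div x 2) fun y => ihl A (y :: B))) (Nat.mod x 2)) l A B = true →
        (l ++ (A.map (2 * ·) ++ B.map (2 * · + 1))).Nodup := by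
      intro l
      induction l with
      | nil =>
        intro A B h
        obtain ⟨hA, hB⟩ := (Bool.and_eq_true _ _).mp h
        rw [List.nil_append]
        refine List.nodup_append.2 ⟨(ih hA).map fun a b h => ?_, (ih hB).map fun a b h => ?_, ?_⟩
        · exact Nat.eq_of_mul_eq_mul_left two_pos h
        · simpa using h
        · intro a ha b hb
          obtain ⟨a, -, rfl⟩ := List.mem_map.1 ha
          obtain ⟨b, -, rfl⟩ := List.mem_map.1 hb
          omega
      | cons x l ihl =>
        intro A B h
        obtain h0 | h1 := Nat.mod_two_eq_zero_or_one x
        · have h' : x = 2 * (x / 2) := by omega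
          dsimp only at h
          rw [show Nat.mod x 2 = 0 from h0] at h
          change withNat _ _ = true at h
          rw [withNat_eq] at h
          have := ihl _ _ h
          rw [List.map_cons, show Nat.div x 2 = x / 2 from rfl, ← h', List.cons_append] at this
          exact List.nodup_middle.1 this
        · have h' : x = 2 * (x / 2) + 1 := by omega
          dsimp only at h
          rw [show Nat.mod x 2 = 0 + 1 from h1] at h
          change withNat _ _ = true at h
          rw [withNat_eq] at h
          have := ihl _ _ h
          rw [List.map_cons, show Nat.div x 2 = x / 2 from rfl, ← h', ← List.append_assoc] at this
          simpa using List.nodup_middle.1 this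
    match l, h with
    | [], _ => exact List.nodup_nil
    | [x], _ => exact List.nodup_singleton x
    | x :: y :: l, h => simpa using key (x :: y :: l) [] [] h

/-! ### Words of type F₄ -/

/-- The relations of type F₄ on words with letter `i` for `r i` and `4 + i` for `e i` (nodes
numbered from 1), up to powers of `δ`. -/
def f4Rels : List (List ℕ × List ℕ) :=
  ([1, 2, 3, 4].flatMap fun i =>
    [([i, i], []), ([i, 4 + i], [4 + i]), ([4 + i, i], [4 + i]), ([4 + i, 4 + i], [4 + i])]) ++
  ([(1, 3), (3, 1), (1, 4), (4, 1), (2, 4), (4, 2)].flatMap fun p =>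
    [([p.1, p.2], [p.2, p.1]), ([4 + p.1, p.2], [p.2, 4 + p.1]),
      ([4 + p.1, 4 + p.2], [4 + p.2, 4 + p.1])]) ++
  ([(1, 2), (2, 1), (3, 4), (4, 3)].flatMap fun p =>
    [([p.1, p.2, p.1], [p.2, p.1, p.2]), ([p.2, p.1, 4 + p.2], [4 + p.1, 4 + p.2]),
      ([p.1, 4 + p.2, p.1], [p.2, 4 + p.1, p.2])]) ++
  [([2, 3, 2, 3], [3, 2, 3, 2]), ([2, 3, 6], [3, 6]), ([2, 7, 2, 7], [7, 6, 7]),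
    ([2, 3, 2, 7], [7, 2, 3, 2]), ([6, 3, 6], [6]), ([6, 7, 6], [6]), ([6, 3, 2], [6, 3]),
    ([6, 7, 2], [6, 7])]

/-- The weights of the letters in the completion in type F₄. -/
def f4Wt (a : ℕ) : ℕ :=
  match Nat.ble a 4 with
  | true => 2
  | false => 1

/-- The completion steps in type F₄. -/
def f4Steps : List ℕ := [
  83138, 118082, 83202, 135490, 71106, 54786, 100610, 37186, 135554, 20866, 543106, 1591426, 1591682,
  1591554, 562308, 608386, 1610884, 608514, 1344578, 1344834, 1344706, 870468, 1344962, 1344770,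
  608322, 1102338, 593156, 1102210, 2150658, 2150914, 2150722, 2150786, 1707268, 658692, 1121540,
  1167618, 2170116, 1167682, 597252, 1167746, 1903810, 1904066, 1903938, 1167554, 1624322, 1150084,
  1624578, 1150340, 1628674, 1154436, 1694210, 580098, 645634, 1361154, 1133636, 2183554, 1709316,
  660740, 872900, 1134084, 330052, 399620, 591236, 1657090, 1656898, 284996, 366018, 1410242, 874564,
  1410498, 1410306, 1410178, 870724, 1349058, 562564, 2216258, 2216322, 1711364, 662788, 2216130,
  1707524, 658948, 844228, 1969474, 1969410, 1121796, 597508, 300482, 874820, 1414594, 1711620,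
  663044, 593412, 9211202, 25986180, 25990276, 30001282, 22846598, 6069382, 30001410, 30001666,
  8964550, 25741766, 8686980, 25464196, 8691076, 25468292, 17631556, 34408772, 18680132, 17630596,
  34407812, 18679172, 5853636, 5852676, 21582276, 21581316, 13929542, 21546242, 18123846, 21546498,
  21792194, 21792002, 18139206, 21611778, 18127942, 21612034, 5278982, 35457348, 35456388, 34918786,
  27348230, 10571014, 34443586, 23170310, 6393094, 23104774, 6327558, 9557254, 18698626, 5283078,
  18403462, 35180674, 26266114, 21824706, 4804100, 5887490, 13995078, 22594818, 18189382, 22595074,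
  21857730, 21857538, 18143302, 22660354, 18193478, 22660610, 22630852, 22629892, 21796290, 18139462,
  21616130, 35475842, 27383046, 10605830, 35492162, 23174406, 6397190, 23108870, 6331654, 23170566,
  6393350, 23105030, 6327814, 5283334, 4838914, 21861826, 18143558, 22664706, 23174662, 6397446,
  23109126, 6331910, 5279238, 22912134, 6134918, 31049986, 31050242, 27106436, 10329220, 18400646,
  25975298, 18466182, 27023874, 27023682, 23174278, 6397062, 22846982, 6069766, 30007490, 30007746,
  1690049, 1427908, 379332, 1689858, 1154180, 27034756, 18468998, 138987718, 407423174, 155764934,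
  138987974, 407423430, 155765190, 147443908, 147444932, 424200390, 424200646, 344742212, 345790788,
  282103046, 550538502, 298880262, 567315718, 551095556, 551099652, 562890116, 546113860, 546112900,
  147382724, 282107142, 550542598, 298884358, 567319814, 147448004, 147444164, 551099908, 416318596,
  420250756, 417367172, 138994054, 139059590, 348737988, 348737028, 567872772, 567876868, 567877124,
  563938692, 547162436, 547161476, 147378628, 147448260, 282107398, 550542854, 298884614, 567320070,
  349786564, 349785604, 282103302, 80267592, 210539650, 210539906, 415532226, 415532482, 361515076,
  164153474, 10259778, 76306754, 77355330, 348701954, 290229320, 348702210, 344786114, 223382600,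
  344851650, 348767490, 290233416, 348767746, 349210050, 290261064, 169138440, 434144388, 349750530,
  290294856, 349750786, 361563330, 223939656, 361628866, 349816066, 290298952, 349816322, 349767106,
  290295880, 290233672, 348771842, 169695496, 290299208, 349820418, 433095812, 421299332, 432309442,
  362563652, 289982792, 344757762, 290048328, 345806338, 369987080, 101551624, 369991176, 101555720,
  369921544, 101486088, 369925640, 101490184, 344753346, 344753410, 289982536, 344753666, 139053254,
  407488710, 155830470, 424265926, 164159940, 164155844, 211588226, 211588482, 76322306, 77370882,
  345801922, 345801986, 290048072, 345802242, 6715656390, 6715656646, 2500380870, 2500381126,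
  8939146502, 8737819910, 4786785542, 4786789638, 2359120070, 6795348166, 6795348422, 9081752838,
  9081756934, 9086031110, 8754597126, 2359170246, 7797786952, 3368636548, 8066222408, 8801029380,
  8797097220, 4513369352, 8808336648, 4781804808, 9076772104, 9069464836, 9069468932, 9065532676,
  9065536772, 8939703556, 8817806596, 4513715464, 4782150920, 4513373448, 4781808904, 9076776200,
  6661375108, 5650338244, 5650337284, 9082309892, 9082313988, 9086242052, 4513373704, 5651386820,
  5651385860, 4513369608, 2359118278, 2359052742, 6678152324, 6648547586, 6648547842, 6916983042,
  6916983298, 5847713994, 1552746698, 6791153922, 6791154178, 6933760258, 6933760514, 5516120516,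
  5516119556, 5532897732, 5532896772, 1284377034, 5847779530, 1552812234, 5847714250, 1552746954,
  6660850882, 6660851138, 6723765442, 6723765698, 6677628098, 6677628354, 1284311498, 5847779786,
  1552812490, 6648546562, 6648546818, 6648612098, 6648612354, 6715721926, 2500446406, 6795413702,
  7797852488, 3385413764, 8066287944, 1221153220, 1237930436, 5579277506, 4643672138, 3574369354,
  5650302466, 5579343042, 4643737674, 3574373450, 5650368002, 6946063554, 6946063810, 5596054722,
  4644720714, 3574434890, 5651351042, 5596120258, 4644786250, 3574438986, 5651416578, 5650372098,
  5651420674, 6929286338, 6929286594, 6740542658, 6916982018, 6916982274, 3574122826, 5517645250,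
  3574188362, 5534422466, 7001181706, 2706214410, 2697301514, 7001185802, 2706218506, 2697305610,
  7001116170, 2706148874, 6992203274, 2697235978, 7001120266, 2706152970, 6992207370, 2697240074,
  5579244802, 4643670090, 5579245058, 5516592322, 5516592578, 4639754314, 3574122570, 5517640898,
  5517641154, 7593543878, 6648613122, 6648613378, 6791219458, 6791219714, 1285425610, 1285360074,
  1222677954, 1239455170, 5580293378, 4643735626, 5580293634, 5533369538, 5533369794, 4640802890,
  3574188106, 5534418114, 5534418370, 37728864584, 37729913160, 37728863624, 37729912200,
  144099806472, 139804839176, 144368241928, 140073274632, 144230616326, 139935649030, 142955547910,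
  138660580614, 37729947016, 144368246024, 140073278728, 144373222662, 144373226758, 140078255366,
  140078259462, 142972325126, 138677357830, 37745892872, 37744844296, 122625247428, 144231173380,
  139797531908, 139793599748, 124764686794, 122642024644, 144373779716, 144373783812, 140065967364,
  140062035204, 140062039300, 56045144516, 56045210052, 42023831880, 42024880456, 42023830920,
  42024879496, 42024914312, 53922613444, 122642090180, 139936206084, 140078812420, 140078816516,
  90341724612, 90341723652, 90358501828, 90358500868, 124765735370, 56046258628, 107580279042,
  107580279298, 107848714498, 107848714754, 129059588298, 108729518338, 108729518594, 107865491714,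
  107865491970, 129060636874, 106581755074, 106581755330, 122613777666, 122612728898, 106850190530,
  106850190786, 106573645058, 106573710594, 107580278018, 107580278274, 107580343554, 107580343810,
  107580344578, 107580344834, 108729583874, 108729584130, 69941108038, 69957885254, 74298756172,
  90404947138, 74315533388, 90421724354, 110868612354, 110868677890, 107848713474, 107848713730,
  89268454594, 74298755148, 57189910604, 90404849154, 89269503170, 74236070988, 74236075084,
  57056217164, 89285231810, 74299803724, 57189976140, 90405897730, 89286280386, 74252848204,
  74252852300, 57057265740, 93563439564, 24843962828, 20548995532, 93564488140, 24845011404,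
  20550044108, 122625494338, 93563439308, 24843962572, 122642271554, 93564487884, 24845011148,
  2222863977736, 2218569010440, 2223132413192, 2218837445896, 1412243704136, 1412512139592,
  1416538671432, 1416807106888, 1412243769672, 1412512205128, 1416538736968, 1416807172424,
  328783677774, 328800454990, 328783676814, 328800454030, 329052113230, 329068890446, 329052112270,
  329068889486, 1705308112130, 1705308177666, 1709603079426, 1709603144962, 1188780084302,
  915038603342, 1446479168706, 912899476558, 1188796861518, 915039651918, 1446495945922,
  912916253774, 9660665825736, 9660665760200, 9660666874312, 9660666808776, 10760177453512,
  10760177387976, 10760178502088, 10760178436552, 9658866371852, 10758377999628, 9658866375948,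
  10758378003724, 9658589023500, 10758100651276, 9658857458956, 10758369086732, 9658589027596,
  10758100655372, 9658857463052, 10758369090828, 9658589027852, 10758100655628, 9658589023756,
  10758100651532, 27232458819782, 27232475596998, 9662947461324, 9662679025868, 27816574372038,
  27816591149254, 9658384124364, 10757895752140, 9662947526860, 9662679091404, 9662947461580,
  9662679026124, 9658384058828, 10757895686604, 9662947527116, 9662679091660, 9658385172940,
  9658385107404, 13799877332100, 13799877332356, 13804172299396, 13804172299652, 14347556930952,
  14347825366408, 14640617655376, 14640634432592, 220798037315718, 220866756792454, 154570652174794,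
  172162838219210, 154570653223370, 172162839267786, 440648830863558, 440648847640774,
  445356115019974, 445356131797190, 154607159396814, 154602864429518, 154534144952782,
  172126330997198, 154607160445390, 154602865478094, 154534146001358, 172126332045774,
  154607159396558, 154602864429262, 154607160445134, 154602865477838, 229542598329736,
  229542866765192, 84168621198610, 84237340675346, 84172916165906, 84241635642642, 84168621202706,
  84237340679442, 84172916170002, 84241635646738, 84168621202962, 84237340679698, 84168621198866,
  84237340675602, 8172434990434762, 8172434990369226, 8172434991483338, 8172434991417802,
  6971509457898634, 6971509457898890, 6971513752865930, 6971513752866186, 8173534502062538,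
  8173534501997002, 8173534503111114, 8173534503045578, 3672974574259468, 3673043293736204,
  3672974574263564, 3673043293740300, 3672974574263820, 3673043293740556, 3672974574259724,
  3673043293736460, 6971509521024132, 6971513815991428, 7121043102401668, 7121047397368964,
  8176570982222290, 8458045958932946, 8176639701699026, 8458114678409682, 8176570998999506,
  8458045975710162, 2331860362661010, 2331860362661266, 2331860631096466, 2331860631096722,
  1628121389091284, 1346646412380628, 1347745924008404, 1628121405868500, 1346646429157844,
  1347745940785620, 1628121389091028, 1628121405868244, 6971509521008898, 6971513815976194,
  130758959845919180, 135262559473289676, 130776552031963596, 135280151659334092, 128582150089738700,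
  128582150089673164, 128582150090787276, 128582150090721740, 58762905172348172, 58762973891824908,
  58762905172352268, 58762973891829004, 58762905172352524, 58762973891829260, 58762905172348428,
  58762973891825164, 26186813107096022, 26187912618723798, 26186813123873238, 26187912635501014,
  2057099191290448070, 904177686683601094, 2057099260009924806, 904177755403077830,
  2057099191289399494, 2057099260008876230, 651976107620601112, 651976176340077848,
  651976107620605208, 651976176340081944, 651976107620605464, 651976176340082200, 651976107620601368,
  651976176340078104, 32913587045528258758, 14466842971818707142, 32913588145039886534,
  14466844071330334918, 32913587045527210182, 32913588145038837958, 33474210191827028166,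
  33474210260546504902, 14542277441143720394, 14542277445438687690, 32913587061763197058,
  14466842988053645442, 921202233877219800, 2074123738484066776, 32913587061763131522,
  2057099191360195778, 33491234739020646872, 34644156243627493848, 604766092071463587092,
  623212836145173138708, 604766092140183063828, 623212836213892615444, 604766092071463591188,
  604766092140183067924, 604766092071463591444, 604766092140183068180, 310175371297540050202,
  310175371366259526938, 310175371297540054298, 310175371366259531034, 310175371297540054554,
  310175371366259531290]

/-- The rewriting system of type F₄. -/
@[irreducible] noncomputable def f4Trie : RuleTrie := RuleTrie.complete f4Wt f4Rels f4Steps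

/-- The image of a letter of type F₄ as a word of type E₆. -/
def f4Img : ℕ → List ℕ
  | 1 => [1, 6] | 2 => [3, 5] | 3 => [4] | 4 => [2]
  | 5 => [7, 12] | 6 => [9, 11] | 7 => [10] | 8 => [8]
  | _ => []

/-- The left action of a letter of type F₄ on admissible sets. -/
def f4Act (a x : ℕ) : ℕ := wordIdx (f4Img a) x

/-- The right action of a letter of type F₄ on admissible sets. -/
def f4Act' (a x : ℕ) : ℕ := wordIdx (f4Img a).reverse x

/-- A number recording the left action of a word, given reversed, on the empty set and its right
action on some admissible sets. -/
noncomputable def f4Key (w : List ℕ) : ℕ :=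
  [39, 148, 351, 319, 8].foldl
    (fun k x => Nat.add (Nat.mul 512 k) (List.rec x (fun a _ ih => f4Act' a ih) w))
    (List.rec (fun x => x) (fun a _ ih x => withNat (f4Act a x) fun y => Nat.add (ih y) 0) w 0)

/-! ### Monomials up to powers of `δ` -/

/-- Two elements of an algebra over `ℤ[δ, δ⁻¹]` are congruent if they differ by a power of `δ`. -/
def unitCon (B : Type*) [Ring B] [Algebra Rring B] : Con B where
  r a b := ∃ k : ℤ, a = (T k : Rring) • b
  iseqv := by
    refine ⟨fun a => ⟨0, by simp⟩, ?_, ?_⟩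
    · rintro a b ⟨k, rfl⟩
      exact ⟨-k, by rw [smul_smul, ← T_add]; simp⟩
    · rintro a b c ⟨k, rfl⟩ ⟨m, rfl⟩
      exact ⟨k + m, by rw [smul_smul, T_add]⟩
  mul' := by
    rintro a b c d ⟨k, rfl⟩ ⟨m, rfl⟩
    exact ⟨k + m, by rw [smul_mul_smul_comm, T_add]⟩

section unitCon

variable {B : Type*} [Ring B] [Algebra Rring B]

variable (B) in
/-- The class of an element up to powers of `δ`. -/
def unitClass : B →* (unitCon B).Quotient := (unitCon B).mk'

theorem unitClass_eq_iff {a b : B} : unitClass B a = unitClass B b ↔ ∃ k : ℤ, a = (T k : Rring) • b :=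
  (unitCon B).eq

theorem δ_pow (k : ℕ) : δ ^ k = T (k : ℤ) := by rw [δ, T_pow, mul_one]

theorem unitClass_smul (k : ℕ) (a : B) : unitClass B (δ ^ k • a) = unitClass B a :=
  unitClass_eq_iff.2 ⟨k, by rw [δ_pow]⟩

theorem unitClass_δ_smul (a : B) : unitClass B (δ • a) = unitClass B a := by
  simpa using unitClass_smul 1 a

end unitCon

theorem map_wordProd {M N F : Type*} [Monoid M] [Monoid N] [FunLike F M N] [MonoidHomClass F M N]
    (f : F) (g : ℕ → M) (w : List ℕ) : f (wordProd g w) = wordProd (fun a => f (g a)) w := by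
  induction w with
  | nil => simp
  | cons a w ih => simp [ih]

/-! ### The Brauer algebra of type F₄ -/

/-- The values of the letters in `BrF4`. -/
noncomputable def f4Gen : ℕ → BrF4
  | 1 => rgen 0 | 2 => rgen 1 | 3 => rgen 2 | 4 => rgen 3
  | 5 => egen 0 | 6 => egen 1 | 7 => egen 2 | 8 => egen 3
  | _ => 1

theorem f4Gen_r (i : Fin 4) : f4Gen (i + 1) = rgen i := by fin_cases i <;> rfl

theorem f4Gen_e (i : Fin 4) : f4Gen (4 + (i + 1)) = egen i := by fin_cases i <;> rfl

/-- The values of the letters in `BrF4` up to powers of `δ`. -/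
noncomputable def f4Class (a : ℕ) : (unitCon BrF4).Quotient := unitClass BrF4 (f4Gen a)

theorem f4Class_rel : ∀ p ∈ f4Rels, wordProd f4Class p.1 = wordProd f4Class p.2 := by
  have mk : ∀ {a b}, BrF4rel.rel a b → unitClass BrF4 (RingQuot.mkAlgHom Rring BrF4rel.rel a) =
      unitClass BrF4 (RingQuot.mkAlgHom Rring BrF4rel.rel b) :=
    fun h => congrArg _ (RingQuot.mkAlgHom_rel Rring h)
  have ee : ∀ i, unitClass BrF4 (egen i) * unitClass BrF4 (egen i) = unitClass BrF4 (egen i) := by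
    intro i
    by_cases h : i = 2 ∨ i = 3
    · have := mk (.ee_short i h)
      simpa only [map_mul, map_smul, unitClass_δ_smul, egen] using this
    · have := mk (.ee_long i (by clear mk; revert i; decide))
      simpa only [map_mul, map_smul, unitClass_smul, egen] using this
  intro p hp
  simp only [f4Rels, List.mem_append, List.mem_flatMap, or_assoc] at hp
  rcases hp with ⟨i, hi, hp⟩ | ⟨q, hq, hp⟩ | ⟨q, hq, hp⟩ | hp
  · obtain ⟨i, rfl⟩ : ∃ j : Fin 4, i = (j : ℕ) + 1 := by
      clear hp; revert i; decide
    have h1 := mk (.rr i)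
    have h2 := mk (.re i)
    have h3 := mk (.er i)
    have h4 := ee i
    simp only [map_mul, map_one] at h1 h2 h3
    simp only [List.mem_cons, List.not_mem_nil, or_false] at hp
    rcases hp with rfl | rfl | rfl | rfl <;>
      simpa [f4Class, f4Gen_r, f4Gen_e, rgen, egen]
  · obtain ⟨i, j, rfl, hij⟩ : ∃ i j : Fin 4, q = ((i : ℕ) + 1, (j : ℕ) + 1) ∧
        BrF4rel.nadj i j := by
      clear hp; revert q; unfold BrF4rel.nadj; decide
    have h1 := mk (.rr_comm hij)
    have h2 := mk (.er_comm hij)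
    have h3 := mk (.ee_comm hij)
    simp only [map_mul] at h1 h2 h3
    simp only [List.mem_cons, List.not_mem_nil, or_false] at hp
    rcases hp with rfl | rfl | rfl <;>
      simpa [f4Class, f4Gen_r, f4Gen_e, rgen, egen]
  · obtain ⟨i, j, rfl, hij⟩ : ∃ i j : Fin 4, q = ((i : ℕ) + 1, (j : ℕ) + 1) ∧
        BrF4rel.sadj i j := by
      clear hp; revert q; unfold BrF4rel.sadj; decide
    have h1 := mk (.braid hij)
    have h2 := mk (.rre hij)
    have h3 := mk (.rer hij)
    simp only [map_mul] at h1 h2 h3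
    simp only [List.mem_cons, List.not_mem_nil, or_false] at hp
    rcases hp with rfl | rfl | rfl <;>
      simpa [f4Class, f4Gen_r, f4Gen_e, rgen, egen, ← mul_assoc]
  · have h1 := mk .db1
    have h2 := mk .db2
    have h3 := mk .db3
    have h4 := mk .db4
    have h5 := mk .db5
    have h6 := mk .db6
    have h7 := mk .db7
    have h8 := mk .db8
    simp only [map_mul, map_smul, unitClass_δ_smul, ← mul_assoc] at h1 h2 h3 h4 h5 h6 h7 h8
    simp only [List.mem_cons, List.not_mem_nil, or_false] at hp
    rcases hp with rfl | rfl | rfl | rfl | rfl | rfl | rfl | rfl <;>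
      simpa [f4Class, f4Gen, rgen, egen, ← mul_assoc]

theorem f4Trie_holds : f4Trie.Holds f4Class := by
  unfold f4Trie
  generalize f4Steps = cs
  exact RuleTrie.complete_holds f4Wt f4Class_rel cs

/-- The irreducible words of type F₄, reversed. -/
noncomputable def f4Words : List (List ℕ) := f4Trie.extensions [1, 2, 3, 4, 5, 6, 7, 8] 25 []

/-- The letters of type F₄. -/
def f4Ok (r : List ℕ) : Bool := r.all fun a => Nat.blt 0 a && Nat.ble a 8

theorem f4Words_check : (f4Trie.all (fun l r => RuleTrie.decreasing f4Wt l r && f4Ok r) [] &&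
    distinctBits 63 (f4Words.map fun w =>
      Nat.mod (Nat.mul (f4Key w) 1000000000000000003) 2305843009213693951)) = true := by
  decide +kernel

theorem f4Words_nodup :
    (f4Words.map fun w => Nat.mod (Nat.mul (f4Key w) 1000000000000000003) 2305843009213693951).Nodup :=
  nodup_of_distinctBits _ ((Bool.and_eq_true _ _).mp f4Words_check).2

theorem nodup_f4Words : f4Words.Nodup := by
  have := f4Words_nodup
  generalize f4Words = l at this
  exact List.Nodup.of_map _ this

theorem f4Trie_decreasing :
    f4Trie.all (fun l r => RuleTrie.decreasing f4Wt l r && f4Ok r) [] = true :=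
  ((Bool.and_eq_true _ _).mp f4Words_check).1

theorem exists_mem_f4Words (w : List ℕ) (hw : ∀ a ∈ w, a ∈ List.range' 1 8) :
    ∃ v : List ℕ, (∀ a ∈ v, a ∈ List.range' 1 8) ∧ wordProd f4Class v = wordProd f4Class w ∧
      v.reverse ∈ f4Words := by
  have ht := f4Trie_holds
  have hd := f4Trie_decreasing
  have hn := nodup_f4Words
  unfold f4Words at hn ⊢
  generalize f4Trie = t at ht hd hn ⊢
  have hG : ∀ p l q r : List ℕ, f4Ok r = true → (∀ a ∈ p ++ l ++ q, a ∈ List.range' 1 8) →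
      ∀ a ∈ p ++ r ++ q, a ∈ List.range' 1 8 := by
    intro p l q r hr h a ha
    simp only [List.mem_append] at ha h
    rcases ha with (ha | ha) | ha
    · exact h a (by simp [ha])
    · have := List.all_eq_true.1 hr a ha
      simp only [Bool.and_eq_true, Nat.blt_eq, Nat.ble_eq] at this
      simp only [List.mem_range'_1]
      omega
    · exact h a (by simp [ha])
  obtain ⟨v, h1, h2, h3⟩ := RuleTrie.exists_irr ht (ok := fun _ r => f4Ok r) hd
    (G := fun w => ∀ a ∈ w, a ∈ List.range' 1 8) hG w hw
  refine ⟨v, h1, h2, ?_⟩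
  have := RuleTrie.mem_extensions 25 [] hn v.reverse (fun b hb => h1 b (by simpa using hb))
    (by simpa using h3)
  simpa using this

theorem f4Key_eq (w : List ℕ) : f4Key w.reverse = [39, 148, 351, 319, 8].foldl
    (fun k x => 512 * k + wordIdx (w.flatMap f4Img).reverse x) (wordIdx (w.flatMap f4Img) 0) := by
  have h1 : ∀ (v : List ℕ) (x : ℕ), List.rec (motive := fun _ => ℕ) x
      (fun a _ ih => f4Act' a ih) v = wordIdx (v.reverse.flatMap f4Img).reverse x := by
    intro v x
    induction v with
    | nil => rfl
    | cons a v ih =>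
      simp only [List.reverse_cons, List.flatMap_append, List.reverse_append, List.flatMap_cons,
        List.flatMap_nil, List.append_nil, wordIdx_append, ← ih]
      rfl
  have h2 : ∀ (v : List ℕ) (x : ℕ), List.rec (motive := fun _ => ℕ → ℕ) (fun x => x)
      (fun a _ ih x => withNat (f4Act a x) fun y => Nat.add (ih y) 0) v x =
        wordIdx (v.reverse.flatMap f4Img) x := by
    intro v
    induction v with
    | nil => exact fun _ => rfl
    | cons a v ih =>
      intro x
      simp only [List.reverse_cons, List.flatMap_append, List.flatMap_cons,
        List.flatMap_nil, List.append_nil, wordIdx_append, ← ih, withNat_eq]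
      rfl
  unfold f4Key
  rw [h2]
  simp only [h1, List.reverse_reverse]
  rfl

/-- The state reached by the image of a word of type F₄ in the representation of `BrE6`. -/
def f4State (w : List ℕ) : (Fin 512 → Fin 512) × (Fin 512 → Fin 512) :=
  wordState (w.flatMap f4Img) (id, id)

theorem f4Key_eq_of_f4State_eq {v w : List ℕ} (h : f4State v = f4State w) :
    f4Key v.reverse = f4Key w.reverse := by
  have h1 : wordIdx (v.flatMap f4Img) 0 = wordIdx (w.flatMap f4Img) 0 := by
    have := wordState_fst (v.flatMap f4Img) (id, id) 0
    rw [show wordState (v.flatMap f4Img) (id, id) = wordState (w.flatMap f4Img) (id, id) from h,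
      wordState_fst] at this
    exact this.symm
  have h2 : ∀ x < 512, wordIdx (v.flatMap f4Img).reverse x % 512 =
      wordIdx (w.flatMap f4Img).reverse x % 512 := by
    intro x hx
    have := congrArg Prod.snd h
    rw [f4State, f4State, wordState_snd, wordState_snd] at this
    exact congrArg Fin.val (congrFun this ⟨x, hx⟩)
  have h3 : ∀ (v : List ℕ) (x : ℕ), x < 512 → wordIdx v x % 512 = wordIdx v x := by
    intro v x hx
    refine Nat.mod_eq_of_lt ?_
    cases v with
    | nil => exact hx
    | cons a v => exact idxAct_lt _ _
  simp only [f4Key_eq, h1]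
  have h4 : ∀ x < 512, wordIdx (v.flatMap f4Img).reverse x =
      wordIdx (w.flatMap f4Img).reverse x := by
    intro x hx
    rw [← h3 _ x hx, h2 x hx, h3 _ x hx]
  simp [h4]

theorem f4State_injOn : Set.InjOn (fun w => f4State w.reverse) {w | w ∈ f4Words} := by
  intro v hv w hw h
  refine List.inj_on_of_nodup_map f4Words_nodup hv hw ?_
  have := f4Key_eq_of_f4State_eq h
  simp only [List.reverse_reverse] at this
  simp only [this]

theorem span_f4Words : Submodule.span Rring ((fun w : List ℕ => wordProd f4Gen w.reverse) ''
    {w | (∀ a ∈ w, a ∈ List.range' 1 8) ∧ w ∈ f4Words}) = ⊤ := by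
  have h1 : Algebra.adjoin Rring (Set.range fun x : GenF4 =>
      RingQuot.mkAlgHom Rring BrF4rel.rel (FreeAlgebra.ι Rring x)) = ⊤ := by
    have := congrArg (Subalgebra.map (RingQuot.mkAlgHom Rring BrF4rel.rel))
      (FreeAlgebra.adjoin_range_ι Rring GenF4)
    rwa [AlgHom.map_adjoin, Algebra.map_top, (AlgHom.range_eq_top _).2
      (RingQuot.mkAlgHom_surjective Rring _), ← Set.range_comp] at this
  rw [eq_top_iff, ← Algebra.top_toSubmodule, ← h1, Algebra.adjoin_eq_span, Submodule.span_le]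
  intro x hx
  obtain ⟨w, hw, rfl⟩ : ∃ w : List ℕ, (∀ a ∈ w, a ∈ List.range' 1 8) ∧ wordProd f4Gen w = x := by
    induction hx using Submonoid.closure_induction with
    | mem x hx =>
      obtain ⟨y, rfl⟩ := hx
      cases y with
      | r i => exact ⟨[i + 1], by simp; omega, by simp [f4Gen_r, rgen]⟩
      | e i => exact ⟨[4 + (i + 1)], by simp; omega, by simp [f4Gen_e, egen]⟩
    | one => exact ⟨[], by simp, by simp⟩
    | mul x y _ _ hx hy =>
      obtain ⟨v, hv, rfl⟩ := hx
      obtain ⟨w, hw, rfl⟩ := hy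
      exact ⟨v ++ w, by simp only [List.mem_append]; rintro a (h | h); exacts [hv a h, hw a h],
        by simp⟩
  obtain ⟨v, hv, h, hm⟩ := exists_mem_f4Words w hw
  have h' : unitClass BrF4 (wordProd f4Gen w) = unitClass BrF4 (wordProd f4Gen v) := by
    rw [map_wordProd, map_wordProd]
    exact h.symm
  obtain ⟨k, hk⟩ := unitClass_eq_iff.1 h'
  rw [hk]
  exact Submodule.smul_mem _ _ (Submodule.subset_span
    ⟨v.reverse, ⟨fun a ha => hv a (by simpa using ha), hm⟩, by simp⟩)

theorem f4Img_mem : ∀ a ∈ List.range' 1 8, ∀ b ∈ f4Img a, b ∈ List.range' 1 12 := by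
  decide

/-- An algebra homomorphism `BrF4 → BrE6` with the prescribed values on generators. -/
def IsFolding (φ : BrF4 →ₐ[Rring] BrE6) : Prop :=
  ∀ a ∈ List.range' 1 8, φ (f4Gen a) = wordProd e6Gen (f4Img a)

theorem IsFolding.wordProd_eq {φ : BrF4 →ₐ[Rring] BrE6} (hφ : IsFolding φ) {w : List ℕ}
    (hw : ∀ a ∈ w, a ∈ List.range' 1 8) :
    φ (wordProd f4Gen w) = wordProd e6Gen (w.flatMap f4Img) := by
  induction w with
  | nil => simp
  | cons a w ih =>
    simp [hφ a (hw a (by simp)), ih fun b hb => hw b (by simp [hb])]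

theorem IsFolding.injective {φ : BrF4 →ₐ[Rring] BrE6} (hφ : IsFolding φ) :
    Function.Injective φ := by
  let s : Set (List ℕ) := {w | (∀ a ∈ w, a ∈ List.range' 1 8) ∧ w ∈ f4Words}
  let f : BrF4 →ₗ[Rring] ((Fin 512 → Fin 512) × (Fin 512 → Fin 512) →₀ Rring) :=
    LinearMap.applyₗ (Finsupp.single (id, id) 1) ∘ₗ (e6Rep.comp φ).toLinearMap
  have hf : ∀ w : s, ∃ u : Rringˣ, f (wordProd f4Gen (w : List ℕ).reverse) =
      u • Finsupp.single (f4State (w : List ℕ).reverse) 1 := by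
    intro ⟨w, hw, _⟩
    have hu : IsUnit (δ ^ (wordAct (w.reverse.flatMap f4Img) 0 / 512) : Rring) := by
      rw [δ_pow]; exact isUnit_T _
    refine ⟨hu.unit, ?_⟩
    have hw' : ∀ a ∈ w.reverse, a ∈ List.range' 1 8 := fun a ha => hw a (by simpa using ha)
    change e6Rep (φ (wordProd f4Gen w.reverse)) (Finsupp.single (id, id) 1) = _
    rw [hφ.wordProd_eq hw', e6Rep_wordProd, wordProd_actOp, Units.smul_def, IsUnit.unit_spec,
      Finsupp.smul_single, smul_eq_mul, mul_one]
    · rfl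
    · intro b hb
      obtain ⟨a, ha, hb⟩ := List.mem_flatMap.1 hb
      exact f4Img_mem a (hw' a ha) b hb
  choose u hu using hf
  have hli : LinearIndepOn Rring (fun w : List ℕ => f (wordProd f4Gen w.reverse)) s := by
    have := ((Finsupp.linearIndependent_single_one Rring
      ((Fin 512 → Fin 512) × (Fin 512 → Fin 512))).comp
      (fun w : s => f4State (w : List ℕ).reverse)
      (fun v w h => Subtype.ext (f4State_injOn v.2.2 w.2.2 h))).units_smul u
    unfold LinearIndepOn
    convert this using 1
    funext w
    exact hu w
  intro x y hxy
  have hs : ∀ x, x ∈ Submodule.span Rring ((fun w : List ℕ => wordProd f4Gen w.reverse) '' s) := by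
    intro x
    rw [span_f4Words]; trivial
  obtain ⟨l, hl, rfl⟩ := (Finsupp.mem_span_image_iff_linearCombination Rring).1 (hs x)
  obtain ⟨m, hm, rfl⟩ := (Finsupp.mem_span_image_iff_linearCombination Rring).1 (hs y)
  have h1 : f (Finsupp.linearCombination Rring (fun w : List ℕ => wordProd f4Gen w.reverse) l) =
      f (Finsupp.linearCombination Rring (fun w : List ℕ => wordProd f4Gen w.reverse) m) := by
    change e6Rep (φ _) (Finsupp.single (id, id) 1) = e6Rep (φ _) (Finsupp.single (id, id) 1)
    rw [hxy]
  rw [Finsupp.apply_linearCombination, Finsupp.apply_linearCombination] at h1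
  rw [linearIndepOn_iffₛ.1 hli l hl m hm h1]

/-! ### The rewriting system of type E₆ -/

/-- All letters of type E₆ have weight 1. -/
def e6Wt (_ : ℕ) : ℕ := 1

/-- The completion steps in type E₆. -/
def e6Steps : List ℕ := [
  115842, 133570, 115970, 168386, 73218, 40578, 116034, 185794, 89730, 73410, 116098, 203202, 106178,
  89858, 133314, 18626, 151042, 19010, 25154, 123458, 133442, 185858, 133506, 203266, 107202, 90882,
  150850, 54722, 185922, 22082, 150914, 55746, 203330, 23106, 108226, 91906, 168322, 72194, 72258,
  203394, 39554, 55938, 2378946, 2379330, 2379266, 2379074, 2379138, 1885250, 1885634, 1885314,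
  1885442, 1166404, 1885826, 1885506, 1885570, 837188, 282052, 319106, 2415812, 904770, 904514,
  904578, 331012, 1102274, 2674946, 2675330, 2675138, 429316, 2002180, 2675074, 2428098, 2428482,
  2428418, 676036, 2248900, 2428226, 1462468, 2428610, 2428290, 1117828, 331396, 840260, 578116,
  861890, 2696452, 1200770, 337156, 1200578, 1200514, 610628, 1381890, 872772, 1381954, 2954562,
  2954946, 2954690, 2954754, 708932, 2281796, 2954818, 971076, 2543940, 2707714, 2708098, 2707906,
  2707842, 1742084, 2708226, 1397444, 611012, 873156, 1119876, 1141506, 2976068, 1480386, 1480130,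
  616772, 1480194, 878916, 1480258, 1152388, 1661570, 3234178, 3234562, 3234242, 3234306, 3234370,
  3234434, 1250692, 2823556, 2987330, 2987714, 2987458, 2987522, 2987586, 1677060, 1152772, 1399492,
  3255684, 1760002, 1759682, 1759746, 1759810, 1158532, 1759874, 2658562, 2658946, 2658754, 2658690,
  2164866, 2165250, 2165186, 2164930, 921732, 2165314, 2165058, 1446020, 2165442, 2165122, 1116804,
  561668, 598594, 598722, 2695428, 1184386, 1184194, 1184130, 1869058, 1165380, 1869122, 1869186,
  2214082, 924804, 2214210, 2214274, 1901890, 1429572, 1901954, 2740610, 1430020, 1428100, 1918338,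
  1692740, 3003906, 3003970, 974148, 2547012, 1693316, 643780, 1692356, 3267074, 3267138, 990596,
  2563460, 3267202, 1169156, 396420, 2148674, 2148738, 2493762, 2493826, 2181506, 1709188, 3020354,
  3283522, 3283586, 1253764, 2826628, 2444674, 1725636, 451908, 1150404, 468356, 3299970, 1254788,
  2827652, 1148484, 889348, 627268, 731524, 993668, 887428, 364164, 2477570, 2477378, 2477442,
  2477122, 1983618, 1984002, 1983746, 1172548, 1984130, 1983810, 1983874, 1983682, 1990146, 1172932,
  1990274, 417282, 417410, 2773442, 435460, 2008324, 2773378, 2773186, 435844, 2008708, 2526722,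
  682180, 2255044, 2526530, 1468612, 2526914, 2526594, 2526466, 682564, 2255428, 1468996, 2533058,
  337540, 584260, 960194, 3052994, 3053058, 715076, 2287940, 3053122, 977220, 2550084, 3052802,
  715460, 2288324, 977604, 2550468, 2806210, 2806146, 1748228, 2806530, 2806082, 1748612, 2812674,
  617156, 879300, 1239810, 3332546, 3332610, 3332674, 3332738, 1256836, 2829700, 3332418, 1257220,
  2830084, 3085762, 3085826, 3085890, 3085698, 1158916, 2757058, 2756994, 2756738, 2263490, 2263234,
  927876, 2263618, 2263362, 1452164, 2263746, 2263426, 2263298, 928260, 2269762, 1452548, 2269890,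
  696898, 697026, 1166788, 1891970, 429700, 2002564, 676420, 2249284, 1462852, 2434754, 709316,
  2282180, 971460, 2544324, 1742468, 2714370, 1251076, 2823940, 922116, 2171458, 1446404, 2171586,
  17631492, 17370372, 13930822, 5558598, 10032518, 14226822, 277892358, 88904008, 227087752,
  93132168, 3302017288, 5658939720, 1489573258, 4710798730, 90534875466, 75242214796, 1741890852236,
  932088190350, 18491181404494, 27870123070862, 445907879925136, 155120533541202, 94955254479132052,
  19101333154540623256]

/-- The rewriting system of type E₆. -/
@[irreducible] noncomputable def e6Trie : RuleTrie :=
  RuleTrie.complete e6Wt (e6Rels.map fun p => (p.1, p.2.1)) e6Steps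

/-- Words `path x` such that `path x` maps the root with index 2 to the root with index `x`. -/
def rootPaths : List (List ℕ) := [
  [3, 1, 4, 2, 3, 4], [], [4, 2, 3, 4], [2, 4], [4, 2, 5, 4], [5, 4, 2, 6, 5, 4], [1, 4, 2, 3, 4],
  [4], [2, 3, 4], [2, 5, 4], [4, 2, 6, 5, 4], [1, 2, 3, 4], [3, 4], [5, 4], [2, 3, 5, 4],
  [2, 6, 5, 4], [1, 3, 4], [1, 2, 3, 5, 4], [3, 5, 4], [6, 5, 4], [2, 3, 6, 5, 4], [1, 3, 5, 4],
  [1, 2, 3, 6, 5, 4], [4, 3, 5, 4], [3, 6, 5, 4], [1, 4, 3, 5, 4], [1, 3, 6, 5, 4],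
  [4, 3, 6, 5, 4], [3, 1, 4, 3, 5, 4], [1, 4, 3, 6, 5, 4], [5, 4, 3, 6, 5, 4],
  [3, 1, 4, 3, 6, 5, 4], [1, 5, 4, 3, 6, 5, 4], [3, 1, 5, 4, 3, 6, 5, 4],
  [4, 3, 1, 5, 4, 3, 6, 5, 4], [2, 4, 3, 1, 5, 4, 3, 6, 5, 4]]

/-- A word mapping the root with index 2 to the root with index `x`. -/
def rootPath (x : ℕ) : List ℕ := rootPaths.getD (Nat.sub x 1) []

/-- A word for the element `E` attached to the root with index `x`. -/
def rootWord (x : ℕ) : List ℕ := rootPath x ++ 8 :: (rootPath x).reverse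

/-- A normalised word for the element `E` attached to the root with index `x`. -/
noncomputable def rootNf (x : ℕ) : List ℕ := (e6Trie.nf (rootWord x)).reverse

/-- Words for the simple reflections of a set of roots containing a basis of the root system of
type A₅ orthogonal to the root with index 2; these words are palindromes. -/
def fixWord : ℕ → List ℕ
  | 4 => [4, 2, 3, 4, 5, 4, 3, 2, 4]
  | b => [b]

/-- The simple roots in the orthogonal set of each of the four levels. -/
def levelRoots : ℕ → List ℕ
  | 0 => [] | 1 => [2] | 2 => [3, 5] | _ => [3, 5, 2]

/-- The product of the elements `E` over the orthogonal set of each level. -/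
def levelWord (L : ℕ) : List ℕ := (levelRoots L).map fun i => Nat.add 6 i

/-- Elements stabilising the orthogonal set of each level. -/
def levelStab : ℕ → List (List ℕ)
  | 0 => [[1], [2], [3], [4], [5], [6]]
  | 1 => [[1], [2], [3], [5], [6], [4, 2, 3, 4, 5, 4, 3, 2, 4]]
  | 2 => [[2], [3], [5], [4, 3, 5, 4], [1, 3, 4, 5, 6, 5, 4, 3, 1]]
  | _ => [[2], [3], [5], [1, 3, 4, 2, 5, 4, 3, 1], [6, 5, 4, 2, 3, 4, 5, 6]]

/-- Representatives `x` of the orbits on roots of the stabiliser of each level, with a form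
`p`, `L`, `q` for the product of the element `E` attached to `x` with the one of the level. -/
def levelReps : ℕ → List (ℕ × List ℕ × ℕ × List ℕ)
  | 0 => [(2, [], 1, [])]
  | 1 => [(1, [4, 5, 2, 4, 3, 1], 2, [1, 3, 4, 2, 5, 4]), (2, [], 1, []), (4, [2, 4], 1, [])]
  | 2 => [(1, [3, 1], 2, []), (2, [], 3, []), (3, [], 2, []), (4, [3, 4], 2, [])]
  | _ => [(1, [3, 1], 3, []), (2, [], 3, []), (4, [3, 4], 3, []), (18, [1, 3, 4, 3, 1, 5], 3, []),
      (24, [], 3, [])]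

/-- Words of type F₄ for the paths to the roots fixed by the diagram automorphism. -/
def fixedRoots : List (ℕ × List ℕ) :=
  [(2, []), (4, [4, 3]), (8, [3]), (15, [2, 4, 3]), (19, [2, 3]), (23, [1, 2, 4, 3]),
    (24, [3, 2, 3]), (27, [1, 2, 3]), (30, [1, 3, 2, 3]), (34, [2, 1, 3, 2, 3]),
    (35, [3, 2, 1, 3, 2, 3]), (36, [4, 3, 2, 1, 3, 2, 3])]

/-- The diagram automorphism on letters. -/
def sigLetter : ℕ → ℕ
  | 1 => 6 | 3 => 5 | 5 => 3 | 6 => 1 | 7 => 12 | 9 => 11 | 11 => 9 | 12 => 7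
  | a => a

/-- The diagram automorphism on roots. -/
def sigRoot (x : ℕ) : ℕ := wordIdx ((rootPath x).map sigLetter) 2

/-- The reflections of the words of type A₅ × A₁ and their relations. -/
def fixRels : List (List ℕ × List ℕ) :=
  ([1, 2, 3, 4, 5, 6].map fun i => ([i, i], [])) ++
  [([1, 2], [2, 1]), ([1, 3, 1], [3, 1, 3]), ([1, 4, 1], [4, 1, 4]), ([1, 5], [5, 1]),
    ([1, 6], [6, 1]), ([2, 3], [3, 2]), ([2, 4], [4, 2]), ([2, 5], [5, 2]), ([2, 6], [6, 2]),
    ([3, 4], [4, 3]), ([3, 5], [5, 3]), ([3, 6], [6, 3]), ([4, 5], [5, 4]),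
    ([4, 6, 4], [6, 4, 6]), ([5, 6, 5], [6, 5, 6])]

/-- Triples `(u, v, w)` with `u v` equal to the word of a level and `v w = v`. -/
def levelAbsorb : ℕ → List (List ℕ × List ℕ × List ℕ)
  | 2 => [([], [9, 11], [3]), ([], [9, 11], [5]), ([], [9, 11], [4, 3, 5, 4]),
      ([], [9, 11], [2, 4, 3, 5, 4, 2])]
  | 3 => [([], [9, 11, 8], [3]), ([], [9, 11, 8], [5]), ([], [9, 11, 8], [2]),
      ([], [9, 11, 8], [4, 3, 5, 4]), ([11], [8, 9], [4, 2, 3, 4]),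
      ([9], [11, 8], [1, 3, 4, 2, 5, 4, 3, 1]), ([11], [8, 9], [6, 5, 4, 2, 3, 4, 5, 6])]
  | _ => []

/-- Equality of words, tested letter by letter. -/
noncomputable def wordBeq (v : List ℕ) : List ℕ → Bool :=
  List.rec (fun w => List.rec true (fun _ _ _ => false) w)
    (fun a _ ih w => List.rec false (fun b w' _ => Nat.beq a b && ih w') w) v

theorem eq_of_wordBeq : ∀ {v w : List ℕ}, wordBeq v w = true → v = w
  | [], [], _ => rfl
  | [], _ :: _, h => by cases h
  | _ :: _, [], h => by cases h
  | a :: v, b :: w, h => by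
    obtain ⟨h1, h2⟩ := (Bool.and_eq_true _ _).mp h
    rw [Nat.eq_of_beq_eq_true h1, eq_of_wordBeq h2]

/-- Two words have the same normal form. -/
noncomputable def e6Eq (v w : List ℕ) : Bool := wordBeq (e6Trie.nf v) (e6Trie.nf w)

/-- Multiplying a path by a letter gives a path times an element fixing the root with index 2. -/
noncomputable def rootPathCheck : Bool :=
  (List.range' 1 6).all fun a => (List.range' 1 36).all fun x =>
    withNat (idxAct a x) fun y => Nat.ble 1 y && Nat.ble y 36 &&
      [[], [1], [2], [3], [4], [5], [6]].any fun k =>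
        e6Eq (a :: rootPath x) (rootPath y ++ k.flatMap fixWord)

/-- The rewriting system shows that each level is stabilised. -/
noncomputable def levelCheck : Bool :=
  (List.range' 0 4).all fun L =>
    ((levelStab L).all fun s =>
      e6Eq ((levelRoots L).flatMap fun x => rootNf (wordIdx s x)) (levelWord L)) &&
    ((levelReps L).all fun r =>
      e6Eq (rootNf r.1 ++ levelWord L) (r.2.1 ++ levelWord r.2.2.1 ++ r.2.2.2)) &&
    ((levelAbsorb L).all fun r =>
      e6Eq (r.1 ++ r.2.1) (levelWord L) && e6Eq (r.2.1 ++ r.2.2) r.2.1) &&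
    e6Eq (levelWord L ++ levelWord L) (levelWord L) && e6Eq (levelWord L).reverse (levelWord L)

/-- The remaining identities to be verified by the rewriting system. -/
def e6Identities : List (List ℕ × List ℕ) :=
  ((List.range' 1 6).map fun b => (fixWord b ++ [8], 8 :: fixWord b)) ++
  ((List.range' 1 6).map fun i => (rootWord i, [Nat.add 6 i])) ++
  (fixRels.map fun p => (p.1.flatMap fixWord, p.2.flatMap fixWord)) ++
  (fixedRoots.map fun p => (rootPath p.1, p.2.flatMap f4Img)) ++
  ((List.range' 1 8).map fun a => ((f4Img a).reverse, f4Img a)) ++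
  [([4, 2, 3, 4, 5, 4, 3, 2, 4], [3, 2, 3, 4, 3, 2, 3].flatMap f4Img),
    ([1, 3, 4, 5, 6, 5, 4, 3, 1], [1, 2, 3, 2, 1].flatMap f4Img),
    ([9, 11, 4, 3], [9, 11, 10]), ([9, 11, 8, 4, 3], [9, 11, 8, 10]), ([9, 10], [9, 4, 3])]

theorem e6_checks : (rootPathCheck && levelCheck && e6Identities.all fun p => e6Eq p.1 p.2) = true := by
  decide +kernel

/-! ### Monoids generated by elements satisfying the relations of type E₆ -/

/-- A word in the letters `1, …, 6`. -/
def IsRWord (w : List ℕ) : Prop := ∀ a ∈ w, a ∈ List.range' 1 6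

instance : DecidablePred IsRWord := fun w => by unfold IsRWord; infer_instance

theorem isRWord_nil : IsRWord [] := by simp [IsRWord]

theorem isRWord_cons {a : ℕ} {w : List ℕ} : IsRWord (a :: w) ↔ a ∈ List.range' 1 6 ∧ IsRWord w := by
  simp only [IsRWord, List.forall_mem_cons]

theorem isRWord_append {v w : List ℕ} : IsRWord (v ++ w) ↔ IsRWord v ∧ IsRWord w := by
  simp only [IsRWord, List.forall_mem_append]

theorem IsRWord.append {v w : List ℕ} (hv : IsRWord v) (hw : IsRWord w) : IsRWord (v ++ w) :=
  isRWord_append.2 ⟨hv, hw⟩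

theorem IsRWord.reverse {w : List ℕ} (hw : IsRWord w) : IsRWord w.reverse := by
  simpa [IsRWord] using hw

/-- A family of elements satisfying the relations of type E₆ up to powers of `δ`, such that
products act on admissible sets. -/
structure IsE6System {M : Type*} [Monoid M] (g : ℕ → M) : Prop where
  rel : ∀ {l r : List ℕ} {k : ℕ}, e6Rel l r k → wordProd g l = wordProd g r
  idx : ∀ {v w : List ℕ}, (∀ a ∈ v, a ∈ List.range' 1 12) → (∀ a ∈ w, a ∈ List.range' 1 12) →
    wordProd g v = wordProd g w → ∀ x < 512,
      wordIdx v x = wordIdx w x ∧ wordIdx v.reverse x = wordIdx w.reverse x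

theorem op_wordProd {M : Type*} [Monoid M] (g : ℕ → M) (w : List ℕ) :
    MulOpposite.op (wordProd g w) = wordProd (fun a => MulOpposite.op (g a)) w.reverse := by
  induction w with
  | nil => simp
  | cons a w ih => simp [ih]

theorem rootPath_isRWord : ∀ x ∈ List.range' 1 36, IsRWord (rootPath x) := by decide

theorem isRWord_flatMap_fixWord {k : List ℕ} (hk : IsRWord k) : IsRWord (k.flatMap fixWord) := by
  intro b hb
  obtain ⟨a, ha, hb⟩ := List.mem_flatMap.1 hb
  exact (by decide : ∀ a ∈ List.range' 1 6, IsRWord (fixWord a)) a (hk a ha) b hb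

theorem fixWord_reverse : ∀ b ∈ List.range' 1 6, (fixWord b).reverse = fixWord b := by decide

theorem e6_checks_paths : ∀ a ∈ List.range' 1 6, ∀ x ∈ List.range' 1 36,
    idxAct a x ∈ List.range' 1 36 ∧ ∃ k, IsRWord k ∧
      e6Eq (a :: rootPath x) (rootPath (idxAct a x) ++ k.flatMap fixWord) = true := by
  have h := e6_checks
  simp only [Bool.and_eq_true, rootPathCheck, List.all_eq_true, List.any_eq_true, withNat_eq,
    Nat.ble_eq] at h
  intro a ha x hx
  obtain ⟨⟨h1, h2⟩, k, hk, h3⟩ := h.1.1 a ha x hx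
  refine ⟨by simp only [List.mem_range'_1]; omega, k, ?_, h3⟩
  clear h3
  revert k
  decide

theorem e6_checks_level : ∀ L < 4,
    (∀ s ∈ levelStab L, e6Eq ((levelRoots L).flatMap fun x => rootNf (wordIdx s x)) (levelWord L)) ∧
    (∀ r ∈ levelReps L, e6Eq (rootNf r.1 ++ levelWord L) (r.2.1 ++ levelWord r.2.2.1 ++ r.2.2.2)) ∧
    (∀ r ∈ levelAbsorb L, e6Eq (r.1 ++ r.2.1) (levelWord L) ∧ e6Eq (r.2.1 ++ r.2.2) r.2.1) ∧
    e6Eq (levelWord L ++ levelWord L) (levelWord L) ∧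
    e6Eq (levelWord L).reverse (levelWord L) := by
  have h := e6_checks
  simp only [Bool.and_eq_true, levelCheck, List.all_eq_true] at h
  intro L hL
  have := h.1.2 L (by simp [hL])
  tauto

theorem e6_checks_identities : ∀ p ∈ e6Identities, e6Eq p.1 p.2 = true := by
  have h := e6_checks
  simp only [Bool.and_eq_true, List.all_eq_true] at h
  exact h.2

namespace IsE6System

variable {M : Type*} [Monoid M] {g : ℕ → M} (hg : IsE6System g)

include hg

theorem e6Trie_holds : e6Trie.Holds g := by
  have h : ∀ p ∈ e6Rels.map fun p => (p.1, p.2.1), wordProd g p.1 = wordProd g p.2 := by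
    intro p hp
    obtain ⟨q, hq, rfl⟩ := List.mem_map.1 hp
    exact hg.rel (k := q.2.2) (Or.inl hq)
  unfold e6Trie
  generalize e6Steps = cs
  exact RuleTrie.complete_holds e6Wt h cs

theorem wordProd_nf (w : List ℕ) : wordProd g (e6Trie.nf w).reverse = wordProd g w :=
  RuleTrie.wordProd_nf hg.e6Trie_holds w

theorem eq_of_e6Eq {v w : List ℕ} (h : e6Eq v w = true) : wordProd g v = wordProd g w := by
  rw [← hg.wordProd_nf v, ← hg.wordProd_nf w, eq_of_wordBeq h]

theorem eq_of_mem {p : List ℕ × List ℕ} (hp : p ∈ e6Identities) : wordProd g p.1 = wordProd g p.2 :=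
  hg.eq_of_e6Eq (e6_checks_identities p hp)

theorem op : IsE6System fun a => MulOpposite.op (g a) where
  rel {l r k} h := by
    have := congrArg MulOpposite.op (hg.rel h.reverse)
    simpa [op_wordProd] using this
  idx {v w} hv hw h x hx := by
    have h' : wordProd g v.reverse = wordProd g w.reverse :=
      MulOpposite.op_injective (by simpa [op_wordProd] using h)
    have := hg.idx (by simpa using hv) (by simpa using hw) h' x hx
    simpa [and_comm] using this

theorem mul_self_R {a : ℕ} (ha : a ∈ List.range' 1 6) : g a * g a = 1 := by
  have : ∀ a ∈ List.range' 1 6, e6Rel [a, a] [] 0 := by decide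
  simpa using hg.rel (this a ha)

theorem wordProd_mul_reverse {w : List ℕ} (hw : IsRWord w) :
    wordProd g w * wordProd g w.reverse = 1 := by
  induction w with
  | nil => simp
  | cons a w ih =>
    obtain ⟨ha, hw⟩ := isRWord_cons.1 hw
    rw [List.reverse_cons, wordProd_append, wordProd_cons, mul_assoc, ← mul_assoc (wordProd g w),
      ih hw, one_mul, wordProd_cons, wordProd_nil, mul_one, hg.mul_self_R ha]

theorem wordProd_reverse_mul {w : List ℕ} (hw : IsRWord w) :
    wordProd g w.reverse * wordProd g w = 1 := by
  simpa using hg.wordProd_mul_reverse hw.reverse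

theorem reverse_mul_cancel {w : List ℕ} (hw : IsRWord w) (m : M) :
    wordProd g w.reverse * (wordProd g w * m) = m := by
  rw [← mul_assoc, hg.wordProd_reverse_mul hw, one_mul]

/-- The elements fixing the root with index 2 commute with the element `E` of that root. -/
theorem fixWord_comm {k : List ℕ} (hk : IsRWord k) :
    wordProd g (k.flatMap fixWord) * g 8 = g 8 * wordProd g (k.flatMap fixWord) := by
  induction k with
  | nil => simp
  | cons b k ih =>
    obtain ⟨hb, hk⟩ := isRWord_cons.1 hk
    have h : wordProd g (fixWord b ++ [8]) = wordProd g (8 :: fixWord b) :=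
      hg.eq_of_mem (p := (fixWord b ++ [8], 8 :: fixWord b)) (by
        simp only [e6Identities, List.mem_append]
        exact .inl <| .inl <| .inl <| .inl <| .inl <| List.mem_map_of_mem hb)
    rw [wordProd_append, wordProd_cons, wordProd_cons, wordProd_nil, mul_one] at h
    rw [List.flatMap_cons, wordProd_append, mul_assoc, ih hk, ← mul_assoc, h, mul_assoc]

/-- The element `E` attached to the root with index `i`, for simple roots. -/
theorem wordProd_rootWord {i : ℕ} (hi : i ∈ List.range' 1 6) : wordProd g (rootWord i) = g (6 + i) := by
  have := hg.eq_of_mem (p := (rootWord i, [Nat.add 6 i])) (by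
    simp only [e6Identities, List.mem_append]
    exact .inl <| .inl <| .inl <| .inl <| .inr <| List.mem_map_of_mem
      (f := fun i => (rootWord i, [Nat.add 6 i])) hi)
  simpa using this

omit hg in
theorem wordProd_rootWord_eq (x : ℕ) : wordProd g (rootWord x) =
    wordProd g (rootPath x) * (g 8 * wordProd g (rootPath x).reverse) := by
  rw [rootWord, wordProd_append, wordProd_cons]

theorem letter_mul_rootWord {a x : ℕ} (ha : a ∈ List.range' 1 6) (hx : x ∈ List.range' 1 36) :
    g a * wordProd g (rootWord x) = wordProd g (rootWord (idxAct a x)) * g a := by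
  obtain ⟨hy, k, hk, h⟩ := e6_checks_paths a ha x hx
  have hP := rootPath_isRWord x hx
  have hQ := rootPath_isRWord _ hy
  have h1 := hg.eq_of_e6Eq h
  rw [wordProd_cons, wordProd_append] at h1
  have h2 : wordProd g (k.flatMap fixWord) * wordProd g (rootPath x).reverse =
      wordProd g (rootPath (idxAct a x)).reverse * g a := by
    have : wordProd g (k.flatMap fixWord) =
        wordProd g (rootPath (idxAct a x)).reverse * (g a * wordProd g (rootPath x)) := by
      rw [h1, hg.reverse_mul_cancel hQ]
    rw [this, mul_assoc, mul_assoc, hg.wordProd_mul_reverse hP, mul_one]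
  rw [wordProd_rootWord_eq, wordProd_rootWord_eq, ← mul_assoc, h1, mul_assoc, ← mul_assoc _ (g 8),
    hg.fixWord_comm hk, mul_assoc (g 8), h2]
  simp only [mul_assoc]

end IsE6System

theorem wordIdx_mem_roots {s : List ℕ} (hs : IsRWord s) {x : ℕ} (hx : x ∈ List.range' 1 36) :
    wordIdx s x ∈ List.range' 1 36 := by
  induction s with
  | nil => exact hx
  | cons a s ih =>
    obtain ⟨ha, hs⟩ := isRWord_cons.1 hs
    exact (e6_checks_paths a ha _ (ih hs)).1

namespace IsE6System

variable {M : Type*} [Monoid M] {g : ℕ → M} (hg : IsE6System g)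

include hg

theorem mul_rootWord {s : List ℕ} (hs : IsRWord s) {x : ℕ} (hx : x ∈ List.range' 1 36) :
    wordProd g s * wordProd g (rootWord x) = wordProd g (rootWord (wordIdx s x)) * wordProd g s := by
  induction s with
  | nil => simp [wordIdx]
  | cons a s ih =>
    obtain ⟨ha, hs⟩ := isRWord_cons.1 hs
    rw [wordProd_cons, mul_assoc, ih hs, ← mul_assoc,
      hg.letter_mul_rootWord ha (wordIdx_mem_roots hs hx), mul_assoc]
    rfl

theorem mul_rootWords {s : List ℕ} (hs : IsRWord s) {X : List ℕ} (hX : ∀ x ∈ X, x ∈ List.range' 1 36) :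
    wordProd g s * wordProd g (X.flatMap rootWord) =
      wordProd g (X.flatMap fun x => rootWord (wordIdx s x)) * wordProd g s := by
  induction X with
  | nil => simp
  | cons x X ih =>
    obtain ⟨hx, hX⟩ := List.forall_mem_cons.1 hX
    rw [List.flatMap_cons, List.flatMap_cons, wordProd_append, wordProd_append, ← mul_assoc,
      hg.mul_rootWord hs hx, mul_assoc, ih hX, mul_assoc]

omit hg in
theorem wordProd_flatMap_congr {X : List ℕ} {f f' : ℕ → List ℕ}
    (h : ∀ x ∈ X, wordProd g (f x) = wordProd g (f' x)) :
    wordProd g (X.flatMap f) = wordProd g (X.flatMap f') := by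
  induction X with
  | nil => rfl
  | cons x X ih =>
    rw [List.flatMap_cons, List.flatMap_cons, wordProd_append, wordProd_append,
      h x (by simp), ih fun y hy => h y (by simp [hy])]

theorem wordProd_levelWord {L : ℕ} : wordProd g (levelWord L) =
    wordProd g ((levelRoots L).flatMap rootWord) := by
  have h : ∀ i ∈ levelRoots L, i ∈ List.range' 1 6 := by
    match L with
    | 0 | 1 | 2 => decide
    | _ + 3 => exact (by decide : ∀ i ∈ [3, 5, 2], i ∈ List.range' 1 6)
  rw [levelWord, List.map_eq_flatMap]
  refine wordProd_flatMap_congr fun i hi => ?_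
  rw [hg.wordProd_rootWord (h i hi)]
  simp

theorem levelStab_comm {L : ℕ} (hL : L < 4) {s : List ℕ} (hs : s ∈ levelStab L) :
    wordProd g s * wordProd g (levelWord L) = wordProd g (levelWord L) * wordProd g s := by
  have hX : ∀ i ∈ levelRoots L, i ∈ List.range' 1 36 := by interval_cases L <;> decide
  have hsR : IsRWord s := by
    have : ∀ L < 4, ∀ s ∈ levelStab L, IsRWord s := by decide
    exact this L hL s hs
  have h := hg.eq_of_e6Eq ((e6_checks_level L hL).1 s hs)
  rw [hg.wordProd_levelWord, hg.mul_rootWords hsR hX, ← hg.wordProd_levelWord, ← h]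
  congr 1
  exact wordProd_flatMap_congr fun x _ => (hg.wordProd_nf _).symm

end IsE6System

/-! ### Exploring orbits -/

/-- Membership of a number in a list. -/
noncomputable def memBeq (x : ℕ) (l : List ℕ) : Bool := List.rec false (fun y _ ih => Nat.beq x y || ih) l

theorem mem_of_memBeq {x : ℕ} : ∀ {l : List ℕ}, memBeq x l = true → x ∈ l
  | [], h => by cases h
  | y :: l, h => by
    obtain h | h := (Bool.or_eq_true _ _).mp h
    · rw [Nat.eq_of_beq_eq_true h]; simp
    · exact List.mem_cons_of_mem _ (mem_of_memBeq h)

/-- Pass the members of `c` missing from `acc` to the continuation `k`, with the enlarged list. -/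
noncomputable def collectNew (k : List ℕ → List ℕ → List ℕ) (c : List ℕ) : List ℕ → List ℕ → List ℕ :=
  List.rec (fun acc new => k acc new)
    (fun x _ ih acc new => withNat x fun x =>
      id (Bool.rec (ih (x :: acc) (x :: new)) (ih acc new) (memBeq x acc))) c

/-- The numbers reached from `acc` by applying `f` at most `n` times, starting at `fr`. -/
noncomputable def reach (f : ℕ → List ℕ) (n : ℕ) : List ℕ → List ℕ → List ℕ :=
  Nat.rec (fun acc _ => acc) (fun _ ih acc fr => collectNew ih (fr.flatMap f) acc []) n

theorem forall_mem_collectNew {P : ℕ → Prop} {k : List ℕ → List ℕ → List ℕ}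
    (hk : ∀ acc new : List ℕ, (∀ x ∈ acc, P x) → (∀ x ∈ new, P x) → ∀ x ∈ k acc new, P x) (c : List ℕ) :
    ∀ acc new : List ℕ, (∀ x ∈ c, P x) → (∀ x ∈ acc, P x) → (∀ x ∈ new, P x) →
      ∀ x ∈ collectNew k c acc new, P x := by
  induction c with
  | nil => exact fun acc new _ => hk acc new
  | cons a c ih =>
    intro acc new hc ha hn
    obtain ⟨h1, h2⟩ := List.forall_mem_cons.1 hc
    change ∀ x ∈ withNat a fun b => id (Bool.rec (motive := fun _ => List ℕ)
      (collectNew k c (b :: acc) (b :: new)) (collectNew k c acc new) (memBeq b acc)), P x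
    rw [withNat_eq, id]
    cases memBeq a acc
    · exact ih _ _ h2 (List.forall_mem_cons.2 ⟨h1, ha⟩) (List.forall_mem_cons.2 ⟨h1, hn⟩)
    · exact ih _ _ h2 ha hn

theorem forall_mem_reach {P : ℕ → Prop} {f : ℕ → List ℕ} (hf : ∀ x, P x → ∀ y ∈ f x, P y) (n : ℕ) :
    ∀ acc fr : List ℕ, (∀ x ∈ acc, P x) → (∀ x ∈ fr, P x) → ∀ x ∈ reach f n acc fr, P x := by
  induction n with
  | zero => exact fun acc fr h _ => h
  | succ n ih =>
    intro acc fr ha hfr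
    refine forall_mem_collectNew ih _ acc [] ?_ ha (by simp)
    intro x hx
    obtain ⟨y, hy, hx⟩ := List.mem_flatMap.1 hx
    exact hf y (hfr y hy) x hx

theorem levelReps_cover : ((List.range' 0 4).all fun L => (List.range' 1 36).all fun x =>
    memBeq x (reach (fun y => (levelStab L).map fun s => wordIdx s y) 36
      ((levelReps L).map fun r => r.1) ((levelReps L).map fun r => r.1))) = true := by
  decide +kernel

/-- A product of reflections, the element of a level and reflections. -/
def LevelForm {M : Type*} [Monoid M] (g : ℕ → M) (m : M) : Prop :=
  ∃ L < 4, ∃ p q : List ℕ, IsRWord p ∧ IsRWord q ∧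
    m = wordProd g p * wordProd g (levelWord L) * wordProd g q

theorem LevelForm.mul {M : Type*} [Monoid M] {g : ℕ → M} {m : M} (h : LevelForm g m) {v w : List ℕ}
    (hv : IsRWord v) (hw : IsRWord w) : LevelForm g (wordProd g v * m * wordProd g w) := by
  obtain ⟨L, hL, p, q, hp, hq, rfl⟩ := h
  exact ⟨L, hL, v ++ p, q ++ w, hv.append hp, hq.append hw, by simp [mul_assoc]⟩

theorem levelStab_isRWord : ∀ L < 4, ∀ s ∈ levelStab L, IsRWord s := by decide

theorem wordIdx_reverse_cancel {s : List ℕ} (hs : IsRWord s) {x : ℕ} (hx : x ∈ List.range' 1 36) :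
    wordIdx s (wordIdx s.reverse x) = x := by
  induction s generalizing x with
  | nil => rfl
  | cons a s ih =>
    obtain ⟨ha, hs⟩ := isRWord_cons.1 hs
    have h1 := (e6_checks_paths a ha x hx).1
    have h2 : idxAct a (idxAct a x) = x := by
      have : ∀ a ∈ List.range' 1 6, ∀ x ∈ List.range' 1 36, idxAct a (idxAct a x) = x := by
        decide +kernel
      exact this a ha x hx
    rw [List.reverse_cons, wordIdx_append]
    exact (congrArg (idxAct a) (ih hs h1)).trans h2

namespace IsE6System

variable {M : Type*} [Monoid M] {g : ℕ → M} (hg : IsE6System g)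

include hg

theorem levelForm_rootWord {L : ℕ} (hL : L < 4) {x : ℕ} (hx : x ∈ List.range' 1 36) :
    LevelForm g (wordProd g (rootWord x) * wordProd g (levelWord L)) := by
  have hc := List.all_eq_true.1 (List.all_eq_true.1 levelReps_cover L (by simp [hL])) x hx
  have hr : ∀ y ∈ (levelReps L).map fun r => r.1, y ∈ List.range' 1 36 ∧
      LevelForm g (wordProd g (rootWord y) * wordProd g (levelWord L)) := by
    intro y hy
    obtain ⟨r, hr, rfl⟩ := List.mem_map.1 hy
    have h : ∀ L < 4, ∀ r ∈ levelReps L, r.1 ∈ List.range' 1 36 ∧ IsRWord r.2.1 ∧ r.2.2.1 < 4 ∧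
        IsRWord r.2.2.2 := by decide
    obtain ⟨h1, h2, h3, h4⟩ := h L hL r hr
    refine ⟨h1, r.2.2.1, h3, r.2.1, r.2.2.2, h2, h4, ?_⟩
    have := hg.eq_of_e6Eq ((e6_checks_level L hL).2.1 r hr)
    rw [wordProd_append, wordProd_append, wordProd_append, rootNf, hg.wordProd_nf] at this
    exact this
  refine (forall_mem_reach (P := fun y => y ∈ List.range' 1 36 ∧
    LevelForm g (wordProd g (rootWord y) * wordProd g (levelWord L))) ?_ 36 _ _ hr hr x
      (mem_of_memBeq hc)).2
  rintro y ⟨hy, h⟩ z hz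
  obtain ⟨s, hs, rfl⟩ := List.mem_map.1 hz
  have hR := levelStab_isRWord L hL s hs
  refine ⟨wordIdx_mem_roots hR hy, ?_⟩
  have := h.mul hR hR.reverse
  rwa [← mul_assoc, hg.mul_rootWord hR hy, mul_assoc (wordProd g _), hg.levelStab_comm hL hs,
    mul_assoc, mul_assoc, hg.wordProd_mul_reverse hR, mul_one] at this

theorem levelForm {w : List ℕ} (hw : ∀ a ∈ w, a ∈ List.range' 1 12) : LevelForm g (wordProd g w) := by
  induction w with
  | nil => exact ⟨0, by norm_num, [], [], isRWord_nil, isRWord_nil, by simp [levelWord, levelRoots]⟩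
  | cons a w ih =>
    obtain ⟨ha, hw⟩ := List.forall_mem_cons.1 hw
    have ih := ih hw
    by_cases h : a ≤ 6
    · have ha' : IsRWord [a] := by
        simp only [List.mem_range'_1] at ha
        simp only [IsRWord, List.mem_singleton, forall_eq, List.mem_range'_1]
        omega
      simpa using ih.mul ha' isRWord_nil
    · obtain ⟨i, hi, rfl⟩ : ∃ i ∈ List.range' 1 6, a = 6 + i := by
        simp only [List.mem_range'_1] at ha ⊢
        exact ⟨a - 6, by omega, by omega⟩
      obtain ⟨L, hL, p, q, hp, hq, h⟩ := ih
      have hi' : i ∈ List.range' 1 36 := by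
        simp only [List.mem_range'_1] at hi ⊢
        omega
      have h1 := hg.mul_rootWord hp (wordIdx_mem_roots hp.reverse hi')
      rw [wordIdx_reverse_cancel hp hi', hg.wordProd_rootWord hi] at h1
      rw [wordProd_cons, h, ← mul_assoc, ← mul_assoc, ← h1, mul_assoc (wordProd g p)]
      exact (hg.levelForm_rootWord hL (wordIdx_mem_roots hp.reverse hi')).mul hp hq

end IsE6System

/-! ### Enumerating irreducible words -/

/-- Evaluate a function at a list given by an expression to be computed first. -/
noncomputable def withList {α : Type} (l : List ℕ) (f : List ℕ → α) : α :=
  List.rec (f []) (fun a l _ => f (a :: l)) l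

theorem withList_eq {α : Type} (l : List ℕ) (f : List ℕ → α) : withList l f = f l := by cases l <;> rfl

/-- The number whose digits in base 16 are the letters of a word. -/
noncomputable def wordCode (v : List ℕ) : ℕ :=
  List.rec 0 (fun b _ ih => Nat.add b (Nat.mul 16 ih)) v

/-- A word is recorded faithfully by its code, which belongs to the list `l`. -/
noncomputable def codeMem (v l : List ℕ) : Bool :=
  withNat (wordCode v) fun c => wordBeq (hexDigits 40 c) v && memBeq c l

namespace RuleTrie

/-- The code of the reversed normal form of a word, if faithful. -/
noncomputable def codeNf (t : RuleTrie) (w : List ℕ) : List ℕ :=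
  withList (t.nf w) fun v => withNat (wordCode v) fun c =>
    Bool.rec [] [c] (wordBeq (hexDigits 40 c) v)

/-- The codes of the reversed normal forms of words obtained from `starts` by appending words from
`blocks`. -/
noncomputable def wordOrbit (t : RuleTrie) (blocks : List (List ℕ)) (n : ℕ) (starts : List (List ℕ)) :
    List ℕ :=
  reach (fun c => blocks.flatMap fun b => t.codeNf ((hexDigits 40 c).reverse ++ b)) n
    (starts.flatMap t.codeNf) (starts.flatMap t.codeNf)

/-- Test all irreducible reversed words that extend the reversed word `w`, failing if there are
any with more than `n` additional letters. -/
noncomputable def forallIrr (t : RuleTrie) (letters : List ℕ) (P : List ℕ → Bool) (n : ℕ) :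
    List ℕ → Bool :=
  Nat.rec (fun _ => false) (fun _ ih w => P w && letters.all fun b =>
    Option.rec (ih (b :: w)) (fun _ => true) (t.find (b :: w))) n

theorem forallIrr_sound {t : RuleTrie} {letters : List ℕ} {P : List ℕ → Bool} (n : ℕ) :
    ∀ w : List ℕ, t.forallIrr letters P n w = true → ∀ q : List ℕ, (∀ b ∈ q, b ∈ letters) →
      t.Irr (q ++ w) → P (q ++ w) = true := by
  induction n with
  | zero => exact fun _ h => by cases h
  | succ n ih =>
    intro w h q hq hi
    obtain ⟨h1, h2⟩ := (Bool.and_eq_true _ _).mp h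
    induction q using List.reverseRecOn with
    | nil => exact h1
    | append_singleton q b _ =>
      have hf : t.find (b :: w) = none := by
        have : ∀ q : List ℕ, t.Irr (q ++ b :: w) → t.find (b :: w) = none := by
          intro q
          induction q with
          | nil => exact fun h => h.1
          | cons c q ih => exact fun h => ih h.2
        exact this q (by simpa using hi)
      have h3 := List.all_eq_true.1 h2 b (hq b (by simp))
      rw [hf] at h3
      simpa using ih (b :: w) h3 q (fun c hc => hq c (by simp [hc])) (by simpa using hi)

variable {M : Type*} [Monoid M] {g : ℕ → M} {t : RuleTrie}

theorem wordProd_of_mem_codeNf (ht : t.Holds g) {w : List ℕ} {c : ℕ} (hc : c ∈ t.codeNf w) :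
    wordProd g (hexDigits 40 c).reverse = wordProd g w := by
  rw [codeNf, withList_eq, withNat_eq] at hc
  generalize h : wordBeq (hexDigits 40 (wordCode (t.nf w))) (t.nf w) = b at hc
  cases b
  · cases hc
  · obtain rfl := List.mem_singleton.1 hc
    rw [eq_of_wordBeq h, wordProd_nf ht]

theorem wordProd_mem_of_mem_wordOrbit (ht : t.Holds g) {H : Submonoid M} {blocks starts : List (List ℕ)}
    (hb : ∀ b ∈ blocks, wordProd g b ∈ H) (hs : ∀ w ∈ starts, wordProd g w ∈ H) {n c : ℕ}
    (hc : c ∈ t.wordOrbit blocks n starts) : wordProd g (hexDigits 40 c).reverse ∈ H := by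
  have h0 : ∀ c ∈ starts.flatMap t.codeNf, wordProd g (hexDigits 40 c).reverse ∈ H := by
    intro c hc
    obtain ⟨w, hw, hc⟩ := List.mem_flatMap.1 hc
    rw [wordProd_of_mem_codeNf ht hc]
    exact hs w hw
  refine forall_mem_reach (P := fun c => wordProd g (hexDigits 40 c).reverse ∈ H) ?_ n _ _ h0 h0 c hc
  intro x hx y hy
  obtain ⟨b, hb', hy⟩ := List.mem_flatMap.1 hy
  rw [wordProd_of_mem_codeNf ht hy, wordProd_append]
  exact mul_mem hx (hb b hb')

end RuleTrie

/-- The action of a reversed word on an index, with letters expanded according to `f`. -/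
noncomputable def idxAlong (f : ℕ → List ℕ) (v : List ℕ) (y : ℕ) : ℕ :=
  List.rec y (fun b _ ih => wordIdx (f b) ih) v

theorem idxAlong_eq (f : ℕ → List ℕ) (v : List ℕ) (y : ℕ) :
    idxAlong f v y = wordIdx (v.flatMap f) y := by
  induction v with
  | nil => rfl
  | cons b v ih =>
    rw [List.flatMap_cons, wordIdx_append, ← ih]
    rfl

/-- A reversed word and its image by the diagram automorphism act equally on given indices. -/
noncomputable def fixedAt (f : ℕ → List ℕ) (ys v : List ℕ) : Bool :=
  ys.all fun y => Nat.beq (idxAlong (fun b => (f b).reverse) v y)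
    (idxAlong (fun b => ((f b).map sigLetter).reverse) v y)

theorem fixedAt_reverse {f : ℕ → List ℕ} {ys w : List ℕ}
    (h : ∀ y ∈ ys, wordIdx (w.flatMap f).reverse y =
      wordIdx ((w.flatMap f).map sigLetter).reverse y) : fixedAt f ys w.reverse = true := by
  have key : ∀ f : ℕ → List ℕ, w.reverse.flatMap (fun b => (f b).reverse) =
      (w.flatMap f).reverse := by
    intro f
    rw [List.reverse_flatMap]
    rfl
  refine List.all_eq_true.2 fun y hy => ?_
  rw [idxAlong_eq, idxAlong_eq, key, key fun b => (f b).map sigLetter, ← List.map_flatMap, h y hy]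
  exact Nat.beq_refl _

/-- Every irreducible word extending `w` and behaving on the indices `ys` as if fixed by the diagram
automorphism is in the orbit of `starts`. -/
noncomputable def fixedCheck (t : RuleTrie) (starts : List (List ℕ)) (f : ℕ → List ℕ) (ys w : List ℕ) :
    Bool :=
  withList (t.wordOrbit [[1, 6], [3, 5], [4], [2]] 16 starts) fun l =>
    t.forallIrr [1, 2, 3, 4, 5, 6] (fun v => Bool.rec true (codeMem v l) (fixedAt f ys v)) 20 w

theorem wordProd_mem_of_fixedCheck {M : Type*} [Monoid M] {g : ℕ → M} {t : RuleTrie} (ht : t.Holds g)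
    {H : Submonoid M} {starts : List (List ℕ)} {f : ℕ → List ℕ} {ys w : List ℕ}
    (hc : fixedCheck t starts f ys w.reverse = true)
    (hb : ∀ b ∈ [[1, 6], [3, 5], [4], [2]], wordProd g b ∈ H) (hs : ∀ w ∈ starts, wordProd g w ∈ H)
    {q : List ℕ} (hq : IsRWord q) (hi : t.Irr (w ++ q).reverse)
    (hf : ∀ y ∈ ys, wordIdx ((w ++ q).flatMap f).reverse y =
      wordIdx (((w ++ q).flatMap f).map sigLetter).reverse y) :
    wordProd g (w ++ q) ∈ H := by
  rw [fixedCheck, withList_eq] at hc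
  rw [List.reverse_append] at hi
  have h := RuleTrie.forallIrr_sound 20 _ hc q.reverse (fun b hb => hq b (by simpa using hb)) hi
  rw [← List.reverse_append, fixedAt_reverse hf] at h
  replace h : codeMem (w ++ q).reverse _ = true := h
  rw [codeMem, withNat_eq] at h
  obtain ⟨h1, h2⟩ := (Bool.and_eq_true _ _).mp h
  have := RuleTrie.wordProd_mem_of_mem_wordOrbit ht hb hs (mem_of_memBeq h2)
  rwa [eq_of_wordBeq h1, List.reverse_reverse] at this

/-! ### Rewriting systems for the centraliser and the levels -/

/-- The completion steps in type A₅ × A₁. -/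
def fixSteps : List ℕ := [
  18626, 18690, 806146, 853252, 364932, 26318212, 26579332, 14176646, 425218438, 4380512648,
  6803968392, 4657009034, 74512617868, 327786189194, 365496652174]

/-- The rewriting system of type A₅ × A₁. -/
@[irreducible] noncomputable def fixTrie : RuleTrie := RuleTrie.complete e6Wt fixRels fixSteps

/-- The relations on words in the letters `1, …, 6`, with a letter `7` in front for the element of
the level. -/
def levelRels (L : ℕ) : List (List ℕ × List ℕ) :=
  ((e6Rels.filter fun p => (p.1 ++ p.2.1).all fun a => Nat.ble a 6).map fun p => (p.1, p.2.1)) ++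
  ((levelAbsorb L).map fun r => (7 :: r.2.2, [7])) ++
  match L with
  | 2 => [([7, 1, 3, 4, 5, 6, 5, 4, 3, 1, 2, 4, 3, 5, 4, 2, 1, 3, 4, 5, 6, 5, 4, 3, 1], [7])]
  | _ => []

/-- The completion steps for each of the last two levels. -/
def levelSteps : ℕ → List ℕ
  | 2 => [
  18626, 36290, 21954, 38338, 331012, 610628, 872772, 1152388, 806338, 1381826, 607684, 869828,
  17631492, 17370372, 12896708, 22103492, 22104516, 13930822, 5558598, 10032518, 14226822, 13927878,
  286577096, 22335942, 348612, 610756, 9753030, 12898756, 8704452, 277892358, 353666502, 353682886,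
  88904008, 227087752, 93132168, 353669574, 357369288, 156042696, 3302017288, 4447339976, 4514449864,
  4447341000, 5658939720, 5658936776, 5588160966, 5658969544, 1489573258, 4710798730, 2488075722,
  36797483468, 4585228746, 357370312, 5573062, 9767366, 156043720, 206375366, 139266502, 3511224769,
  5717919178, 2496693706, 71157450186, 71157466570, 90534875466, 90534905290, 90543031754,
  20674548162, 75242214796, 90543523274, 39809222092, 1138519475660, 845324814796, 1138515559884,
  1741890852236, 1448558003660, 1448558495180, 1448688518604, 932088190350, 18491181404494,
  18216110835150, 18491189560782, 18216311653838, 27870123070862, 18216248968654, 23176928069070,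
  286772026738126, 291460855956944, 291457773372880, 291460986471888, 445907879925136,
  155120533541202, 2547093055538638, 4663373695321554, 40616583655654862, 94955254479132052,
  19101333154540623256, 6107247888099859115241179760065, 87236886302706540811030184904176,
  16248438221757494370147742303726, 1353543669075798902561479640556, 105700109476135585463162422762,
  7902846372590543746131609064, 165721127056917028012082662, 20650028703161527047341540,
  1609447044231117545719266, 60510837849873915626976, 5023031676155584366046, 79304264401424532956,
  14740660143441102298, 1500077238971844052, 1788307615123555794, 23964032180295878100,
  28575718198723266002, 14182213789647160792, 309927645038036440, 1174618773493171668,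
  1462849149644883410, 1751079525796595152, 19389549805181126104, 28612921842035901908,
  24001235823549515222, 23403260634287097298, 28014946652714485200, 10432893707460068820,
  1228516610148451800, 1804977362451875278, 28879637781169620432, 18793900375949755862,
  28017272412804531666, 23405586394318144980, 19963491060009715152, 1535948567457351128,
  671257439002215896, 959487815153927640, 28844589525184333262, 24882609035746002380,
  1843393440873760216, 690471936266913240, 978702312418624984, 1266932688570336728,
  10737928506082117082, 15351805042521851354, 19963491060949239248, 5549781735351305680,
  1535811660085773784, 671120531630638552, 28608211827488245196, 690471936279496152,
  11047414073079678426, 20270786109934454234, 15659236998757008858, 20270923017184396762,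
  6111468881481614810, 1843384884174833112, 690463379567986136, 1266924131871409624,
  11047550980270622170, 15659236998698010074, 24882609035552785868, 10723154899921585626,
  19961300542941087182, 20270923017322808794, 11046490722706441690, 20270786109938648538,
  15081715988830406090, 1843327174775981528, 402175294017422808, 690405670169134552,
  6418984396184405466, 11046490722706163162, 15658176741133551066, 19101120946859722200,
  1842338405520082392, 401186524761523672, 977647277064947160, 29224224139932698072,
  1538283632594082264, 385362127987235288, 961822880290658776, 6381966829909542362,
  15605338866764318170, 15642356433039164890, 6418984396184421850, 20254042451466585562,
  6163480449903581658, 15386852486758357466, 15389166084650535386, 6165794047795761626,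
  20000852103077925316, 457211491179631265236, 383424514884734059990, 236445820585971336668,
  457806749470485956054, 384019773178868975064, 310232796882898027994, 448239146443490772434,
  374452170148593567188, 319415856960155452882, 24575177079317628378, 10740119024035464666,
  15351805042462852570, 240713275614258316758, 166926299319420110294, 19656265762434237914,
  15044579744006850004, 28879637799289013712, 462074204498772936146, 374489382311167051222,
  300702406015196104152, 310157436650194519514, 388896182017132119514, 324332577759010276828,
  176758625169274865116, 176760815686406686172, 250547791981244892636, 398121744570921305550,
  250547791980112152028, 392931407283058673116, 6435864962044560858, 11047550980471948762,
  97783502103705847260, 29494158146797340122, 11047414073087788506, 250547791982188611036,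
  398121744571865023950, 388881408410959005146, 241307455821282592204, 29493234796415747546,
  6434804704278808026, 24881548777988359624, 320013633649246799302, 388935733577268957658,
  249685421868229101020, 102111469278552720860, 102703750338950759900, 324064679223465379292,
  324064679223464887772, 379404911444593804760, 246189639788133714396, 98615687198457303516,
  98652704764732180956, 320013633649246800326, 320013633649246769606, 171806856097313883612,
  245628880680349631964, 319415856975187838418, 88796507765620901330, 24572986561372390874,
  10737928506090227162, 310192484923359675866, 461513432403008341456, 462074204786535744978,
  324334768277164951004, 176743851563303077340, 324332577759018386908, 467603406547017598426,
  102703750338950530524, 250530827858136860124, 398104780447813273034, 171570478398745380316,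
  319380808687057405392, 3630646730148528834012, 79341477128592999900, 448276358602784032212,
  7481671468875389126108, 393202833271158785500, 171841904386644166108, 245628880681482372572,
  6369912864863652201934, 471906530348556666332, 5120218138387948799432, 5120218138387948307912,
  6222971737236303317468, 6222971737236303286748, 6134792238157821691352, 7315383858872011769302,
  6144316370859815126490, 4963724750144492307932, 3783133129375541396958, 5991234722379573806550,
  6222373960562244355548, 314500252198947816924, 240713275904109610454, 462074204788624229842,
  7393187271978278503892, 5110653711361342752212, 393202833267937560028, 4963079758774887564764,
  4811238496261261526490, 3851412409828133078488, 2828138002710474573278, 4008764671699918292446,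
  6286902516531015501278, 102973839392713016796, 176760815687551223260, 324334768277227636188,
  1564536033661370287582, 471906530348757485020, 176758625169404659164, 6369947913149832283600,
  471908720862538286556, 324334768272861873628, 7481654504752281093596, 6300809759105360397790,
  471638631813142087132, 102703750338951054812, 1633783508456843544030, 5185034867575438214622,
  2528703720961266976222, 471891756742651971036, 102956875268460938716, 398104780447813764554,
  6070478583113500886490, 6070478583113500394970, 1577850995175316851166, 5120218138387948308936,
  3939626517670537236958, 4962518986403112322524, 6222338912274113922524, 4008764671715017786846,
  6369947913149840393680, 6222102534575344092636, 6222102534575406777820, 7171826343093763884500,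
  5991830116976584345048, 2748909697559098869214, 3930062090903717971422, 4962518986404245063132,
  1420744124252011152852, 393167784981958297052, 171806856097443677660, 319380808687120090576,
  4963079758773754824156, 7384214918448133473746, 7393187276584571930068, 5189356292435642189278,
  2828173051000689067486, 4008764671718100370910, 6369947913152922977744, 2827901625012849280478,
  5189321244145297163742, 5189321244142075954654, 2828173050980418504158, 1633783508456843838942,
  4004443246858039002590, 7481654504752281585116, 1643260005423208498654, 6369676487165012379084,
  6222338912274176607708, 2745127654379926128094, 5110092938993921459666, 2748909697558968337886,
  98309118153194384953820, 58090347682376461354462, 1269463634057488008670, 7172421737644544525782,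
  81923490214207172937162, 99567547795780852582878, 81770459381830935168470, 6291245332336452093406,
  2749470470184218183134, 101918605837818435241424, 7550504485576906671582, 100812956145685766374880,
  7546218109010273404382, 1643260005423216887262, 98156675810523058587098, 79419596002053034395102,
  60530130070799880324576, 81770459381781484045782, 6291245332287000970718, 79409276140398201046494,
  61622598557268253115866, 97127657329816006329820, 119706472076036497507806,
  63034024282728595786208, 101919166610397316548050, 7550539533800612595166, 5189356292365789988318,
  80664174621727797085664, 7550504485579989255646, 2828138002710344041950, 95859755558071092430296,
  76979815939921341892060, 79400303782467921020382, 41621371919508670825952, 97127893707514846971356,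
  99557422596386825733598, 45250768816011025090016, 64140234747489605944800,
  101919166610446767654354, 101919166610432678495698, 99553640553206508455390,
  45250208043365504697824, 63919467998266662651360, 82960557881207149888992, 43982555160943493416416,
  114749221489500222162390, 95869281871625349531098, 43982555160943493432800,
  81770459385679225865686, 26140536135309501433312, 64071091949728624051680, 83029139906273215284704,
  45250768815686696076768, 45246426000205457982944, 83029139906308577232352,
  1572945890451110159256030, 1554046299320237551551966, 1308327350109294962705880,
  100659925317383233504736, 43991527522947490940384, 1630697693405144285218258,
  120808071769279828100576, 45250208043365504681440, 1592927733903965694248416,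
  80512064562961780360672, 61622598631483199505882, 968482081129191256655330,
  985961576916033207322076, 665941950712138733225442, 1630706665766922855941588,
  647348152566084358702562, 120804289726118917375456, 101914823794640336520654,
  1554042517277056239732190, 1533756088929137478895066, 1022711487972266602431970,
  724003328693848075175394, 1592858248851287957898720, 703720882575095894935010,
  723942816003287327737314, 1270548418246112374212064, 1915303553216584098579936]
  | _ => [
  18626, 21954, 18882, 331012, 610628, 872772, 1152388, 806338, 1381826, 869828, 17631492, 17370372,
  22103492, 13930822, 5558598, 10032518, 14226822, 286577096, 22335942, 348612, 610756, 9753030,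
  12898756, 8704452, 286036424, 21795265, 315841, 5018049, 12898756, 277892358, 353682886, 88904008,
  227087752, 93132168, 357369288, 88933832, 273483204, 3302017288, 5658939720, 5658969544,
  1489573258, 4710798730, 2429093316, 71157466570, 90534875466, 90543031754, 38734988740,
  75242214796, 1138515559884, 1741890852236, 932088190350, 4729104025040, 880813327822, 73359476172,
  5713741258, 223397320, 3566257610, 4644193729, 90543539658, 28127951673808, 1464794700238,
  73225296332, 3432077770, 349264324, 5579561412, 3302054344, 4514484680, 52824201674, 52832866762,
  106452849092, 70012732872, 845187224012, 845325832652, 1120203769290, 621848921544, 18491181404494,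
  27870123070862, 9916158150088, 13522995548622, 17923259827660, 9949582788042, 445907879925136,
  158658530444746, 304618699015624, 155120533541202, 159193324127692, 4873364390331848,
  2538536486634956, 4873899184293322, 3747999277696468, 94955254479132052, 77973830245352906,
  97197691545634248, 77982386948212172, 59967988439238102, 21678834903467468, 1247581283925165516,
  1555163064726242762, 598139587206890966, 1555163064722048458, 959487814889686488,
  19101333154540623256, 24882609035481761228, 18793605432161125846, 24882609035611784652,
  388896182016993707482]

/-- The rewriting system for each of the last two levels. -/
@[irreducible] noncomputable def levelTrie (L : ℕ) : RuleTrie :=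
  RuleTrie.complete e6Wt (levelRels L) (levelSteps L)

/-- Representatives of the fixed irreducible words for each of the last two levels. -/
def levelStarts : ℕ → List (List ℕ)
  | 2 => [[7], [7, 4, 3], [7, 2, 4, 3], [7, 1, 3, 4, 5, 6, 5, 4, 3, 1, 4, 3],
      [7, 1, 3, 4, 5, 6, 5, 4, 3, 1, 2, 4, 3]]
  | _ => [[7], [7, 4, 3], [7, 6, 1, 3, 4, 5, 3, 2, 1, 4, 3, 1, 2, 3, 5, 4, 3, 1, 6]]

/-- A letter `1, …, 6`, but the letter `7` does not count. -/
def levelLetter : ℕ → List ℕ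
  | 7 => []
  | a => [a]

/-- A rule takes a word with just one letter `7`, in front, to another such word. -/
def levelOk (l r : List ℕ) : Bool :=
  List.rec false (fun a _ _ => Bool.rec (r.all fun a => Nat.ble 1 a && Nat.ble a 6)
    (List.rec false (fun b r' _ => Nat.beq b 7 && r'.all fun a => Nat.ble 1 a && Nat.ble a 6) r)
    (Nat.beq a 7)) l

theorem fixTrie_check : (fixTrie.all (fun l r => RuleTrie.decreasing e6Wt l r &&
      r.all fun a => Nat.ble 1 a && Nat.ble a 6) [] &&
    fixedCheck fixTrie [[]] fixWord [idxAct 8 1, idxAct 8 3] []) = true := by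
  decide +kernel

theorem levelTrie_check : ((List.range' 2 2).all fun L =>
    (levelTrie L).all (fun l r => RuleTrie.decreasing e6Wt l r && levelOk l r) [] &&
      fixedCheck (levelTrie L) (levelStarts L) levelLetter [wordIdx (levelWord L) 0] [7]) = true := by
  decide +kernel

/-- A system of type E₆ with an endomorphism which acts as the diagram automorphism, and a
submonoid of fixed elements which contains the images of the generators of type F₄. -/
structure IsFoldedSystem {M : Type*} [Monoid M] (g : ℕ → M) (s : M →* M) (H : Submonoid M) : Prop
    extends IsE6System g where
  sig : ∀ a ∈ List.range' 1 12, s (g a) = g (sigLetter a)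
  mem : ∀ a ∈ List.range' 1 8, wordProd g (f4Img a) ∈ H
  fixed : ∀ m ∈ H, s m = m

theorem sigLetter_mem : ∀ a ∈ List.range' 1 12, sigLetter a ∈ List.range' 1 12 := by decide

theorem sigLetter_mem_R : ∀ a ∈ List.range' 1 6, sigLetter a ∈ List.range' 1 6 := by decide

theorem IsRWord.map_sigLetter {w : List ℕ} (hw : IsRWord w) : IsRWord (w.map sigLetter) := by
  intro a ha
  obtain ⟨b, hb, rfl⟩ := List.mem_map.mp ha
  exact sigLetter_mem_R b (hw b hb)

theorem IsRWord.mem_e6 {w : List ℕ} (hw : IsRWord w) : ∀ a ∈ w, a ∈ List.range' 1 12 := by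
  intro a ha
  have := hw a ha
  simp only [List.mem_range'_1] at this ⊢
  omega

theorem levelWord_mem : ∀ L < 4, ∀ a ∈ levelWord L, a ∈ List.range' 1 12 := by decide

theorem f4Img_reverse_mem : ∀ a ∈ List.range' 1 8, ((f4Img a).reverse, f4Img a) ∈ e6Identities := by
  decide

theorem sigRoot_idxAct : ∀ a ∈ List.range' 1 6, ∀ x ∈ List.range' 1 36,
    sigRoot (idxAct a x) = idxAct (sigLetter a) (sigRoot x) := by
  decide +kernel

theorem sigRoot_two : sigRoot 2 = 2 := by decide +kernel

theorem mem_fixedRoots : ∀ x ∈ List.range' 1 36, sigRoot x = x →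
    ∃ p ∈ fixedRoots, p.1 = x ∧ ∀ a ∈ p.2, a ∈ List.range' 1 8 := by
  decide +kernel

theorem wordIdx_map_sigLetter {w : List ℕ} (hw : IsRWord w) :
    wordIdx (w.map sigLetter) 2 = sigRoot (wordIdx w 2) := by
  induction w with
  | nil => exact sigRoot_two.symm
  | cons a w ih =>
    rw [isRWord_cons] at hw
    have e (a : ℕ) (w : List ℕ) : wordIdx (a :: w) 2 = idxAct a (wordIdx w 2) := rfl
    rw [List.map_cons, e, e, ih hw.2,
      sigRoot_idxAct a hw.1 _ (wordIdx_mem_roots hw.2 (by simp))]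

theorem wordIdx_zero {w : List ℕ} (hw : IsRWord w) : wordIdx w 0 = 0 := by
  induction w with
  | nil => rfl
  | cons a w ih =>
    rw [isRWord_cons] at hw
    have e : wordIdx (a :: w) 0 = idxAct a (wordIdx w 0) := rfl
    rw [e, ih hw.2]
    revert a
    have : ∀ a ∈ List.range' 1 6, idxAct a 0 = 0 := by decide +kernel
    exact fun a h _ => this a h.1

/-- Elements of the parabolic subgroup factor through the path of a root. -/
theorem IsE6System.exists_path {M : Type*} [Monoid M] {g : ℕ → M} (hg : IsE6System g) {w : List ℕ}
    (hw : IsRWord w) : ∃ k, IsRWord k ∧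
      wordProd g w = wordProd g (rootPath (wordIdx w 2)) * wordProd g (k.flatMap fixWord) := by
  induction w with
  | nil => exact ⟨[], isRWord_nil, by
      have : rootPath 2 = [] := by decide +kernel
      change _ = wordProd g (rootPath 2) * _
      simp [this]⟩
  | cons a w ih =>
    rw [isRWord_cons] at hw
    obtain ⟨k, hk, h⟩ := ih hw.2
    obtain ⟨-, k', hk', h'⟩ := e6_checks_paths a hw.1 _ (wordIdx_mem_roots hw.2 (by simp : 2 ∈ _))
    refine ⟨k' ++ k, hk'.append hk, ?_⟩
    have e : wordIdx (a :: w) 2 = idxAct a (wordIdx w 2) := rfl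
    have h'' := hg.eq_of_e6Eq h'
    rw [e, List.flatMap_append, wordProd_append, ← mul_assoc, ← wordProd_append, ← h'',
      wordProd_cons, wordProd_cons, h, mul_assoc]

namespace IsFoldedSystem

variable {M : Type*} [Monoid M] {g : ℕ → M} {s : M →* M} {H : Submonoid M}
  (hg : IsFoldedSystem g s H)

include hg

theorem map_wordProd {w : List ℕ} (hw : ∀ a ∈ w, a ∈ List.range' 1 12) :
    s (wordProd g w) = wordProd g (w.map sigLetter) := by
  induction w with
  | nil => simp
  | cons a w ih =>
    rw [List.forall_mem_cons] at hw
    rw [wordProd_cons, map_mul, hg.sig a hw.1, ih hw.2, List.map_cons, wordProd_cons]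

theorem idx_eq {w : List ℕ} (hw : ∀ a ∈ w, a ∈ List.range' 1 12)
    (h : s (wordProd g w) = wordProd g w) {x : ℕ} (hx : x < 512) :
    wordIdx w x = wordIdx (w.map sigLetter) x ∧
      wordIdx w.reverse x = wordIdx (w.map sigLetter).reverse x := by
  rw [hg.map_wordProd hw] at h
  refine hg.idx hw (fun a ha => ?_) h.symm x hx
  obtain ⟨b, hb, rfl⟩ := List.mem_map.mp ha
  exact sigLetter_mem b (hw b hb)

theorem mem_flatMap {f : List ℕ} (hf : ∀ a ∈ f, a ∈ List.range' 1 8) :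
    wordProd g (f.flatMap f4Img) ∈ H := by
  induction f with
  | nil => simp
  | cons a f ih =>
    rw [List.forall_mem_cons] at hf
    rw [List.flatMap_cons, wordProd_append]
    exact H.mul_mem (hg.mem a hf.1) (ih hf.2)

theorem op : IsFoldedSystem (fun a => MulOpposite.op (g a)) (MonoidHom.op s) H.op where
  toIsE6System := hg.toIsE6System.op
  sig a ha := by simp [hg.sig a ha]
  mem a ha := by
    rw [← List.reverse_reverse (f4Img a), ← op_wordProd, hg.eq_of_mem (f4Img_reverse_mem a ha)]
    exact hg.mem a ha
  fixed m hm := by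
    have := hg.fixed _ hm
    exact MulOpposite.unop_injective this

theorem rootPath_mem {x : ℕ} (hx : x ∈ List.range' 1 36) (h : sigRoot x = x) :
    wordProd g (rootPath x) ∈ H ∧ wordProd g (rootPath x).reverse ∈ H := by
  have key : ∀ {M : Type _} [Monoid M] {g : ℕ → M} {s : M →* M} {H : Submonoid M},
      IsFoldedSystem g s H → wordProd g (rootPath x) ∈ H := by
    intro M _ g s H hg
    obtain ⟨p, hp, hpx, hl⟩ := mem_fixedRoots x hx h
    have : (rootPath p.1, p.2.flatMap f4Img) ∈ e6Identities := by
      simp only [e6Identities, List.mem_append, List.mem_map]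
      exact Or.inl (Or.inl (Or.inr ⟨p, hp, rfl⟩))
    rw [← hpx, hg.eq_of_mem this]
    exact hg.mem_flatMap hl
  refine ⟨key hg, ?_⟩
  have := key hg.op
  rw [← List.reverse_reverse (rootPath x), ← op_wordProd] at this
  exact this

end IsFoldedSystem

theorem wordProd_flatMap {M : Type*} [Monoid M] (g : ℕ → M) (f : ℕ → List ℕ) (w : List ℕ) :
    wordProd g (w.flatMap f) = wordProd (fun a => wordProd g (f a)) w := by
  induction w with
  | nil => simp
  | cons a w ih => rw [List.flatMap_cons, wordProd_append, ih, wordProd_cons]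

theorem isRWord_of_all {w : List ℕ} (h : (w.all fun a => Nat.ble 1 a && Nat.ble a 6) = true) :
    IsRWord w := by
  intro a ha
  have := List.all_eq_true.mp h a ha
  rw [Bool.and_eq_true, Nat.ble_eq, Nat.ble_eq] at this
  simp only [List.mem_range'_1]
  omega

theorem IsE6System.exists_path_right {M : Type*} [Monoid M] {g : ℕ → M} (hg : IsE6System g)
    {w : List ℕ} (hw : IsRWord w) : ∃ k, IsRWord k ∧ wordProd g w =
      wordProd g (k.flatMap fixWord) * wordProd g (rootPath (wordIdx w.reverse 2)).reverse := by
  obtain ⟨k, hk, h⟩ := hg.op.exists_path hw.reverse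
  refine ⟨k.reverse, hk.reverse, MulOpposite.op_injective ?_⟩
  rw [op_wordProd, h, MulOpposite.op_mul, op_wordProd, op_wordProd, List.reverse_reverse,
    List.reverse_flatMap, List.reverse_reverse]
  congr 2
  rw [List.flatMap_def, List.flatMap_def]
  congr 1
  exact List.map_congr_left fun a ha => (fixWord_reverse a (hk a ha)).symm

namespace IsFoldedSystem

variable {M : Type*} [Monoid M] {g : ℕ → M} {s : M →* M} {H : Submonoid M}
  (hg : IsFoldedSystem g s H)

include hg

/-- Invariance of the right action at a point only depends on the element. -/
theorem idx_congr {v w : List ℕ} (hv : ∀ a ∈ v, a ∈ List.range' 1 12)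
    (hw : ∀ a ∈ w, a ∈ List.range' 1 12) (h : wordProd g v = wordProd g w) {x : ℕ} (hx : x < 512)
    (hs : wordIdx w.reverse x = wordIdx (w.map sigLetter).reverse x) :
    wordIdx v.reverse x = wordIdx (v.map sigLetter).reverse x := by
  have key : ∀ u : List ℕ, (∀ a ∈ u, a ∈ List.range' 1 12) →
      ∀ a ∈ u.map sigLetter, a ∈ List.range' 1 12 := by
    intro u hu a ha
    obtain ⟨b, hb, rfl⟩ := List.mem_map.mp ha
    exact sigLetter_mem b (hu b hb)
  have h' := congrArg s h
  rw [hg.map_wordProd hv, hg.map_wordProd hw] at h'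
  rw [(hg.idx hv hw h x hx).2, (hg.idx (key v hv) (key w hw) h' x hx).2, hs]

theorem singles_mem : ∀ b ∈ [[1, 6], [3, 5], [4], [2]], wordProd g b ∈ H := by
  intro b hb
  have : ∀ b ∈ [[1, 6], [3, 5], [4], [2]], ∃ a ∈ List.range' 1 8, f4Img a = b := by decide
  obtain ⟨a, ha, rfl⟩ := this b hb
  exact hg.mem a ha

/-- Elements of the stabiliser of the root with index 2 with invariance at two points. -/
theorem fixWord_mem {k : List ℕ} (hk : IsRWord k)
    (h : ∀ y ∈ [idxAct 8 1, idxAct 8 3], wordIdx (k.flatMap fixWord).reverse y =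
      wordIdx ((k.flatMap fixWord).map sigLetter).reverse y) :
    wordProd g (k.flatMap fixWord) ∈ H := by
  have hc := fixTrie_check
  have ht : fixTrie.Holds fun a => wordProd g (fixWord a) := by
    have h : ∀ p ∈ fixRels, wordProd (fun a => wordProd g (fixWord a)) p.1 =
        wordProd (fun a => wordProd g (fixWord a)) p.2 := by
      intro p hp
      rw [← wordProd_flatMap, ← wordProd_flatMap]
      refine hg.eq_of_mem (p := (p.1.flatMap fixWord, p.2.flatMap fixWord)) ?_
      simp only [e6Identities, List.mem_append]
      exact .inl <| .inl <| .inl <| .inr <| List.mem_map_of_mem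
        (f := fun p : List ℕ × List ℕ => (p.1.flatMap fixWord, p.2.flatMap fixWord)) hp
    unfold fixTrie
    generalize fixSteps = cs
    exact RuleTrie.complete_holds e6Wt h cs
  generalize fixTrie = t at hc ht
  rw [Bool.and_eq_true] at hc
  obtain ⟨k', hk', he, hi⟩ := RuleTrie.exists_irr ht (G := IsRWord) hc.1 (fun p l q r hr hG => by
    rw [isRWord_append, isRWord_append] at hG ⊢
    exact ⟨⟨hG.1.1, isRWord_of_all hr⟩, hG.2⟩) k hk
  rw [← wordProd_flatMap, ← wordProd_flatMap] at he
  rw [← he, wordProd_flatMap]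
  refine wordProd_mem_of_fixedCheck (w := []) ht hc.2 ?_ (by simp) hk' hi fun y hy => ?_
  · intro b hb
    rw [← wordProd_flatMap]
    have : ∀ b ∈ [[1, 6], [3, 5], [4], [2]], b.flatMap fixWord ∈ [[1, 6], [3, 5], [2]] ∨
        b.flatMap fixWord = [4, 2, 3, 4, 5, 4, 3, 2, 4] := by decide
    rcases this b hb with h | h
    · exact hg.singles_mem _ (by revert h; generalize b.flatMap fixWord = c; revert c; simp)
    · rw [h, hg.eq_of_mem (p := (_, [3, 2, 3, 4, 3, 2, 3].flatMap f4Img)) (by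
        simp only [e6Identities, List.mem_append]
        exact .inr <| .head _)]
      exact hg.mem_flatMap (by decide)
  · refine hg.idx_congr (isRWord_flatMap_fixWord hk').mem_e6 (isRWord_flatMap_fixWord hk).mem_e6 he
      ?_ (h y hy)
    revert y
    simp only [List.mem_cons, List.not_mem_nil, or_false, forall_eq_or_imp, forall_eq]
    exact ⟨idxAct_lt _ _, idxAct_lt _ _⟩

/-- Invertible fixed elements. -/
theorem mem_of_fixed_R {w : List ℕ} (hw : IsRWord w) (h : s (wordProd g w) = wordProd g w) :
    wordProd g w ∈ H := by
  obtain ⟨k, hk, hwk⟩ := hg.exists_path hw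
  have hx := wordIdx_mem_roots hw (by simp : 2 ∈ List.range' 1 36)
  have hfx : sigRoot (wordIdx w 2) = wordIdx w 2 := by
    rw [← wordIdx_map_sigLetter hw, ← (hg.idx_eq hw.mem_e6 h (by norm_num)).1]
  obtain ⟨h1, h2⟩ := hg.rootPath_mem hx hfx
  rw [hwk]
  refine H.mul_mem h1 (hg.fixWord_mem hk fun y hy => ?_)
  refine (hg.idx_eq (isRWord_flatMap_fixWord hk).mem_e6 ?_ ?_).2
  · have : wordProd g (k.flatMap fixWord) =
        wordProd g (rootPath (wordIdx w 2)).reverse * wordProd g w := by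
      rw [hwk, hg.reverse_mul_cancel (rootPath_isRWord _ hx)]
    rw [this, map_mul, h, hg.fixed _ h2]
  · revert y
    simp only [List.mem_cons, List.not_mem_nil, or_false, forall_eq_or_imp, forall_eq]
    exact ⟨idxAct_lt _ _, idxAct_lt _ _⟩

theorem E_mem : g 8 ∈ H := by simpa [f4Img] using hg.mem 8 (by simp)

/-- Fixed elements in which one factor `E` occurs. -/
theorem mem_of_fixed_E {p q : List ℕ} (hp : IsRWord p) (hq : IsRWord q)
    (h : s (wordProd g p * g 8 * wordProd g q) = wordProd g p * g 8 * wordProd g q) :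
    wordProd g p * g 8 * wordProd g q ∈ H := by
  have hw : ∀ a ∈ p ++ 8 :: q, a ∈ List.range' 1 12 := by
    simp only [List.mem_append, List.mem_cons]
    rintro a (ha | rfl | ha)
    exacts [hp.mem_e6 a ha, by simp, hq.mem_e6 a ha]
  have e : wordProd g (p ++ 8 :: q) = wordProd g p * g 8 * wordProd g q := by
    rw [wordProd_append, wordProd_cons, mul_assoc]
  have h2 : ∀ q, IsRWord q → ∀ p, wordIdx (p ++ 8 :: q) 0 = wordIdx p 2 := by
    intro q hq p
    rw [wordIdx_append]
    change wordIdx p (idxAct 8 (wordIdx q 0)) = _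
    rw [wordIdx_zero hq]
    congr 1
  have hs8 : sigLetter 8 = 8 := by decide
  have hx := hg.idx_eq (x := 0) hw (by rw [e, h]) (by norm_num)
  simp only [List.map_append, List.map_cons, hs8, List.reverse_append, List.reverse_cons,
    List.append_assoc, List.cons_append, List.nil_append] at hx
  rw [h2 _ hq, h2 _ hq.map_sigLetter, h2 _ hp.reverse, h2 _ hp.map_sigLetter.reverse,
    wordIdx_map_sigLetter hp, ← List.map_reverse, wordIdx_map_sigLetter hq.reverse] at hx
  obtain ⟨k, hk, hpk⟩ := hg.exists_path hp
  obtain ⟨l, hl, hql⟩ := hg.exists_path_right hq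
  have hy1 := wordIdx_mem_roots hp (by simp : 2 ∈ List.range' 1 36)
  have hy2 := wordIdx_mem_roots hq.reverse (by simp : 2 ∈ List.range' 1 36)
  obtain ⟨a1, a2⟩ := hg.rootPath_mem hy1 hx.1.symm
  obtain ⟨b1, b2⟩ := hg.rootPath_mem hy2 hx.2.symm
  have hkl : IsRWord (k ++ l) := hk.append hl
  have hv := isRWord_flatMap_fixWord hkl
  have hv' : ∀ a ∈ 8 :: (k ++ l).flatMap fixWord, a ∈ List.range' 1 12 := by
    rw [List.forall_mem_cons]
    exact ⟨by simp, hv.mem_e6⟩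
  have hz : wordProd g p * g 8 * wordProd g q = wordProd g (rootPath (wordIdx p 2)) *
      (wordProd g (8 :: (k ++ l).flatMap fixWord) *
        wordProd g (rootPath (wordIdx q.reverse 2)).reverse) := by
    rw [hpk, hql, wordProd_cons, List.flatMap_append, wordProd_append, ← mul_assoc (g 8),
      ← hg.fixWord_comm hk]
    simp only [mul_assoc]
  have hf : s (wordProd g (8 :: (k ++ l).flatMap fixWord)) =
      wordProd g (8 :: (k ++ l).flatMap fixWord) := by
    have : wordProd g (8 :: (k ++ l).flatMap fixWord) =
        wordProd g (rootPath (wordIdx p 2)).reverse * (wordProd g p * g 8 * wordProd g q) *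
          wordProd g (rootPath (wordIdx q.reverse 2)) := by
      rw [hz, hg.reverse_mul_cancel (rootPath_isRWord _ hy1), mul_assoc,
        hg.wordProd_reverse_mul (rootPath_isRWord _ hy2), mul_one]
    rw [this, map_mul, map_mul, h, hg.fixed _ a2, hg.fixed _ b1]
  rw [hz]
  refine H.mul_mem a1 (H.mul_mem ?_ b2)
  rw [wordProd_cons]
  refine H.mul_mem hg.E_mem (hg.fixWord_mem hkl fun y hy => ?_)
  have hi : ∀ x < 512, wordIdx ((k ++ l).flatMap fixWord).reverse (idxAct 8 x) =
      wordIdx (((k ++ l).flatMap fixWord).map sigLetter).reverse (idxAct 8 x) := by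
    intro x hx
    have := (hg.idx_eq hv' hf hx).2
    rw [List.map_cons, hs8, List.reverse_cons, List.reverse_cons, wordIdx_append,
      wordIdx_append] at this
    exact this
  revert y
  simp only [List.mem_cons, List.not_mem_nil, or_false, forall_eq_or_imp, forall_eq]
  exact ⟨hi 1 (by norm_num), hi 3 (by norm_num)⟩

end IsFoldedSystem

/-- The letter `7` stands for the word of a level. -/
def levelSubst (L : ℕ) : ℕ → List ℕ
  | 7 => levelWord L
  | a => [a]

theorem IsRWord.flatMap_levelSubst {L : ℕ} {w : List ℕ} (hw : IsRWord w) :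
    w.flatMap (levelSubst L) = w := by
  induction w with
  | nil => rfl
  | cons a w ih =>
    obtain ⟨ha, hw⟩ := isRWord_cons.mp hw
    rw [List.flatMap_cons, ih hw]
    have : a ≠ 7 := by
      simp only [List.mem_range'_1] at ha
      omega
    rw [levelSubst]
    · rfl
    · exact this

theorem IsRWord.flatMap_levelLetter {w : List ℕ} (hw : IsRWord w) : w.flatMap levelLetter = w := by
  induction w with
  | nil => rfl
  | cons a w ih =>
    obtain ⟨ha, hw⟩ := isRWord_cons.mp hw
    rw [List.flatMap_cons, ih hw]
    have : a ≠ 7 := by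
      simp only [List.mem_range'_1] at ha
      omega
    rw [levelLetter]
    · rfl
    · exact this

theorem levelOk_iff {l r : List ℕ} (h : levelOk l r = true) :
    ((∃ l', l = 7 :: l') ∧ ∃ r', r = 7 :: r' ∧ IsRWord r') ∨
      (∃ a l', l = a :: l' ∧ a ≠ 7) ∧ IsRWord r := by
  cases l with
  | nil => exact absurd h (by simp [levelOk])
  | cons a l =>
    by_cases ha : a = 7
    · subst ha
      cases r with
      | nil => exact absurd h (by simp [levelOk])
      | cons b r =>
        have h' : (Nat.beq b 7 && r.all fun a => Nat.ble 1 a && Nat.ble a 6) = true := h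
        rw [Bool.and_eq_true, Nat.beq_eq] at h'
        exact .inl ⟨⟨l, rfl⟩, r, by rw [h'.1], isRWord_of_all h'.2⟩
    · refine .inr ⟨⟨a, l, rfl, ha⟩, isRWord_of_all ?_⟩
      have : Nat.beq a 7 = false := by rw [← Bool.not_eq_true, Nat.beq_eq]; exact ha
      rw [levelOk] at h
      simpa only [this] using h

theorem levelOk_preserves {p l q r : List ℕ} (h : levelOk l r = true)
    (hG : ∃ u, IsRWord u ∧ p ++ l ++ q = 7 :: u) : ∃ u, IsRWord u ∧ p ++ r ++ q = 7 :: u := by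
  obtain ⟨u, hu, he⟩ := hG
  have h7 : ¬ (7 ∈ u) := fun h => by simpa using hu 7 h
  rcases levelOk_iff h with ⟨⟨l, rfl⟩, r, rfl, hr⟩ | ⟨⟨a, l, rfl, ha⟩, hr⟩
  · cases p with
    | nil =>
      simp only [List.nil_append, List.cons_append, List.cons.injEq, true_and] at he
      subst he
      exact ⟨r ++ q, hr.append (isRWord_append.mp hu).2, rfl⟩
    | cons b p =>
      simp only [List.cons_append, List.cons.injEq] at he
      exact absurd (he.2 ▸ by simp) h7
  · cases p with
    | nil =>
      simp only [List.nil_append, List.cons_append, List.cons.injEq] at he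
      exact absurd he.1 ha
    | cons b p =>
      simp only [List.cons_append, List.cons.injEq] at he
      obtain ⟨rfl, rfl⟩ := he
      rw [isRWord_append, isRWord_append] at hu
      exact ⟨p ++ r ++ q, (hu.1.1.append hr).append hu.2, rfl⟩

theorem wordIdx_levelWord : ∀ L < 4, wordIdx (levelWord L).reverse 0 = wordIdx (levelWord L) 0 ∧
    wordIdx ((levelWord L).map sigLetter) 0 = wordIdx (levelWord L) 0 ∧
    wordIdx ((levelWord L).map sigLetter).reverse 0 = wordIdx (levelWord L) 0 := by
  decide +kernel

namespace IsE6System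

variable {M : Type*} [Monoid M] {g : ℕ → M} (hg : IsE6System g)

include hg

theorem levelWord_mul_self {L : ℕ} (hL : L < 4) :
    wordProd g (levelWord L) * wordProd g (levelWord L) = wordProd g (levelWord L) := by
  rw [← wordProd_append, hg.eq_of_e6Eq (e6_checks_level L hL).2.2.2.1]

theorem wordProd_levelWord_reverse {L : ℕ} (hL : L < 4) :
    wordProd g (levelWord L).reverse = wordProd g (levelWord L) :=
  hg.eq_of_e6Eq (e6_checks_level L hL).2.2.2.2

theorem levelWord_absorb {L : ℕ} (hL : L < 4) {r : List ℕ × List ℕ × List ℕ}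
    (hr : r ∈ levelAbsorb L) :
    wordProd g (levelWord L) * wordProd g r.2.2 = wordProd g (levelWord L) := by
  obtain ⟨h1, h2⟩ := (e6_checks_level L hL).2.2.1 r hr
  have h1 := hg.eq_of_e6Eq h1
  have h2 := hg.eq_of_e6Eq h2
  rw [wordProd_append] at h1 h2
  rw [← h1, mul_assoc, h2]

omit hg in
theorem wordProd_levelSubst (L : ℕ) {q : List ℕ} (hq : IsRWord q) :
    wordProd (fun a => wordProd g (levelSubst L a)) q = wordProd g q := by
  rw [← wordProd_flatMap, hq.flatMap_levelSubst]

omit hg in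
theorem wordProd_levelSubst_cons (L : ℕ) {q : List ℕ} (hq : IsRWord q) :
    wordProd (fun a => wordProd g (levelSubst L a)) (7 :: q) =
      wordProd g (levelWord L) * wordProd g q := by
  rw [wordProd_cons, wordProd_levelSubst L hq]
  rfl

theorem levelTrie_holds {L : ℕ} (hL : L < 4) :
    (levelTrie L).Holds fun a => wordProd g (levelSubst L a) := by
  have h : ∀ p ∈ levelRels L, wordProd (fun a => wordProd g (levelSubst L a)) p.1 =
      wordProd (fun a => wordProd g (levelSubst L a)) p.2 := by
    intro p hp
    unfold levelRels at hp
    rw [List.mem_append, List.mem_append] at hp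
    rcases hp with (hp | hp) | hp
    · have : ∀ p ∈ (e6Rels.filter fun p => (p.1 ++ p.2.1).all fun a => Nat.ble a 6),
          IsRWord p.1 ∧ IsRWord p.2.1 ∧ p ∈ e6Rels := by decide +kernel
      obtain ⟨r, hr, rfl⟩ := List.mem_map.mp hp
      obtain ⟨h1, h2, h3⟩ := this r hr
      rw [wordProd_levelSubst L h1, wordProd_levelSubst L h2]
      exact hg.rel (k := r.2.2) (.inl h3)
    · obtain ⟨r, hr, rfl⟩ := List.mem_map.mp hp
      have h1 : ∀ L < 4, ∀ r ∈ levelAbsorb L, IsRWord r.2.2 := by decide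
      rw [wordProd_levelSubst_cons L (h1 L hL r hr), hg.levelWord_absorb hL hr,
        wordProd_levelSubst_cons L isRWord_nil, wordProd_nil, mul_one]
    · split at hp
      · obtain rfl := List.mem_singleton.mp hp
        have hz := hg.levelStab_comm (L := 2) (s := [1, 3, 4, 5, 6, 5, 4, 3, 1]) hL (by simp [levelStab])
        have ha := hg.levelWord_absorb (L := 2) (r := ([], [9, 11], [2, 4, 3, 5, 4, 2])) hL
          (by simp [levelAbsorb])
        have hR : IsRWord [1, 3, 4, 5, 6, 5, 4, 3, 1] := by decide
        rw [wordProd_levelSubst_cons 2 (by decide), wordProd_levelSubst_cons 2 isRWord_nil,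
          wordProd_nil, mul_one]
        change _ * wordProd g ([1, 3, 4, 5, 6, 5, 4, 3, 1] ++ ([2, 4, 3, 5, 4, 2] ++
          [1, 3, 4, 5, 6, 5, 4, 3, 1].reverse)) = _
        rw [wordProd_append, wordProd_append, ← mul_assoc, ← hz, mul_assoc,
          ← mul_assoc (wordProd g (levelWord 2)), ha, ← mul_assoc, hz, mul_assoc, hg.wordProd_mul_reverse hR, mul_one]
      · exact absurd hp (by simp)
  unfold levelTrie
  generalize levelSteps L = cs
  exact RuleTrie.complete_holds e6Wt h cs

end IsE6System

namespace IsFoldedSystem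

variable {M : Type*} [Monoid M] {g : ℕ → M} {s : M →* M} {H : Submonoid M}
  (hg : IsFoldedSystem g s H)

include hg

theorem mem_of_identity {l f : List ℕ} (h : (l, f.flatMap f4Img) ∈ e6Identities)
    (hf : ∀ a ∈ f, a ∈ List.range' 1 8) : wordProd g l ∈ H := by
  rw [hg.eq_of_mem h]
  exact hg.mem_flatMap hf

theorem levelWord_two_mem : wordProd g (levelWord 2) ∈ H := hg.mem 6 (by simp)

theorem levelWord_three_mem : wordProd g (levelWord 3) ∈ H :=
  hg.mem_flatMap (f := [6, 8]) (by simp)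

theorem levelStarts_two_mem {w : List ℕ} (hw : w ∈ levelStarts 2) :
    wordProd (fun a => wordProd g (levelSubst 2 a)) w ∈ H := by
  have h43 : wordProd g (levelWord 2) * wordProd g [4, 3] ∈ H := by
    have := hg.eq_of_mem (p := ([9, 11, 4, 3], [9, 11, 10])) (by
      simp only [e6Identities, List.mem_append]
      exact .inr <| .tail _ <| .tail _ <| .head _)
    rw [← wordProd_append]
    change wordProd g [9, 11, 4, 3] ∈ H
    rw [this]
    exact hg.mem_flatMap (f := [6, 7]) (by simp)
  have h2 : wordProd g [2] ∈ H := hg.singles_mem _ (by simp)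
  have hz : wordProd g [1, 3, 4, 5, 6, 5, 4, 3, 1] ∈ H := by
    refine hg.mem_of_identity (f := [1, 2, 3, 2, 1]) ?_ (by decide)
    simp only [e6Identities, List.mem_append]
    exact .inr <| .tail _ <| .head _
  have key : ∀ t ∈ levelStab 2, wordProd g t ∈ H → ∀ u, IsRWord u →
      wordProd g (levelWord 2) * wordProd g u ∈ H →
        wordProd g (levelWord 2) * wordProd g (t ++ u) ∈ H := by
    intro t ht htH u hu h
    rw [wordProd_append, ← mul_assoc, ← hg.levelStab_comm (by norm_num) ht, mul_assoc]
    exact H.mul_mem htH h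
  have h1 : ∀ w ∈ levelStarts 2, ∃ q, w = 7 :: q ∧ IsRWord q ∧
      (q = [] ∨ q = [4, 3] ∨ q = [2] ++ [4, 3] ∨ q = [1, 3, 4, 5, 6, 5, 4, 3, 1] ++ [4, 3] ∨
        q = [1, 3, 4, 5, 6, 5, 4, 3, 1] ++ ([2] ++ [4, 3])) := by
    simp only [levelStarts, List.forall_mem_cons]
    refine ⟨⟨_, rfl, ?_⟩, ⟨_, rfl, ?_⟩, ⟨_, rfl, ?_⟩, ⟨_, rfl, ?_⟩, ⟨_, rfl, ?_⟩, by simp⟩ <;> decide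
  obtain ⟨q, rfl, hq, h⟩ := h1 w hw
  rw [IsE6System.wordProd_levelSubst_cons 2 hq]
  rcases h with rfl | rfl | rfl | rfl | rfl
  · simpa using hg.levelWord_two_mem
  · exact h43
  · exact key _ (by decide) h2 _ (by decide) h43
  · exact key _ (by decide) hz _ (by decide) h43
  · exact key _ (by decide) hz _ (by decide) (key _ (by decide) h2 _ (by decide) h43)

theorem levelStarts_three_mem {w : List ℕ} (hw : w ∈ levelStarts 3) :
    wordProd (fun a => wordProd g (levelSubst 3 a)) w ∈ H := by
  have h1 : ∀ w ∈ levelStarts 3, ∃ q, w = 7 :: q ∧ IsRWord q ∧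
      (q = [] ∨ q = [4, 3] ∨
        q = [6, 1, 3, 4, 5, 3, 2, 1] ++ ([4, 3] ++ [6, 1, 3, 4, 5, 3, 2, 1].reverse)) := by
    simp only [levelStarts, List.forall_mem_cons]
    refine ⟨⟨_, rfl, ?_⟩, ⟨_, rfl, ?_⟩, ⟨_, rfl, ?_⟩, by simp⟩ <;> decide
  obtain ⟨q, rfl, hq, h⟩ := h1 w hw
  rw [IsE6System.wordProd_levelSubst_cons 3 hq]
  rcases h with rfl | rfl | rfl
  · simpa using hg.levelWord_three_mem
  · have := hg.eq_of_mem (p := ([9, 11, 8, 4, 3], [9, 11, 8, 10])) (by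
      simp only [e6Identities, List.mem_append]
      exact .inr <| .tail _ <| .tail _ <| .tail _ <| .head _)
    rw [← wordProd_append]
    change wordProd g [9, 11, 8, 4, 3] ∈ H
    rw [this]
    exact hg.mem_flatMap (f := [6, 8, 7]) (by simp)
  · have hR : IsRWord [6, 1, 3, 4, 5, 3, 2, 1] := by decide
    have h3 := hg.mul_rootWord hR (x := 3) (by simp)
    have h4 := hg.mul_rootWord hR (x := 4) (by simp)
    have e3 : wordIdx [6, 1, 3, 4, 5, 3, 2, 1] 3 = 3 := by decide +kernel
    have e4 : wordIdx [6, 1, 3, 4, 5, 3, 2, 1] 4 = 30 := by decide +kernel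
    rw [e3, hg.wordProd_rootWord (by simp)] at h3
    rw [e4, hg.wordProd_rootWord (by simp)] at h4
    have h30 : wordProd g (rootWord 30) ∈ H := by
      obtain ⟨h, h'⟩ := hg.rootPath_mem (x := 30) (by simp) (by decide +kernel)
      rw [IsE6System.wordProd_rootWord_eq]
      exact H.mul_mem h (H.mul_mem hg.E_mem h')
    have h910 := hg.eq_of_mem (p := ([9, 10], [9, 4, 3])) (by
      simp only [e6Identities, List.mem_append]
      exact .inr <| .tail _ <| .tail _ <| .tail _ <| .tail _ <| .head _)
    rw [wordProd_cons, wordProd_cons, wordProd_nil, mul_one, wordProd_cons] at h910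
    have hX : wordProd g (levelWord 3) = wordProd g [11, 8] * g 9 := by
      have h1 := hg.rel (l := [9, 11]) (r := [11, 9]) (k := 0) (by decide)
      have h2 := hg.rel (l := [9, 8]) (r := [8, 9]) (k := 0) (by decide)
      simp only [wordProd_cons, wordProd_nil, mul_one] at h1 h2
      change wordProd g [9, 11, 8] = _
      simp only [wordProd_cons, wordProd_nil, mul_one]
      rw [← mul_assoc, h1, mul_assoc, h2, mul_assoc]
    have hE : g 9 * wordProd g (rootWord 30) = g 9 * wordProd g
        ([6, 1, 3, 4, 5, 3, 2, 1] ++ ([4, 3] ++ [6, 1, 3, 4, 5, 3, 2, 1].reverse)) := by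
      generalize [6, 1, 3, 4, 5, 3, 2, 1] = p at h3 h4 hR
      have : wordProd g (rootWord 30) = wordProd g p * g 10 * wordProd g p.reverse := by
        rw [h4, mul_assoc, hg.wordProd_mul_reverse hR, mul_one]
      rw [this, wordProd_append, wordProd_append, ← mul_assoc, ← mul_assoc, ← mul_assoc,
        ← mul_assoc, ← h3, mul_assoc (wordProd g p), mul_assoc (wordProd g p), h910]
      simp only [mul_assoc]
    rw [hX, mul_assoc, ← hE, ← mul_assoc, ← hX]
    exact H.mul_mem hg.levelWord_three_mem h30

theorem levelWord_append_mem {L : ℕ} (hL : L ∈ List.range' 2 2) {q : List ℕ} (hq : IsRWord q)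
    (h : wordIdx q.reverse (wordIdx (levelWord L) 0) =
      wordIdx (q.map sigLetter).reverse (wordIdx (levelWord L) 0)) :
    wordProd g (levelWord L ++ q) ∈ H := by
  have hL4 : L < 4 := by simp only [List.mem_range'_1] at hL; omega
  have hs : ∀ w ∈ levelStarts L, wordProd (fun a => wordProd g (levelSubst L a)) w ∈ H := by
    have : L = 2 ∨ L = 3 := by simp only [List.mem_range'_1] at hL; omega
    rcases this with rfl | rfl
    exacts [fun w => hg.levelStarts_two_mem, fun w => hg.levelStarts_three_mem]
  have hc := List.all_eq_true.mp levelTrie_check L hL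
  have ht := hg.levelTrie_holds hL4
  generalize levelTrie L = t at hc ht
  rw [Bool.and_eq_true] at hc
  obtain ⟨w, ⟨u, hu, rfl⟩, he, hi⟩ := RuleTrie.exists_irr ht
    (G := fun w => ∃ u, IsRWord u ∧ w = 7 :: u) hc.1
    (fun p l q r hr hG => levelOk_preserves hr hG) (7 :: q) ⟨q, hq, rfl⟩
  have he' := he
  rw [IsE6System.wordProd_levelSubst_cons L hu, IsE6System.wordProd_levelSubst_cons L hq, ← wordProd_append,
    ← wordProd_append] at he'
  rw [wordProd_append, ← IsE6System.wordProd_levelSubst_cons L hq, ← he]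
  obtain ⟨r1, r2, r3⟩ := wordIdx_levelWord L hL4
  refine wordProd_mem_of_fixedCheck (w := [7]) (q := u) ht hc.2 (fun b hb => ?_) hs hu hi fun y hy => ?_
  · have : ∀ b ∈ [[1, 6], [3, 5], [4], [2]], IsRWord b := by decide
    rw [IsE6System.wordProd_levelSubst L (this b hb)]
    exact hg.singles_mem b hb
  · obtain rfl := List.mem_singleton.mp hy
    have hf : ([7] ++ u).flatMap levelLetter = u := hu.flatMap_levelLetter
    have hm : ∀ v, IsRWord v → ∀ a ∈ levelWord L ++ v, a ∈ List.range' 1 12 := by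
      intro v hv a ha
      rcases List.mem_append.mp ha with ha | ha
      exacts [levelWord_mem L hL4 a ha, hv.mem_e6 a ha]
    have key := hg.idx_congr (x := 0) (hm u hu) (hm q hq) he' (by norm_num)
    simp only [List.map_append, List.reverse_append, wordIdx_append, r1, r3] at key
    rw [hf]
    exact key h

theorem mem_of_fixed_level {L : ℕ} (hL : L ∈ List.range' 2 2) {p q : List ℕ} (hp : IsRWord p)
    (hq : IsRWord q) (h : s (wordProd g p * wordProd g (levelWord L) * wordProd g q) =
      wordProd g p * wordProd g (levelWord L) * wordProd g q) :
    wordProd g p * wordProd g (levelWord L) * wordProd g q ∈ H := by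
  have hL4 : L < 4 := by simp only [List.mem_range'_1] at hL; omega
  have hw : ∀ a ∈ p ++ levelWord L ++ q, a ∈ List.range' 1 12 := by
    simp only [List.mem_append]
    rintro a ((ha | ha) | ha)
    exacts [hp.mem_e6 a ha, levelWord_mem L hL4 a ha, hq.mem_e6 a ha]
  obtain ⟨r1, r2, r3⟩ := wordIdx_levelWord L hL4
  rw [← wordProd_append, ← wordProd_append] at h
  have hx := hg.idx_eq (x := 0) hw h (by norm_num)
  simp only [List.map_append, List.reverse_append, wordIdx_append, r1, r2, r3, wordIdx_zero hq,
    wordIdx_zero hq.map_sigLetter, wordIdx_zero hp.reverse, wordIdx_zero hp.map_sigLetter.reverse] at hx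
  have h1 := hg.levelWord_append_mem hL hq hx.2
  have h2 := hg.op.levelWord_append_mem hL hp.reverse (by
    rw [List.reverse_reverse, List.map_reverse, List.reverse_reverse]
    exact hx.1)
  rw [wordProd_append, ← hg.op.wordProd_levelWord_reverse hL4, ← op_wordProd, ← op_wordProd] at h2
  have h2' : wordProd g p * wordProd g (levelWord L) ∈ H := h2
  have := H.mul_mem h2' h1
  rwa [wordProd_append, mul_assoc, ← mul_assoc (wordProd g (levelWord L)),
    hg.levelWord_mul_self hL4, ← mul_assoc] at this

/-- All fixed products of generators are in the given submonoid. -/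
theorem mem_of_fixed {w : List ℕ} (hw : ∀ a ∈ w, a ∈ List.range' 1 12)
    (h : s (wordProd g w) = wordProd g w) : wordProd g w ∈ H := by
  obtain ⟨L, hL, p, q, hp, hq, e⟩ := hg.levelForm hw
  rw [e] at h ⊢
  interval_cases L
  · have : wordProd g p * wordProd g (levelWord 0) * wordProd g q = wordProd g (p ++ q) := by
      rw [wordProd_append]
      change _ * wordProd g [] * _ = _
      rw [wordProd_nil, mul_one]
    rw [this] at h ⊢
    exact hg.mem_of_fixed_R (hp.append hq) h
  · have : wordProd g (levelWord 1) = g 8 := by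
      change wordProd g [8] = _
      simp
    rw [this] at h ⊢
    exact hg.mem_of_fixed_E hp hq h
  · exact hg.mem_of_fixed_level (by simp) hp hq h
  · exact hg.mem_of_fixed_level (by simp) hp hq h

end IsFoldedSystem

/-! ### The fixed subalgebra -/

theorem wordIdx_lt {w : List ℕ} {x : ℕ} (hx : x < 512) : wordIdx w x < 512 := by
  cases w with
  | nil => exact hx
  | cons a w => exact idxAct_lt _ _

/-- Products of generators which agree up to powers of `δ` act in the same way. -/
theorem wordState_eq_of_unitClass {v w : List ℕ} (hv : ∀ a ∈ v, a ∈ List.range' 1 12)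
    (hw : ∀ a ∈ w, a ∈ List.range' 1 12)
    (h : unitClass BrE6 (wordProd e6Gen v) = unitClass BrE6 (wordProd e6Gen w)) :
    wordState v (id, id) = wordState w (id, id) := by
  obtain ⟨k, hk⟩ := unitClass_eq_iff.mp h
  have h1 := congrArg (fun a => e6Rep a (Finsupp.single (id, id) 1)) hk
  simp only [map_smul, LinearMap.smul_apply] at h1
  rw [e6Rep_wordProd hv, e6Rep_wordProd hw, wordProd_actOp, wordProd_actOp,
    Finsupp.smul_single] at h1
  rcases (Finsupp.single_eq_single_iff _ _ _ _).mp h1 with ⟨h2, -⟩ | ⟨h2, -⟩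
  · exact h2
  · rw [δ_pow] at h2
    exact absurd h2 (isUnit_T _).ne_zero

theorem isE6System_unitClass : IsE6System fun a => unitClass BrE6 (e6Gen a) where
  rel h := by rw [← map_wordProd, ← map_wordProd, e6Gen_rel h, unitClass_smul]
  idx {v w} hv hw h x hx := by
    rw [← map_wordProd, ← map_wordProd] at h
    have hs := wordState_eq_of_unitClass hv hw h
    constructor
    · have := congrArg (fun s : (Fin 512 → Fin 512) × (Fin 512 → Fin 512) => (s.1 ⟨x, hx⟩ : ℕ)) hs
      simpa only [wordState_fst, id] using this
    · have := congrArg (fun s : (Fin 512 → Fin 512) × (Fin 512 → Fin 512) => (s.2 ⟨x, hx⟩ : ℕ)) hs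
      simp only [wordState_snd] at this
      simpa [Nat.mod_eq_of_lt (wordIdx_lt hx)] using this

/-- The action of an algebra automorphism on classes up to powers of `δ`. -/
noncomputable def unitClassMap {B : Type*} [Ring B] [Algebra Rring B] (σ : B ≃ₐ[Rring] B) :
    (unitCon B).Quotient →* (unitCon B).Quotient :=
  (unitCon B).lift ((unitClass B).comp (σ : B →* B)) fun a b h => by
    obtain ⟨k, rfl⟩ := h
    exact unitClass_eq_iff.mpr ⟨k, map_smul σ _ _⟩

theorem unitClassMap_unitClass {B : Type*} [Ring B] [Algebra Rring B] (σ : B ≃ₐ[Rring] B) (a : B) :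
    unitClassMap σ (unitClass B a) = unitClass B (σ a) := rfl

/-- Every monomial is a product of generators up to powers of `δ`. -/
theorem exists_wordProd_of_mem_BrMonE6 {a : BrE6} (ha : a ∈ BrMonE6) :
    ∃ w : List ℕ, (∀ b ∈ w, b ∈ List.range' 1 12) ∧
      unitClass BrE6 a = wordProd (fun b => unitClass BrE6 (e6Gen b)) w := by
  have hT : ∀ k : ℤ, unitClass BrE6 (algebraMap Rring BrE6 (T k)) = 1 := fun k => by
    rw [← map_one (unitClass BrE6)]
    exact unitClass_eq_iff.mpr ⟨k, by rw [Algebra.algebraMap_eq_smul_one]⟩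
  induction ha using Submonoid.closure_induction with
  | mem x hx =>
    rcases hx with ((rfl | rfl) | ⟨i, rfl⟩) | ⟨i, rfl⟩
    · exact ⟨[], by simp, by rw [δ, hT, wordProd_nil]⟩
    · exact ⟨[], by simp, by rw [hT, wordProd_nil]⟩
    · exact ⟨[i + 1], by simp; omega, by simp [e6Gen_R]⟩
    · exact ⟨[6 + (i + 1)], by simp; omega, by simp [e6Gen_E]⟩
  | one => exact ⟨[], by simp, by simp⟩
  | mul x y _ _ hx hy =>
    obtain ⟨v, hv, hv'⟩ := hx
    obtain ⟨w, hw, hw'⟩ := hy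
    refine ⟨v ++ w, ?_, by rw [map_mul, hv', hw', wordProd_append]⟩
    simp only [List.mem_append]
    rintro a (h | h)
    exacts [hv a h, hw a h]

theorem adjoin_f4Gen :
    Algebra.adjoin Rring (f4Gen '' {a | a ∈ List.range' 1 8}) = ⊤ := by
  rw [eq_top_iff]
  intro x _
  have hx : x ∈ Submodule.span Rring ((fun w : List ℕ => wordProd f4Gen w.reverse) ''
      {w | (∀ a ∈ w, a ∈ List.range' 1 8) ∧ w ∈ f4Words}) := by
    rw [span_f4Words]
    trivial
  refine (Submodule.span_le (p := Subalgebra.toSubmodule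
    (Algebra.adjoin Rring (f4Gen '' {a | a ∈ List.range' 1 8})))).mpr ?_ hx
  rintro _ ⟨w, ⟨hw, -⟩, rfl⟩
  have key : ∀ w : List ℕ, (∀ a ∈ w, a ∈ List.range' 1 8) →
      wordProd f4Gen w ∈ Algebra.adjoin Rring (f4Gen '' {a | a ∈ List.range' 1 8}) := by
    intro w hw
    induction w with
    | nil => simp [one_mem]
    | cons a w ih =>
      rw [List.forall_mem_cons] at hw
      rw [wordProd_cons]
      exact mul_mem (Algebra.subset_adjoin ⟨a, hw.1, rfl⟩) (ih hw.2)
  exact key _ fun a ha => hw a (by simpa using ha)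

theorem e6Gen_mem_BrMonE6 {a : ℕ} (ha : a ∈ List.range' 1 12) : e6Gen a ∈ BrMonE6 := by
  obtain ⟨i, rfl | rfl⟩ : ∃ i : Fin 6, a = i + 1 ∨ a = 6 + (i + 1) := by
    revert a; decide
  · rw [e6Gen_R]
    exact Submonoid.subset_closure (.inl (.inr ⟨i, rfl⟩))
  · rw [e6Gen_E]
    exact Submonoid.subset_closure (.inr ⟨i, rfl⟩)

theorem map_e6Gen {σ : BrE6 ≃ₐ[Rring] BrE6} (hσR : ∀ i : Fin 6, σ (Rgen i) = Rgen (τ i))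
    (hσE : ∀ i : Fin 6, σ (Egen i) = Egen (τ i)) {a : ℕ} (ha : a ∈ List.range' 1 12) :
    σ (e6Gen a) = e6Gen (sigLetter a) := by
  have key : ∀ i : Fin 6, sigLetter (i + 1) = τ i + 1 ∧ sigLetter (6 + (i + 1)) = 6 + (τ i + 1) := by
    decide
  obtain ⟨i, rfl | rfl⟩ : ∃ i : Fin 6, a = i + 1 ∨ a = 6 + (i + 1) := by
    clear key
    revert a; decide
  · rw [e6Gen_R, (key i).1, e6Gen_R, hσR]
  · rw [e6Gen_E, (key i).2, e6Gen_E, hσE]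

namespace IsFolding

variable {σ : BrE6 ≃ₐ[Rring] BrE6} (hσR : ∀ i : Fin 6, σ (Rgen i) = Rgen (τ i))
  (hσE : ∀ i : Fin 6, σ (Egen i) = Egen (τ i)) {φ : BrF4 →ₐ[Rring] BrE6} (hφ : IsFolding φ)

include hσR hσE hφ

theorem map_f4Gen {a : ℕ} (ha : a ∈ List.range' 1 8) :
    φ (f4Gen a) ∈ BrMonE6 ∧ σ (φ (f4Gen a)) = φ (f4Gen a) := by
  rw [hφ a ha]
  constructor
  · have key : ∀ w : List ℕ, (∀ b ∈ w, b ∈ List.range' 1 12) → wordProd e6Gen w ∈ BrMonE6 := by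
      intro w hw
      induction w with
      | nil => simp [one_mem]
      | cons b w ih =>
        rw [List.forall_mem_cons] at hw
        rw [wordProd_cons]
        exact mul_mem (e6Gen_mem_BrMonE6 hw.1) (ih hw.2)
    exact key _ (f4Img_mem a ha)
  · have key : ∀ a ∈ List.range' 1 8, ((f4Img a).map sigLetter = f4Img a ∨
        e6Rel ((f4Img a).map sigLetter) (f4Img a) 0) := by decide
    have hm : σ (wordProd e6Gen (f4Img a)) = wordProd e6Gen ((f4Img a).map sigLetter) := by
      have : ∀ w : List ℕ, (∀ b ∈ w, b ∈ List.range' 1 12) →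
          σ (wordProd e6Gen w) = wordProd e6Gen (w.map sigLetter) := by
        intro w hw
        induction w with
        | nil => simp
        | cons b w ih =>
          rw [List.forall_mem_cons] at hw
          rw [wordProd_cons, map_mul, map_e6Gen hσR hσE hw.1, ih hw.2, List.map_cons, wordProd_cons]
      exact this _ (f4Img_mem a ha)
    rw [hm]
    rcases key a ha with h | h
    · rw [h]
    · simpa using e6Gen_rel h

theorem map_apply (b : BrF4) : σ (φ b) = φ b := by
  have : (σ : BrE6 →ₐ[Rring] BrE6).comp φ = φ := by
    refine AlgHom.ext_of_adjoin_eq_top adjoin_f4Gen ?_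
    rintro _ ⟨a, ha, rfl⟩
    exact (hφ.map_f4Gen hσR hσE ha).2
  exact DFunLike.congr_fun this b

theorem isFoldedSystem : IsFoldedSystem (fun a => unitClass BrE6 (e6Gen a)) (unitClassMap σ)
    (MonoidHom.mrange ((unitClass BrE6).comp (φ : BrF4 →* BrE6))) where
  toIsE6System := isE6System_unitClass
  sig a ha := by rw [unitClassMap_unitClass, map_e6Gen hσR hσE ha]
  mem a ha := ⟨f4Gen a, by
    rw [← map_wordProd]
    exact congrArg (unitClass BrE6) (hφ a ha)⟩
  fixed := by
    rintro _ ⟨b, rfl⟩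
    exact congrArg (unitClass BrE6) (hφ.map_apply hσR hσE b)

theorem range_eq : φ.range = SBrE6 σ := by
  refine le_antisymm ?_ (Algebra.adjoin_le ?_)
  · rw [← Algebra.map_top, ← adjoin_f4Gen, AlgHom.map_adjoin, Set.image_image]
    refine Algebra.adjoin_mono ?_
    rintro _ ⟨a, ha, rfl⟩
    exact hφ.map_f4Gen hσR hσE ha
  · rintro a ⟨ha, hσ⟩
    obtain ⟨w, hw, he⟩ := exists_wordProd_of_mem_BrMonE6 ha
    have h := (hφ.isFoldedSystem hσR hσE).mem_of_fixed hw (by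
      rw [← he, unitClassMap_unitClass, hσ])
    obtain ⟨b, hb⟩ := h
    rw [← he] at hb
    obtain ⟨k, hk⟩ := unitClass_eq_iff.mp hb.symm
    exact ⟨(T k : Rring) • b, (map_smul φ _ _).trans hk.symm⟩

end IsFolding

/-- The homomorphism `φ : Br(F₄) → Br(E₆)` (with the prescribed images of the
generators) is injective with image `SBr(E₆)`; in particular it induces an isomorphism
`Br(F₄) ≅ SBr(E₆)`.  Here `σ` is the algebra automorphism of `Br(E₆)` induced by the diagram
automorphism `(1 6)(3 5)`. -/
theorem brF4_iso_SBrE6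
    (σ : BrE6 ≃ₐ[Rring] BrE6)
    (hσR : ∀ i : Fin 6, σ (Rgen i) = Rgen (τ i))
    (hσE : ∀ i : Fin 6, σ (Egen i) = Egen (τ i))
    (φ : BrF4 →ₐ[Rring] BrE6)
    (h1 : φ (rgen 0) = Rgen 0 * Rgen 5) (h2 : φ (rgen 1) = Rgen 2 * Rgen 4)
    (h3 : φ (rgen 2) = Rgen 3) (h4 : φ (rgen 3) = Rgen 1)
    (h5 : φ (egen 0) = Egen 0 * Egen 5) (h6 : φ (egen 1) = Egen 2 * Egen 4)
    (h7 : φ (egen 2) = Egen 3) (h8 : φ (egen 3) = Egen 1) :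
    Function.Injective φ ∧ φ.range = SBrE6 σ ∧ Nonempty (BrF4 ≃ₐ[Rring] SBrE6 σ) := by
  have hφ : IsFolding φ := by
    intro a ha
    fin_cases ha <;> simp [f4Gen, f4Img, e6Gen, h1, h2, h3, h4, h5, h6, h7, h8]
  have hr := hφ.range_eq hσR hσE
  exact ⟨hφ.injective, hr,
    ⟨(AlgEquiv.ofInjective φ hφ.injective).trans (Subalgebra.equivOfEq _ _ hr)⟩⟩
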